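/- Under the multi-layer network assumptions, almost surely as n → ∞, (1/n)‖K^NTK − (r₊ Id + X_LᵀX_L + Σ_{ℓ=0}^{L−1} q_ℓ X_ℓᵀX_ℓ)‖_F² → 0, where ‖·‖_F is the Frobenius norm. Furthermore, there is a constant C > 0 such that almost surely ‖K^NTK‖ ≤ C for all large n. Consequently, the empirical eigenvalue distributions of K^NTK and of r₊ Id + X_LᵀX_L + Σ_{ℓ=0}^{L−1} q_ℓ X_ℓᵀX_ℓ have the same almost-sure weak limit whenever one exists. -/

import Mathlib

/-!
Lemma (NTK approximation): under the multi-layer network assumptions,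
`(1/n)‖K^NTK − (r₊Id + X_LᵀX_L + Σ_ℓ q_ℓ X_ℓᵀX_ℓ)‖_F² → 0` almost surely, `‖K^NTK‖ ≤ C`
almost surely for all large `n`, and consequently the empirical spectral distributions of
the two matrices have the same almost-sure weak limits.
-/

open MeasureTheory ProbabilityTheory Filter Topology Matrix

noncomputable abbrev stdGaussian : Measure ℝ := gaussianReal 0 1

noncomputable abbrev gaussianVec (d : ℕ) : Measure (Fin d → ℝ) :=
  Measure.pi fun _ => stdGaussian

noncomputable abbrev gaussianMat (a b : ℕ) : Measure (Fin a → Fin b → ℝ) :=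
  Measure.pi fun _ => gaussianVec b

/-- ℓ₂→ℓ₂ operator norm of a real matrix. -/
noncomputable def opNorm {m n : ℕ} (X : Matrix (Fin m) (Fin n) ℝ) : ℝ :=
  ‖LinearMap.toContinuousLinearMap (Matrix.toEuclideanLin X)‖

/-- Squared Frobenius norm. -/
def frobSq {m n : ℕ} (X : Matrix (Fin m) (Fin n) ℝ) : ℝ :=
  ∑ i, ∑ j, (X i j) ^ 2

/-- `(ε,B)`-orthonormality of the columns of a matrix. -/
def IsOrthonormal {d n : ℕ} (ε B : ℝ) (X : Matrix (Fin d) (Fin n) ℝ) : Prop :=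
  (∀ α : Fin n, |(∑ i, X i α ^ 2) - 1| ≤ ε) ∧
  (∀ α β : Fin n, α ≠ β → |∑ i, X i α * X i β| ≤ ε) ∧
  opNorm X ≤ B ∧
  ∑ α : Fin n, ((∑ i, X i α ^ 2) - 1) ^ 2 ≤ B ^ 2

open Classical in
/-- Integral of `f` against the empirical eigenvalue distribution of a symmetric matrix. -/
noncomputable def esd {n : ℕ} (M : Matrix (Fin n) (Fin n) ℝ) (f : ℝ → ℝ) : ℝ :=
  if h : M.IsHermitian then (n : ℝ)⁻¹ * ∑ α, f (h.eigenvalues α) else 0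

/-- The layers `X_ℓ = σ(W_ℓ X_{ℓ-1})/√d_ℓ` of the network. -/
noncomputable def netLayer (σ : ℝ → ℝ) (d : ℕ → ℕ) (n : ℕ)
    (W : (ℓ : ℕ) → Fin (d (ℓ + 1)) → Fin (d ℓ) → ℝ)
    (X0 : Matrix (Fin (d 0)) (Fin n) ℝ) : (ℓ : ℕ) → Matrix (Fin (d ℓ)) (Fin n) ℝ
  | 0 => X0
  | ℓ + 1 => (Real.sqrt (d (ℓ + 1)))⁻¹ • ((Matrix.of (W ℓ) * netLayer σ d n W X0 ℓ).map σ)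

/-- The pre-activations `W_{ℓ+1} X_ℓ` of the network. -/
noncomputable def preact (σ : ℝ → ℝ) (d : ℕ → ℕ) (n : ℕ)
    (W : (ℓ : ℕ) → Fin (d (ℓ + 1)) → Fin (d ℓ) → ℝ)
    (X0 : Matrix (Fin (d 0)) (Fin n) ℝ) (ℓ : ℕ) : Matrix (Fin (d (ℓ + 1))) (Fin n) ℝ :=
  Matrix.of (W ℓ) * netLayer σ d n W X0 ℓ

lemma gv_iIndep (d : ℕ) : iIndepFun (fun (i : Fin d) (w : Fin d → ℝ) => w i) (gaussianVec d) := by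
  have := iIndepFun_pi (μ := fun _ : Fin d => (gaussianReal 0 1)) (X := fun _ x => x) (fun i => aemeasurable_id)
  exact this

instance gv_isGaussian (d : ℕ) : IsGaussian (gaussianVec d) := by
  have h := iIndepFun.hasGaussianLaw (X := fun (i : Fin d) (w : Fin d → ℝ) => w i) (P := gaussianVec d) ?_ (gv_iIndep d)
  · have := h.isGaussian_map
    rwa [show (fun w : Fin d → ℝ => fun i => w i) = id from rfl, Measure.map_id] at this
  · intro i
    refine ⟨?_⟩
    rw [(measurePreserving_eval (fun _ : Fin d => gaussianReal 0 1) i).map_eq]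
    infer_instance

lemma gv_integral_id (d : ℕ) : ∫ w, w ∂(gaussianVec d) = 0 := by
  ext i
  have hi : Integrable (fun w : Fin d → ℝ => w) (gaussianVec d) := IsGaussian.integrable_id
  have := ContinuousLinearMap.integral_comp_comm (ContinuousLinearMap.proj (R := ℝ) (φ := fun _ : Fin d => ℝ) i) hi
  simp only [ContinuousLinearMap.proj_apply] at this
  rw [← this]
  have h2 := integral_map (μ := gaussianVec d) (φ := fun w => w i) (measurable_pi_apply i).aemeasurable
    (f := fun x : ℝ => x) (by fun_prop)
  rw [← h2, (measurePreserving_eval (fun _ : Fin d => gaussianReal 0 1) i).map_eq]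
  simp

lemma gv_memLp {d : ℕ} (i : Fin d) : MemLp (fun w : Fin d → ℝ => w i) 2 (gaussianVec d) := by
  exact IsGaussian.memLp_dual (gaussianVec d) (ContinuousLinearMap.proj (R := ℝ) (φ := fun _ : Fin d => ℝ) i) 2 (by norm_num)

lemma gv_cov1 {d : ℕ} (i j : Fin d) :
    cov[fun w : Fin d → ℝ => w i, fun w => w j; gaussianVec d] = if i = j then 1 else 0 := by
  split_ifs with h
  · subst h
    rw [covariance_self (measurable_pi_apply i).aemeasurable]
    have h2 := variance_map (μ := gaussianVec d) (X := fun x : ℝ => x) (Y := fun w : Fin d → ℝ => w i) (by fun_prop) (measurable_pi_apply i).aemeasurable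
    rw [(measurePreserving_eval (fun _ : Fin d => gaussianReal 0 1) i).map_eq] at h2
    simpa [Function.comp_def] using h2.symm
  · exact ((gv_iIndep d).indepFun h).covariance_eq_zero (gv_memLp i) (gv_memLp j)

lemma gv_cov {d : ℕ} (x y : Fin d → ℝ) :
    cov[fun w : Fin d → ℝ => ∑ i, w i * x i, fun w => ∑ i, w i * y i; gaussianVec d] = ∑ i, x i * y i := by
  rw [covariance_fun_sum_fun_sum (fun i => (gv_memLp i).mul_const _) (fun i => (gv_memLp i).mul_const _)]
  simp only [covariance_mul_const_left, covariance_mul_const_right, gv_cov1]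
  simp [Finset.sum_ite_eq]

/-- the linear functional `w ↦ w ⬝ x` -/
noncomputable def dotL {d : ℕ} (x : Fin d → ℝ) : (Fin d → ℝ) →L[ℝ] ℝ :=
  ∑ i, x i • ContinuousLinearMap.proj (R := ℝ) (φ := fun _ : Fin d => ℝ) i

lemma dotL_apply {d : ℕ} (x w : Fin d → ℝ) : dotL x w = ∑ i, w i * x i := by
  simp [dotL, mul_comm]

lemma gv_dot_integral {d : ℕ} (x : Fin d → ℝ) : ∫ w, (∑ i, w i * x i) ∂(gaussianVec d) = 0 := by
  have hi : Integrable (fun w : Fin d → ℝ => w) (gaussianVec d) := IsGaussian.integrable_id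
  have := ContinuousLinearMap.integral_comp_comm (dotL x) hi
  rw [gv_integral_id, map_zero] at this
  simpa [dotL_apply] using this

lemma gv_law {d : ℕ} (x : Fin d → ℝ) :
    (gaussianVec d).map (fun w => ∑ i, w i * x i) = gaussianReal 0 (Real.toNNReal (∑ i, x i ^ 2)) := by
  have h : HasGaussianLaw (fun w : Fin d → ℝ => ∑ i, w i * x i) (gaussianVec d) := by
    have := (IsGaussian.hasGaussianLaw_id (μ := gaussianVec d)).map (dotL x)
    refine this.congr ?_
    filter_upwards with w
    simp [dotL_apply]
  rw [h.map_eq_gaussianReal, gv_dot_integral, ← covariance_self (Measurable.aemeasurable (by fun_prop)), gv_cov]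
  simp [pow_two]

lemma gv_pair_indep {d : ℕ} (x y : Fin d → ℝ) (h : ∑ i, x i * y i = 0) :
    IndepFun (fun w : Fin d → ℝ => ∑ i, w i * x i) (fun w => ∑ i, w i * y i) (gaussianVec d) := by
  apply HasGaussianLaw.indepFun_of_covariance_eq_zero
  · have := (IsGaussian.hasGaussianLaw_id (μ := gaussianVec d)).map ((dotL x).prod (dotL y))
    refine this.congr ?_
    filter_upwards with w
    simp [dotL_apply]
  · rw [gv_cov, h]

lemma gv_rotation (d : ℕ) (θ : ℝ) :
    ((gaussianVec d).prod (gaussianVec d)).map (ContinuousLinearMap.rotation θ)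
      = (gaussianVec d).prod (gaussianVec d) :=
  IsGaussian.map_rotation_eq_self (by simpa using gv_integral_id d) θ

/-- Gaussian integral of `exp (a t²)`. -/
lemma gauss_exp_sq (a : ℝ) (ha : 0 ≤ a) (ha' : a ≤ 1/4) :
    ∫⁻ t, ENNReal.ofReal (Real.exp (a * t ^ 2)) ∂(gaussianReal 0 1) ≤ ENNReal.ofReal (Real.exp (2 * a)) := by
  rw [gaussianReal_of_var_ne_zero _ (by norm_num), lintegral_withDensity_eq_lintegral_mul _ (measurable_gaussianPDF _ _) (by fun_prop)]
  have hb : 0 < 1/2 - a := by linarith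
  have e : ∀ t : ℝ, (gaussianPDF 0 1 * fun t => ENNReal.ofReal (Real.exp (a * t ^ 2))) t
      = ENNReal.ofReal ((√(2 * Real.pi))⁻¹ * Real.exp (-(1/2 - a) * t ^ 2)) := by
    intro t
    simp only [Pi.mul_apply, gaussianPDF, gaussianPDFReal]
    rw [← ENNReal.ofReal_mul (by positivity), mul_assoc, ← Real.exp_add]
    simp
    congr 2
    ring_nf
  simp only [e]
  rw [← ofReal_integral_eq_lintegral_ofReal ((integrable_exp_neg_mul_sq hb).const_mul _) (by filter_upwards with t; positivity)]
  apply ENNReal.ofReal_le_ofReal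
  rw [integral_const_mul, integral_gaussian]
  rw [← Real.sqrt_inv, ← Real.sqrt_mul (by positivity)]
  have h1 : (2 * Real.pi)⁻¹ * (Real.pi / (1/2 - a)) = (1 - 2 * a)⁻¹ := by
    have := Real.pi_pos.ne'
    have h3 : 1 - 2 * a ≠ 0 := by linarith
    have h2 : 1/2 - a = (1 - 2 * a) / 2 := by ring
    rw [h2]
    field_simp
  rw [h1]
  apply Real.sqrt_le_iff.2 ⟨by positivity, ?_⟩
  rw [← Real.exp_nat_mul, inv_le_comm₀ (by linarith) (by positivity), ← Real.exp_neg]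
  have hq : 1 - 2 * a ≥ 1 / 2 := by linarith
  -- exp(-4a) ≤ 1 - 2a
  have h4 := Real.add_one_le_exp (4 * a)
  rw [Real.exp_neg]
  have : (Real.exp (((2:ℕ):ℝ) * (2 * a)))⁻¹ ≤ (4 * a + 1)⁻¹ := by
    rw [show ((2:ℕ):ℝ) * (2 * a) = 4 * a by push_cast; ring]
    gcongr
  refine this.trans ?_
  rw [inv_le_comm₀ (by linarith) (by linarith), inv_le_iff_one_le_mul₀ (by linarith)]
  nlinarith

lemma gaussianReal_sq_scale (s : ℝ) (hs : 0 ≤ s) :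
    gaussianReal 0 (Real.toNNReal s) = (gaussianReal 0 1).map (fun t => √s * t) := by
  rw [gaussianReal_map_const_mul]
  congr 1
  · simp
  · ext
    simp [Real.sq_sqrt hs, Real.coe_toNNReal _ hs]

lemma gv_law' {d : ℕ} (x : Fin d → ℝ) :
    (gaussianVec d).map (fun w => ∑ i, w i * x i) = (gaussianReal 0 1).map (fun t => √(∑ i, x i ^ 2) * t) := by
  rw [gv_law, gaussianReal_sq_scale]
  exact Finset.sum_nonneg fun i _ => sq_nonneg _

lemma gv_lintegral {d : ℕ} (x : Fin d → ℝ) (F : ℝ → ENNReal) (hF : Measurable F) :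
    ∫⁻ w, F (∑ i, w i * x i) ∂(gaussianVec d) = ∫⁻ t, F (√(∑ i, x i ^ 2) * t) ∂(gaussianReal 0 1) := by
  rw [← lintegral_map (f := F) (g := fun w : Fin d → ℝ => ∑ i, w i * x i) hF (by fun_prop), gv_law',
    lintegral_map hF (by fun_prop)]

lemma gv_integral {d : ℕ} (x : Fin d → ℝ) (F : ℝ → ℝ) (hF : Measurable F) :
    ∫ w, F (∑ i, w i * x i) ∂(gaussianVec d) = ∫ t, F (√(∑ i, x i ^ 2) * t) ∂(gaussianReal 0 1) := by
  rw [← integral_map (f := F) (φ := fun w : Fin d → ℝ => ∑ i, w i * x i) (Measurable.aemeasurable (by fun_prop)) hF.aestronglyMeasurable, gv_law',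
    integral_map (Measurable.aemeasurable (by fun_prop)) hF.aestronglyMeasurable]

lemma gv_exp_sq {d : ℕ} (x : Fin d → ℝ) (a : ℝ) (ha : 0 ≤ a) (h : a * ∑ i, x i ^ 2 ≤ 1/4) :
    ∫⁻ w, ENNReal.ofReal (Real.exp (a * (∑ i, w i * x i) ^ 2)) ∂(gaussianVec d)
      ≤ ENNReal.ofReal (Real.exp (2 * (a * ∑ i, x i ^ 2))) := by
  have hs : 0 ≤ ∑ i, x i ^ 2 := Finset.sum_nonneg fun i _ => sq_nonneg _
  rw [gv_lintegral x (fun t => ENNReal.ofReal (Real.exp (a * t ^ 2))) (by fun_prop)]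
  simp only [mul_pow, Real.sq_sqrt hs, ← mul_assoc]
  refine (gauss_exp_sq _ (by positivity) h).trans (le_of_eq ?_)
  ring_nf

lemma gv_exp_lin {d : ℕ} (x : Fin d → ℝ) :
    ∫⁻ w, ENNReal.ofReal (Real.exp (∑ i, w i * x i)) ∂(gaussianVec d)
      = ENNReal.ofReal (Real.exp ((∑ i, x i ^ 2) / 2)) := by
  have hs : 0 ≤ ∑ i, x i ^ 2 := Finset.sum_nonneg fun i _ => sq_nonneg _
  rw [gv_lintegral x (fun t => ENNReal.ofReal (Real.exp t)) (by fun_prop)]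
  have h1 := integrable_exp_mul_gaussianReal (μ := 0) (v := 1) (√(∑ i, x i ^ 2))
  rw [← ofReal_integral_eq_lintegral_ofReal h1 (by filter_upwards with t; positivity)]
  have h2 := congrFun (mgf_id_gaussianReal (μ := 0) (v := 1)) (√(∑ i, x i ^ 2))
  simp only [mgf, id] at h2
  rw [h2, Real.sq_sqrt hs]
  simp

lemma lintegral_pi_pow {E : Type*} [MeasurableSpace E] (ν : Measure E) [IsProbabilityMeasure ν] (d : ℕ)
    (F : E → ENNReal) (hF : Measurable F) :
    ∫⁻ w, ∏ i, F (w i) ∂(Measure.pi fun _ : Fin d => ν) = (∫⁻ x, F x ∂ν) ^ d := by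
  have hind := iIndepFun_pi (μ := fun _ : Fin d => ν) (X := fun _ x => F x) (fun i => hF.aemeasurable)
  rw [lintegral_prod_eq_prod_lintegral_of_indepFun _ (fun i (w : Fin d → E) => F (w i)) hind (fun i => by fun_prop)]
  have : ∀ i : Fin d, ∫⁻ w : Fin d → E, F (w i) ∂(Measure.pi fun _ : Fin d => ν) = ∫⁻ x, F x ∂ν := by
    intro i
    exact (measurePreserving_eval (fun _ : Fin d => ν) i).lintegral_comp hF
  simp [this]

lemma jensen_ofReal {E : Type*} [MeasurableSpace E] (μ : Measure E) [IsProbabilityMeasure μ]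
    (Φ : ℝ → ℝ) (hc : ConvexOn ℝ Set.univ Φ) (hcont : Continuous Φ) (hpos : ∀ x, 0 ≤ Φ x)
    (h : E → ℝ) (hi : Integrable h μ) :
    ENNReal.ofReal (Φ (∫ x, h x ∂μ)) ≤ ∫⁻ x, ENNReal.ofReal (Φ (h x)) ∂μ := by
  by_cases hI : Integrable (Φ ∘ h) μ
  · have := hc.map_integral_le hcont.continuousOn isClosed_univ (by simp) hi hI
    rw [← ofReal_integral_eq_lintegral_ofReal (f := fun x => Φ (h x)) hI (by filter_upwards with t; exact hpos _)]
    exact ENNReal.ofReal_le_ofReal this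
  · have hm : AEStronglyMeasurable (fun x => Φ (h x)) μ := hcont.comp_aestronglyMeasurable hi.1
    have : ∫⁻ x, ENNReal.ofReal (Φ (h x)) ∂μ = ⊤ := by
      by_contra hne
      apply hI
      refine ⟨hm, ?_⟩
      rw [hasFiniteIntegral_iff_ofReal (by filter_upwards with t; exact hpos _)]
      exact lt_top_iff_ne_top.2 hne
    rw [this]
    exact le_top

lemma maurey_pisier {d : ℕ} (f : (Fin d → ℝ) → ℝ) (g : (Fin d → ℝ) → (Fin d → ℝ))
    (hf : ∀ x, HasFDerivAt f (dotL (g x)) x) (hg : Continuous g)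
    (Φ : ℝ → ℝ) (hc : ConvexOn ℝ Set.univ Φ) (hcont : Continuous Φ) (hpos : ∀ x, 0 ≤ Φ x) :
    ∫⁻ p, ENNReal.ofReal (Φ (f p.2 - f p.1)) ∂((gaussianVec d).prod (gaussianVec d)) ≤
    ∫⁻ p, ENNReal.ofReal (Φ (Real.pi / 2 * ∑ j, p.2 j * g p.1 j)) ∂((gaussianVec d).prod (gaussianVec d)) := by
  have hpi : (0:ℝ) < Real.pi / 2 := by positivity
  let ν : Measure ℝ := (ENNReal.ofReal (Real.pi / 2))⁻¹ • volume.restrict (Set.Ioc 0 (Real.pi / 2))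
  have hν : IsProbabilityMeasure ν := by
    constructor
    simp only [ν, Measure.smul_apply, Measure.restrict_apply_univ, Real.volume_Ioc, sub_zero, smul_eq_mul]
    exact ENNReal.inv_mul_cancel (by simpa using Real.pi_pos) (by simp)
  let G : (Fin d → ℝ) × (Fin d → ℝ) → ℝ := fun p => Real.pi / 2 * ∑ j, p.2 j * g p.1 j
  have hG : Continuous G := by fun_prop
  have key : ∀ p : (Fin d → ℝ) × (Fin d → ℝ), ENNReal.ofReal (Φ (f p.2 - f p.1)) ≤
      ∫⁻ θ, ENNReal.ofReal (Φ (G (ContinuousLinearMap.rotation θ p))) ∂ν := by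
    intro p
    have hcθ : Continuous fun θ : ℝ => G (ContinuousLinearMap.rotation θ p) := by
      apply hG.comp
      simp only [ContinuousLinearMap.rotation_apply]
      fun_prop
    have hder : ∀ θ : ℝ, HasDerivAt (fun θ => f (ContinuousLinearMap.rotation θ p).1)
        ((Real.pi / 2)⁻¹ * G (ContinuousLinearMap.rotation θ p)) θ := by
      intro θ
      have h1 : HasDerivAt (fun θ => (ContinuousLinearMap.rotation θ p).1) (ContinuousLinearMap.rotation θ p).2 θ := by
        simp only [ContinuousLinearMap.rotation_apply]
        exact ((Real.hasDerivAt_cos θ).smul_const p.1).add ((Real.hasDerivAt_sin θ).smul_const p.2)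
      have h2 := (hf (ContinuousLinearMap.rotation θ p).1).comp_hasDerivAt θ h1
      have e : (Real.pi / 2)⁻¹ * G (ContinuousLinearMap.rotation θ p) =
          dotL (g (ContinuousLinearMap.rotation θ p).1) (ContinuousLinearMap.rotation θ p).2 := by
        rw [dotL_apply]
        simp only [G]
        rw [← mul_assoc, inv_mul_cancel₀ hpi.ne', one_mul]
      rw [e]
      exact h2
    have hint := intervalIntegral.integral_eq_sub_of_hasDerivAt (a := 0) (b := Real.pi / 2) (fun θ _ => hder θ)
      ((continuous_const.mul hcθ).intervalIntegrable _ _)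
    have h0 : (ContinuousLinearMap.rotation (Real.pi / 2) p).1 = p.2 := by
      simp [ContinuousLinearMap.rotation_apply]
    have h0' : (ContinuousLinearMap.rotation 0 p).1 = p.1 := by
      simp [ContinuousLinearMap.rotation_apply]
    rw [h0, h0'] at hint
    have hIν : Integrable (fun θ => G (ContinuousLinearMap.rotation θ p)) ν := by
      apply Integrable.smul_measure
      · exact (hcθ.integrableOn_Icc (a := 0) (b := Real.pi / 2)).mono_set Set.Ioc_subset_Icc_self
      · simpa using Real.pi_pos
    have : ∫ θ, G (ContinuousLinearMap.rotation θ p) ∂ν = f p.2 - f p.1 := by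
      rw [← hint, integral_smul_measure, intervalIntegral.integral_of_le hpi.le, integral_const_mul (Real.pi / 2)⁻¹,
        ENNReal.toReal_inv, ENNReal.toReal_ofReal hpi.le, smul_eq_mul]
    rw [← this]
    exact jensen_ofReal ν Φ hc hcont hpos _ hIν
  calc _ ≤ ∫⁻ p, ∫⁻ θ, ENNReal.ofReal (Φ (G (ContinuousLinearMap.rotation θ p))) ∂ν ∂((gaussianVec d).prod (gaussianVec d)) :=
        lintegral_mono key
    _ = ∫⁻ θ, ∫⁻ p, ENNReal.ofReal (Φ (G (ContinuousLinearMap.rotation θ p))) ∂((gaussianVec d).prod (gaussianVec d)) ∂ν := by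
        apply lintegral_lintegral_swap
        apply Measurable.aemeasurable
        have : Continuous fun q : ((Fin d → ℝ) × (Fin d → ℝ)) × ℝ => Φ (G (ContinuousLinearMap.rotation q.2 q.1)) := by
          apply hcont.comp (hG.comp _)
          simp only [ContinuousLinearMap.rotation_apply]
          fun_prop
        exact (this.measurable.ennreal_ofReal)
    _ = ∫⁻ θ, ∫⁻ p, ENNReal.ofReal (Φ (G p)) ∂((gaussianVec d).prod (gaussianVec d)) ∂ν := by
        congr 1
        ext θ
        conv_rhs => rw [← gv_rotation d θ]
        rw [lintegral_map]
        · exact (hcont.comp hG).measurable.ennreal_ofReal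
        · exact (ContinuousLinearMap.continuous _).measurable
    _ = _ := by simp [G]

lemma mp_centered {d : ℕ} (f : (Fin d → ℝ) → ℝ) (g : (Fin d → ℝ) → (Fin d → ℝ))
    (hf : ∀ x, HasFDerivAt f (dotL (g x)) x) (hg : Continuous g)
    (hfi : Integrable f (gaussianVec d))
    (Φ : ℝ → ℝ) (hc : ConvexOn ℝ Set.univ Φ) (hcont : Continuous Φ) (hpos : ∀ x, 0 ≤ Φ x) :
    ∫⁻ x, ENNReal.ofReal (Φ (f x - ∫ y, f y ∂(gaussianVec d))) ∂(gaussianVec d) ≤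
    ∫⁻ x, ∫⁻ y, ENNReal.ofReal (Φ (Real.pi / 2 * ∑ j, y j * g x j)) ∂(gaussianVec d) ∂(gaussianVec d) := by
  have hfc : Continuous f := continuous_iff_continuousAt.2 fun x => (hf x).continuousAt
  have h1 := maurey_pisier f g hf hg Φ hc hcont hpos
  rw [lintegral_prod_symm' _ (Continuous.measurable (by fun_prop)).ennreal_ofReal,
    lintegral_prod _ (Continuous.measurable (by fun_prop)).ennreal_ofReal.aemeasurable] at h1
  refine le_trans (lintegral_mono fun x => ?_) h1
  have := jensen_ofReal (gaussianVec d) Φ hc hcont hpos (fun y => f x - f y) ((integrable_const _).sub hfi)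
  rw [integral_sub (integrable_const _) hfi] at this
  simpa using this

lemma mp_exp {d : ℕ} (f : (Fin d → ℝ) → ℝ) (g : (Fin d → ℝ) → (Fin d → ℝ))
    (hf : ∀ x, HasFDerivAt f (dotL (g x)) x) (hg : Continuous g)
    (hfi : Integrable f (gaussianVec d)) (s : ℝ) :
    ∫⁻ x, ENNReal.ofReal (Real.exp (s * (f x - ∫ y, f y ∂(gaussianVec d)))) ∂(gaussianVec d) ≤
    ∫⁻ x, ENNReal.ofReal (Real.exp (2 * s ^ 2 * ∑ j, g x j ^ 2)) ∂(gaussianVec d) := by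
  have hconv : ConvexOn ℝ Set.univ (fun t : ℝ => Real.exp (s * t)) := by
    have := convexOn_exp.comp_linearMap (s • (LinearMap.id : ℝ →ₗ[ℝ] ℝ))
    simpa [Function.comp_def] using this
  refine (mp_centered f g hf hg hfi (fun t => Real.exp (s * t)) hconv (by fun_prop) (fun x => by positivity)).trans ?_
  refine lintegral_mono fun x => ?_
  have h := gv_exp_lin (fun j => s * (Real.pi / 2) * g x j)
  have e : ∀ y : Fin d → ℝ, ∑ i, y i * (s * (Real.pi / 2) * g x i) = s * (Real.pi / 2 * ∑ j, y j * g x j) := by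
    intro y
    rw [Finset.mul_sum, Finset.mul_sum]
    exact Finset.sum_congr rfl fun i _ => by ring
  simp only [e] at h
  rw [h]
  apply ENNReal.ofReal_le_ofReal
  apply Real.exp_le_exp.2
  have hp : Real.pi ^ 2 ≤ 16 := by nlinarith [Real.pi_le_four, Real.pi_pos]
  have hs : 0 ≤ ∑ j, g x j ^ 2 := Finset.sum_nonneg fun i _ => sq_nonneg _
  simp only [mul_pow, ← Finset.mul_sum]
  nlinarith [mul_nonneg (sq_nonneg s) hs]

lemma mp_exp_sq {d : ℕ} (f : (Fin d → ℝ) → ℝ) (g : (Fin d → ℝ) → (Fin d → ℝ))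
    (hf : ∀ x, HasFDerivAt f (dotL (g x)) x) (hg : Continuous g)
    (hfi : Integrable f (gaussianVec d)) (c M : ℝ) (hc0 : 0 ≤ c) (hM : ∀ x, ∑ j, g x j ^ 2 ≤ M)
    (hcM : 4 * c * M ≤ 1/4) :
    ∫⁻ x, ENNReal.ofReal (Real.exp (c * (f x - ∫ y, f y ∂(gaussianVec d)) ^ 2)) ∂(gaussianVec d) ≤
      ENNReal.ofReal (Real.exp 1) := by
  have hconv : ConvexOn ℝ Set.univ (fun t : ℝ => Real.exp (c * t ^ 2)) := by
    have h1 : ConvexOn ℝ Set.univ (fun t : ℝ => c * t ^ 2) := by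
      have := (even_two.convexOn_pow (𝕜 := ℝ)).smul hc0
      simpa using this
    refine ⟨convex_univ, fun x _ y _ a b ha hb hab => ?_⟩
    exact (Real.exp_le_exp.2 (h1.2 (Set.mem_univ x) (Set.mem_univ y) ha hb hab)).trans
      (convexOn_exp.2 (Set.mem_univ _) (Set.mem_univ _) ha hb hab)
  refine (mp_centered f g hf hg hfi (fun t => Real.exp (c * t ^ 2)) hconv (by fun_prop) (fun x => by positivity)).trans ?_
  have hx : ∀ x, ∫⁻ y, ENNReal.ofReal (Real.exp (c * (Real.pi / 2 * ∑ j, y j * g x j) ^ 2)) ∂(gaussianVec d)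
      ≤ ENNReal.ofReal (Real.exp 1) := by
    intro x
    have hp : Real.pi ^ 2 / 4 ≤ 4 := by nlinarith [Real.pi_le_four, Real.pi_pos]
    have hs : 0 ≤ ∑ j, g x j ^ 2 := Finset.sum_nonneg fun i _ => sq_nonneg _
    have hb : c * (Real.pi ^ 2 / 4) * ∑ j, g x j ^ 2 ≤ 1/4 := by
      calc c * (Real.pi ^ 2 / 4) * ∑ j, g x j ^ 2 ≤ c * 4 * M := by
            gcongr
            exact hM x
        _ ≤ 1/4 := by linarith
    have h := gv_exp_sq (g x) (c * (Real.pi ^ 2 / 4)) (by positivity) hb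
    refine le_trans (le_of_eq ?_) (h.trans (ENNReal.ofReal_le_ofReal (Real.exp_le_exp.2 (by linarith))))
    congr 1
    ext y
    congr 2
    ring
  refine (lintegral_mono hx).trans ?_
  simp

section opn
variable {m n p : ℕ}

lemma opNorm_nonneg (X : Matrix (Fin m) (Fin n) ℝ) : 0 ≤ opNorm X := norm_nonneg _

lemma eucl_norm_sq (v : Fin n → ℝ) : ‖(WithLp.toLp 2 v : EuclideanSpace ℝ (Fin n))‖ ^ 2 = ∑ i, v i ^ 2 := by
  rw [EuclideanSpace.norm_sq_eq]
  simp

lemma opNorm_apply_norm (X : Matrix (Fin m) (Fin n) ℝ) (v : Fin n → ℝ) :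
    ‖(LinearMap.toContinuousLinearMap (Matrix.toEuclideanLin X)) (WithLp.toLp 2 v)‖ ^ 2
      = ∑ i, (∑ j, X i j * v j) ^ 2 := by
  rw [EuclideanSpace.norm_sq_eq]
  simp [Matrix.toEuclideanLin, Matrix.mulVec, dotProduct]

lemma opNorm_bound (X : Matrix (Fin m) (Fin n) ℝ) (v : Fin n → ℝ) :
    ∑ i, (∑ j, X i j * v j) ^ 2 ≤ opNorm X ^ 2 * ∑ j, v j ^ 2 := by
  rw [← opNorm_apply_norm, ← eucl_norm_sq, ← mul_pow]
  gcongr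
  exact ContinuousLinearMap.le_opNorm _ _

lemma opNorm_bound' {X : Matrix (Fin m) (Fin n) ℝ} {C : ℝ} (h : opNorm X ≤ C) (v : Fin n → ℝ) :
    ∑ i, (∑ j, X i j * v j) ^ 2 ≤ C ^ 2 * ∑ j, v j ^ 2 := by
  refine (opNorm_bound X v).trans ?_
  have := opNorm_nonneg X
  gcongr

lemma opNorm_le_of (X : Matrix (Fin m) (Fin n) ℝ) (C : ℝ) (hC : 0 ≤ C)
    (h : ∀ v : Fin n → ℝ, ∑ i, (∑ j, X i j * v j) ^ 2 ≤ C ^ 2 * ∑ j, v j ^ 2) : opNorm X ≤ C := by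
  refine ContinuousLinearMap.opNorm_le_bound _ hC fun v => ?_
  have := h v.ofLp
  rw [← opNorm_apply_norm, ← eucl_norm_sq, ← mul_pow] at this
  exact le_of_sq_le_sq this (by positivity)

lemma opNorm_transpose_bound {X : Matrix (Fin m) (Fin n) ℝ} {C : ℝ} (h : opNorm X ≤ C) (u : Fin m → ℝ) :
    ∑ j, (∑ i, X i j * u i) ^ 2 ≤ C ^ 2 * ∑ i, u i ^ 2 := by
  set y : Fin n → ℝ := fun j => ∑ i, X i j * u i with hy
  have h1 : ∑ j, y j ^ 2 = ∑ i, u i * ∑ j, X i j * y j := by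
    simp only [Finset.mul_sum]
    rw [Finset.sum_comm]
    refine Finset.sum_congr rfl fun j _ => ?_
    rw [pow_two]
    conv_lhs => rw [hy]
    simp only
    rw [Finset.sum_mul]
    exact Finset.sum_congr rfl fun i _ => by simp only [hy]; ring
  have h2 : (∑ i, u i * ∑ j, X i j * y j) ^ 2 ≤ (∑ i, u i ^ 2) * ∑ i, (∑ j, X i j * y j) ^ 2 :=
    Finset.sum_mul_sq_le_sq_mul_sq _ _ _
  have h3 := opNorm_bound' h y
  have hu : 0 ≤ ∑ i, u i ^ 2 := Finset.sum_nonneg fun i _ => sq_nonneg _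
  have hy0 : 0 ≤ ∑ j, y j ^ 2 := Finset.sum_nonneg fun i _ => sq_nonneg _
  rw [← h1] at h2
  have h4 : (∑ j, y j ^ 2) * (∑ j, y j ^ 2) ≤ (C ^ 2 * ∑ i, u i ^ 2) * ∑ j, y j ^ 2 := by nlinarith
  rcases hy0.eq_or_lt with h0 | h0
  · rw [← h0]; positivity
  · exact le_of_mul_le_mul_right h4 h0

lemma opNorm_transpose_le (X : Matrix (Fin m) (Fin n) ℝ) : opNorm Xᵀ ≤ opNorm X :=
  opNorm_le_of _ _ (opNorm_nonneg _) fun v => by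
    simpa using opNorm_transpose_bound (le_refl (opNorm X)) v

lemma opNorm_mul (X : Matrix (Fin m) (Fin n) ℝ) (Y : Matrix (Fin n) (Fin p) ℝ) :
    opNorm (X * Y) ≤ opNorm X * opNorm Y := by
  have hX := opNorm_nonneg X
  have hY := opNorm_nonneg Y
  refine opNorm_le_of _ _ (by positivity) fun v => ?_
  have e : ∀ i, ∑ j, (X * Y) i j * v j = ∑ k, X i k * ∑ j, Y k j * v j := by
    intro i
    simp only [Matrix.mul_apply, Finset.sum_mul, Finset.mul_sum]
    rw [Finset.sum_comm]
    exact Finset.sum_congr rfl fun _ _ => Finset.sum_congr rfl fun _ _ => by ring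
  simp only [e]
  refine (opNorm_bound X _).trans ?_
  rw [mul_pow, mul_assoc]
  gcongr
  exact opNorm_bound Y v

lemma opNorm_smul (c : ℝ) (X : Matrix (Fin m) (Fin n) ℝ) : opNorm (c • X) = |c| * opNorm X := by
  unfold opNorm
  rw [map_smul, map_smul, norm_smul, Real.norm_eq_abs]

lemma opNorm_add (X Y : Matrix (Fin m) (Fin n) ℝ) : opNorm (X + Y) ≤ opNorm X + opNorm Y := by
  unfold opNorm
  rw [map_add, map_add]
  exact norm_add_le _ _

lemma opNorm_sum {ι : Type*} (s : Finset ι) (X : ι → Matrix (Fin m) (Fin n) ℝ) :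
    opNorm (∑ i ∈ s, X i) ≤ ∑ i ∈ s, opNorm (X i) := by
  unfold opNorm
  rw [map_sum, map_sum]
  exact norm_sum_le _ _

lemma opNorm_diagonal {d : Fin n → ℝ} {C : ℝ} (hC : 0 ≤ C) (h : ∀ i, |d i| ≤ C) : opNorm (Matrix.diagonal d) ≤ C := by
  refine opNorm_le_of _ _ hC fun v => ?_
  rw [Finset.mul_sum]
  refine Finset.sum_le_sum fun i _ => ?_
  simp only [Matrix.diagonal_apply, ite_mul, zero_mul, Finset.sum_ite_eq, Finset.mem_univ, if_true]
  rw [mul_pow]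
  exact mul_le_mul_of_nonneg_right (sq_le_sq' (abs_le.1 (h i)).1 (abs_le.1 (h i)).2) (sq_nonneg _)

lemma opNorm_one : opNorm (1 : Matrix (Fin n) (Fin n) ℝ) ≤ 1 := by
  rw [← Matrix.diagonal_one]
  exact opNorm_diagonal zero_le_one (by simp)

lemma continuous_opNorm : Continuous (opNorm : Matrix (Fin m) (Fin n) ℝ → ℝ) := by
  unfold opNorm
  apply continuous_norm.comp
  exact LinearMap.continuous_of_finiteDimensional
    ((LinearMap.toContinuousLinearMap (𝕜 := ℝ) (E := EuclideanSpace ℝ (Fin n)) (F' := EuclideanSpace ℝ (Fin m))).toLinearMap ∘ₗ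
      (Matrix.toEuclideanLin (𝕜 := ℝ) (m := Fin m) (n := Fin n)).toLinearMap)

lemma col_sq_le {X : Matrix (Fin m) (Fin n) ℝ} {C : ℝ} (h : opNorm X ≤ C) (j : Fin n) : ∑ i, X i j ^ 2 ≤ C ^ 2 := by
  have := opNorm_bound' h (Pi.single j 1)
  simpa [Pi.single_apply] using this

end opn

lemma chernoff {E : Type*} [MeasurableSpace E] (μ : Measure E) (h : E → ℝ) (hm : Measurable h) (s t : ℝ) (hs : 0 ≤ s)
    (K : ℝ) (hK : ∫⁻ x, ENNReal.ofReal (Real.exp (s * h x)) ∂μ ≤ ENNReal.ofReal (Real.exp K)) :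
    μ {x | t < h x} ≤ ENNReal.ofReal (Real.exp (K - s * t)) := by
  have h1 := mul_meas_ge_le_lintegral (μ := μ) (f := fun x => ENNReal.ofReal (Real.exp (s * h x))) (by fun_prop)
    (ENNReal.ofReal (Real.exp (s * t)))
  have h2 : {x | t < h x} ⊆ {x | ENNReal.ofReal (Real.exp (s * t)) ≤ ENNReal.ofReal (Real.exp (s * h x))} := by
    intro x hx
    simp only [Set.mem_ofPred_eq] at hx ⊢
    gcongr
  have h3 : ENNReal.ofReal (Real.exp (s * t)) * μ {x | t < h x} ≤ ENNReal.ofReal (Real.exp K) :=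
    le_trans (by gcongr) (h1.trans hK)
  rw [Real.exp_sub, ENNReal.ofReal_div_of_pos (by positivity), ENNReal.le_div_iff_mul_le (by left; simp [Real.exp_pos]) (by left; simp),
    mul_comm]
  exact h3

/-- Chernoff for sums of iid. -/
lemma chernoff_pi {E : Type*} [MeasurableSpace E] (ν : Measure E) [IsProbabilityMeasure ν] (d : ℕ)
    (h : E → ℝ) (hm : Measurable h) (s t : ℝ) (hs : 0 ≤ s)
    (K : ℝ) (hK : ∫⁻ x, ENNReal.ofReal (Real.exp (s * h x)) ∂ν ≤ ENNReal.ofReal (Real.exp K)) :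
    (Measure.pi fun _ : Fin d => ν) {x | t * d < ∑ i, h (x i)} ≤ ENNReal.ofReal (Real.exp (d * (K - s * t))) := by
  have := chernoff (Measure.pi fun _ : Fin d => ν) (fun x => ∑ i, h (x i)) (by fun_prop) s (t * d) hs (d * K) ?_
  · convert this using 3
    ring
  · have e : ∀ x : Fin d → E, ENNReal.ofReal (Real.exp (s * ∑ i, h (x i))) = ∏ i, ENNReal.ofReal (Real.exp (s * h (x i))) := by
      intro x
      rw [← ENNReal.ofReal_prod_of_nonneg (fun i _ => by positivity), ← Real.exp_sum, Finset.mul_sum]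
    simp only [e]
    rw [lintegral_pi_pow ν d (fun x => ENNReal.ofReal (Real.exp (s * h x))) (by fun_prop)]
    rw [Real.exp_nat_mul, ENNReal.ofReal_pow (by positivity)]
    gcongr

lemma exp_le_quad (x : ℝ) : Real.exp x ≤ 1 + x + x ^ 2 * Real.exp |x| := by
  have := Complex.norm_exp_sub_sum_le_norm_mul_exp (x : ℂ) 2
  simp only [Finset.sum_range_succ, Finset.sum_range_zero] at this
  norm_num at this
  have h2 : ‖(Complex.exp x - (1 + x))‖ = |Real.exp x - (1 + x)| := by
    rw [← Complex.ofReal_exp, ← Complex.ofReal_one, ← Complex.ofReal_add, ← Complex.ofReal_sub, Complex.norm_real, Real.norm_eq_abs]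
  rw [h2] at this
  have := (abs_le.1 this).2
  linarith

/-- exponential moment of a centred variable -/
lemma centered_mgf {E : Type*} [MeasurableSpace E] (ν : Measure E) [IsProbabilityMeasure ν]
    (h : E → ℝ) (hm : Measurable h) (hi : Integrable h ν) (h0 : ∫ x, h x ∂ν = 0) (c K : ℝ) (hc : 0 < c) (hK0 : 0 ≤ K)
    (hK : ∫⁻ x, ENNReal.ofReal (Real.exp (c * |h x|)) ∂ν ≤ ENNReal.ofReal K)
    (s : ℝ) (hs : |s| ≤ c / 2) :
    ∫⁻ x, ENNReal.ofReal (Real.exp (s * h x)) ∂ν ≤ ENNReal.ofReal (Real.exp (8 * K / c ^ 2 * s ^ 2)) := by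
  have hI : Integrable (fun x => Real.exp (c * |h x|)) ν := by
    refine ⟨by fun_prop, ?_⟩
    rw [hasFiniteIntegral_iff_ofReal (by filter_upwards with t; positivity)]
    exact hK.trans_lt ENNReal.ofReal_lt_top
  have hIK : ∫ x, Real.exp (c * |h x|) ∂ν ≤ K := by
    rw [← ofReal_integral_eq_lintegral_ofReal hI (by filter_upwards with t; positivity)] at hK
    exact (ENNReal.ofReal_le_ofReal_iff hK0).1 hK
  have hpt : ∀ x, Real.exp (s * h x) ≤ 1 + s * h x + 8 / c ^ 2 * s ^ 2 * Real.exp (c * |h x|) := by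
    intro x
    refine (exp_le_quad _).trans ?_
    have h1 : (h x) ^ 2 ≤ 8 / c ^ 2 * Real.exp (c / 2 * |h x|) := by
      have := Real.quadratic_le_exp_of_nonneg (x := c / 2 * |h x|) (by positivity)
      have h3 : 0 ≤ c / 2 * |h x| := by positivity
      have h2 : (c / 2 * |h x|) ^ 2 / 2 ≤ Real.exp (c / 2 * |h x|) := by linarith
      rw [mul_pow, sq_abs] at h2
      calc (h x) ^ 2 = 8 / c ^ 2 * ((c / 2) ^ 2 * h x ^ 2 / 2) := by field_simp; ring
        _ ≤ _ := by gcongr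
    have h2 : Real.exp |s * h x| ≤ Real.exp (c / 2 * |h x|) := by
      rw [abs_mul]
      gcongr
    have : (s * h x) ^ 2 * Real.exp |s * h x| ≤ s ^ 2 * (8 / c ^ 2 * Real.exp (c / 2 * |h x|)) * Real.exp (c / 2 * |h x|) := by
      rw [mul_pow]
      gcongr
    have e : Real.exp (c / 2 * |h x|) * Real.exp (c / 2 * |h x|) = Real.exp (c * |h x|) := by
      rw [← Real.exp_add]; ring_nf
    have e2 : s ^ 2 * (8 / c ^ 2 * Real.exp (c / 2 * |h x|)) * Real.exp (c / 2 * |h x|) = 8 / c ^ 2 * s ^ 2 * Real.exp (c * |h x|) := by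
      rw [← e]; ring
    linarith
  have hI2 : Integrable (fun x => 1 + s * h x + 8 / c ^ 2 * s ^ 2 * Real.exp (c * |h x|)) ν :=
    ((integrable_const _).add (hi.const_mul _)).add (hI.const_mul _)
  calc _ ≤ ∫⁻ x, ENNReal.ofReal (1 + s * h x + 8 / c ^ 2 * s ^ 2 * Real.exp (c * |h x|)) ∂ν :=
        lintegral_mono fun x => ENNReal.ofReal_le_ofReal (hpt x)
    _ = ENNReal.ofReal (∫ x, (1 + s * h x + 8 / c ^ 2 * s ^ 2 * Real.exp (c * |h x|)) ∂ν) := by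
        rw [ofReal_integral_eq_lintegral_ofReal hI2]
        filter_upwards with x
        exact (Real.exp_pos _).le.trans (hpt x)
    _ ≤ _ := by
        apply ENNReal.ofReal_le_ofReal
        rw [integral_add (f := fun x => 1 + s * h x) ((integrable_const _).add (hi.const_mul _)) (hI.const_mul _),
          integral_add (integrable_const _) (hi.const_mul _),
          integral_const_mul, integral_const_mul, h0]
        simp only [integral_const, probReal_univ, smul_eq_mul, mul_one, mul_zero, add_zero]
        calc _ ≤ 1 + 8 / c ^ 2 * s ^ 2 * K := by gcongr
          _ = 8 * K / c ^ 2 * s ^ 2 + 1 := by ring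
          _ ≤ _ := Real.add_one_le_exp _

/-- Bernstein. -/
lemma bernstein_tail (c K δ : ℝ) (hc : 0 < c) (hK : 1 ≤ K) (hδ : 0 < δ) :
    ∃ c' : ℝ, 0 < c' ∧ ∀ (E : Type) [MeasurableSpace E] (ν : Measure E) [IsProbabilityMeasure ν]
    (h : E → ℝ) (_ : Measurable h)
    (_ : ∫⁻ x, ENNReal.ofReal (Real.exp (c * |h x|)) ∂ν ≤ ENNReal.ofReal K) (d : ℕ),
    (Measure.pi fun _ : Fin d => ν) {x | δ * d < |∑ i, (h (x i) - ∫ y, h y ∂ν)|} ≤ ENNReal.ofReal (2 * Real.exp (-(c' * d))) := by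
  set K' := K * Real.exp K with hK'
  have hK'1 : 0 < K' := by positivity
  set s := min (c / 2) (δ * c ^ 2 / (16 * K')) with hs
  have hs0 : 0 < s := by positivity
  refine ⟨s * δ / 2, by positivity, ?_⟩
  intro E _ ν _ h hm hE d
  have hI : Integrable (fun x => Real.exp (c * |h x|)) ν := by
    refine ⟨by fun_prop, ?_⟩
    rw [hasFiniteIntegral_iff_ofReal (by filter_upwards with t; positivity)]
    exact hE.trans_lt ENNReal.ofReal_lt_top
  have hIK : ∫ x, Real.exp (c * |h x|) ∂ν ≤ K := by
    rw [← ofReal_integral_eq_lintegral_ofReal hI (by filter_upwards with t; positivity)] at hE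
    exact (ENNReal.ofReal_le_ofReal_iff (by linarith)).1 hE
  have hpt : ∀ x, |h x| ≤ c⁻¹ * Real.exp (c * |h x|) := by
    intro x
    have := Real.add_one_le_exp (c * |h x|)
    calc |h x| = c⁻¹ * (c * |h x|) := by field_simp
      _ ≤ _ := by gcongr; linarith
  have hi : Integrable h ν := (hI.const_mul c⁻¹).mono' hm.aestronglyMeasurable
    (by filter_upwards with x; exact hpt x)
  set e := ∫ y, h y ∂ν with he
  have heb : c * |e| ≤ K := by
    have h1 : |e| ≤ ∫ x, c⁻¹ * Real.exp (c * |h x|) ∂ν := by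
      refine (abs_integral_le_integral_abs).trans (integral_mono hi.abs (hI.const_mul _) hpt)
    rw [integral_const_mul] at h1
    calc c * |e| ≤ c * (c⁻¹ * ∫ x, Real.exp (c * |h x|) ∂ν) := by gcongr
      _ = ∫ x, Real.exp (c * |h x|) ∂ν := by field_simp
      _ ≤ K := hIK
  have hE' : ∫⁻ x, ENNReal.ofReal (Real.exp (c * |h x - e|)) ∂ν ≤ ENNReal.ofReal K' := by
    calc _ ≤ ∫⁻ x, ENNReal.ofReal (Real.exp (c * |h x|)) * ENNReal.ofReal (Real.exp K) ∂ν := by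
          refine lintegral_mono fun x => ?_
          rw [← ENNReal.ofReal_mul (by positivity), ← Real.exp_add]
          gcongr
          have := abs_sub (h x) e
          nlinarith
      _ = (∫⁻ x, ENNReal.ofReal (Real.exp (c * |h x|)) ∂ν) * ENNReal.ofReal (Real.exp K) := by
          rw [lintegral_mul_const _ (by fun_prop)]
      _ ≤ _ := by
          rw [hK', ENNReal.ofReal_mul (by linarith)]
          gcongr
  have h0 : ∫ x, (h x - e) ∂ν = 0 := by
    rw [integral_sub hi (integrable_const _)]
    simp [he]
  have hsc : |s| ≤ c / 2 := by rw [abs_of_pos hs0]; exact min_le_left _ _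
  have hsc' : |-s| ≤ c / 2 := by rw [abs_neg]; exact hsc
  have hm1 := centered_mgf ν (fun x => h x - e) (by fun_prop) (hi.sub (integrable_const _)) h0 c K' hc hK'1.le hE' s hsc
  have hm2 := centered_mgf ν (fun x => h x - e) (by fun_prop) (hi.sub (integrable_const _)) h0 c K' hc hK'1.le hE' (-s) hsc'
  have hexp : 8 * K' / c ^ 2 * s ^ 2 - s * δ ≤ -(s * δ / 2) := by
    have : s ≤ δ * c ^ 2 / (16 * K') := min_le_right _ _
    have h2 : 8 * K' / c ^ 2 * s ≤ δ / 2 := by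
      calc 8 * K' / c ^ 2 * s ≤ 8 * K' / c ^ 2 * (δ * c ^ 2 / (16 * K')) := by gcongr
        _ = δ / 2 := by field_simp; norm_num
    nlinarith
  have c1 := chernoff_pi ν d (fun x => h x - e) (by fun_prop) s δ hs0.le _ hm1
  have c2 := chernoff_pi ν d (fun x => -(h x - e)) (by fun_prop) s δ hs0.le (8 * K' / c ^ 2 * s ^ 2) (by
    rw [neg_sq] at hm2
    refine le_trans (le_of_eq (lintegral_congr fun x => ?_)) hm2
    congr 2
    ring)
  have hsub : {x : Fin d → E | δ * d < |∑ i, (h (x i) - e)|} ⊆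
      {x | δ * d < ∑ i, (h (x i) - e)} ∪ {x | δ * d < ∑ i, -(h (x i) - e)} := by
    intro x hx
    simp only [Set.mem_ofPred_eq, Set.mem_union, Finset.sum_neg_distrib] at hx ⊢
    exact lt_abs.1 hx
  refine (measure_mono hsub).trans ((measure_union_le _ _).trans ?_)
  have hfin : ENNReal.ofReal (Real.exp (d * (8 * K' / c ^ 2 * s ^ 2 - s * δ))) ≤ ENNReal.ofReal (Real.exp (-(s * δ / 2 * d))) := by
    gcongr
    have : (0:ℝ) ≤ d := by positivity
    nlinarith
  calc _ ≤ ENNReal.ofReal (Real.exp (-(s * δ / 2 * d))) + ENNReal.ofReal (Real.exp (-(s * δ / 2 * d))) :=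
        add_le_add (c1.trans hfin) (c2.trans hfin)
    _ = _ := by rw [← ENNReal.ofReal_add (by positivity) (by positivity)]; ring_nf

/-- two-sided chernoff from mp_exp -/
lemma quad_hasFDeriv {d : ℕ} (A : Matrix (Fin d) (Fin d) ℝ) (w : Fin d → ℝ) :
    HasFDerivAt (fun w : Fin d → ℝ => ∑ i, ∑ j, w i * A i j * w j)
      (dotL (fun j => ∑ i, (A i j + A j i) * w i)) w := by
  have h : HasFDerivAt (fun w : Fin d → ℝ => ∑ i, ∑ j, w i * A i j * w j)
      (∑ i, ∑ j, ((w i * A i j) • (ContinuousLinearMap.proj (R := ℝ) (φ := fun _ : Fin d => ℝ) j) +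
        (w j) • ((A i j) • (ContinuousLinearMap.proj (R := ℝ) (φ := fun _ : Fin d => ℝ) i)))) w := by
    refine HasFDerivAt.fun_sum fun i _ => HasFDerivAt.fun_sum fun j _ => ?_
    have h1 : HasFDerivAt (fun w : Fin d → ℝ => w i) (ContinuousLinearMap.proj (R := ℝ) (φ := fun _ : Fin d => ℝ) i) w := hasFDerivAt_apply i w
    have h2 : HasFDerivAt (fun w : Fin d → ℝ => w j) (ContinuousLinearMap.proj (R := ℝ) (φ := fun _ : Fin d => ℝ) j) w := hasFDerivAt_apply j w
    exact (h1.mul_const (A i j)).mul h2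
  refine h.congr_fderiv (ContinuousLinearMap.ext fun v => ?_)
  rw [dotL_apply]
  simp only [_root_.sum_apply, _root_.add_apply,
    _root_.smul_apply, ContinuousLinearMap.proj_apply, smul_eq_mul]
  simp only [Finset.sum_add_distrib, add_mul, mul_add, Finset.mul_sum]
  congr 1
  · rw [Finset.sum_comm]
    exact Finset.sum_congr rfl fun i _ => Finset.sum_congr rfl fun j _ => by ring
  · exact Finset.sum_congr rfl fun i _ => Finset.sum_congr rfl fun j _ => by ring

lemma gv_coord_mean {d : ℕ} (i : Fin d) : ∫ w : Fin d → ℝ, w i ∂(gaussianVec d) = 0 := by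
  have := gv_dot_integral (Pi.single i (1:ℝ))
  simpa [Pi.single_apply] using this

lemma gv_int_mul {d : ℕ} (i j : Fin d) : Integrable (fun w : Fin d → ℝ => w i * w j) (gaussianVec d) ∧
    ∫ w, w i * w j ∂(gaussianVec d) = if i = j then 1 else 0 := by
  have hi := gv_memLp (d := d) i
  have hj := gv_memLp (d := d) j
  refine ⟨hi.integrable_mul hj, ?_⟩
  have := covariance_eq_sub hi hj
  rw [gv_cov1, gv_coord_mean, gv_coord_mean] at this
  simpa using this.symm

lemma quad_mean {d : ℕ} (A : Matrix (Fin d) (Fin d) ℝ) :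
    Integrable (fun w : Fin d → ℝ => ∑ i, ∑ j, w i * A i j * w j) (gaussianVec d) ∧
    ∫ w, (∑ i, ∑ j, w i * A i j * w j) ∂(gaussianVec d) = A.trace := by
  have e : ∀ i j : Fin d, (fun w : Fin d → ℝ => w i * A i j * w j) = fun w => A i j * (w i * w j) := by
    intro i j; ext w; ring
  have hI : ∀ i j : Fin d, Integrable (fun w : Fin d → ℝ => w i * A i j * w j) (gaussianVec d) := by
    intro i j
    rw [e]
    exact (gv_int_mul i j).1.const_mul _
  refine ⟨integrable_finsetSum _ fun i _ => integrable_finsetSum _ fun j _ => hI i j, ?_⟩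
  rw [integral_finsetSum _ fun i _ => integrable_finsetSum _ fun j _ => hI i j]
  simp only [Matrix.trace, Matrix.diag]
  refine Finset.sum_congr rfl fun i _ => ?_
  rw [integral_finsetSum _ fun j _ => hI i j]
  simp only [e, integral_const_mul, (gv_int_mul _ _).2]
  simp

lemma gv_exp_norm {d : ℕ} (a : ℝ) (ha : 0 ≤ a) (h : a ≤ 1/4) :
    ∫⁻ w, ENNReal.ofReal (Real.exp (a * ∑ i, w i ^ 2)) ∂(gaussianVec d) ≤ ENNReal.ofReal (Real.exp (d * (2 * a))) := by
  have e : ∀ x : Fin d → ℝ, ENNReal.ofReal (Real.exp (a * ∑ i, x i ^ 2)) = ∏ i, ENNReal.ofReal (Real.exp (a * (x i) ^ 2)) := by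
    intro x
    rw [← ENNReal.ofReal_prod_of_nonneg (fun i _ => by positivity), ← Real.exp_sum, Finset.mul_sum]
  simp only [e]
  rw [lintegral_pi_pow (gaussianReal 0 1) d (fun x => ENNReal.ofReal (Real.exp (a * x ^ 2))) (by fun_prop)]
  rw [Real.exp_nat_mul, ENNReal.ofReal_pow (by positivity)]
  gcongr
  exact gauss_exp_sq a ha h

lemma two_sided {E : Type*} [MeasurableSpace E] (μ : Measure E) (h : E → ℝ) (hm : Measurable h) (s t K : ℝ) (hs : 0 ≤ s)
    (hK : ∫⁻ x, ENNReal.ofReal (Real.exp (s * h x)) ∂μ ≤ ENNReal.ofReal (Real.exp K))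
    (hK' : ∫⁻ x, ENNReal.ofReal (Real.exp ((-s) * h x)) ∂μ ≤ ENNReal.ofReal (Real.exp K)) :
    μ {x | t < |h x|} ≤ ENNReal.ofReal (2 * Real.exp (K - s * t)) := by
  have c1 := chernoff μ h hm s t hs K hK
  have c2 := chernoff μ (fun x => - h x) hm.neg s t hs K (by simpa using hK')
  have hsub : {x | t < |h x|} ⊆ {x | t < h x} ∪ {x | t < - h x} := by
    intro x hx
    simp only [Set.mem_ofPred_eq, Set.mem_union] at hx ⊢
    exact lt_abs.1 hx
  refine (measure_mono hsub).trans ((measure_union_le _ _).trans ((add_le_add c1 c2).trans ?_))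
  rw [← ENNReal.ofReal_add (by positivity) (by positivity)]
  gcongr
  linarith

lemma hanson_wright (C δ : ℝ) (hδ : 0 < δ) : ∃ c : ℝ, 0 < c ∧ ∀ (d : ℕ) (A : Matrix (Fin d) (Fin d) ℝ), opNorm A ≤ C →
    (gaussianVec d) {w | δ * d < |(∑ i, ∑ j, w i * A i j * w j) - A.trace|} ≤ ENNReal.ofReal (2 * Real.exp (-(c * d))) := by
  set C' := max C 1 with hC'
  have hC1 : 1 ≤ C' := le_max_right _ _
  set s := min (1 / (6 * C')) (δ / (32 * C' ^ 2)) with hs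
  have hs0 : 0 < s := by positivity
  have hs1 : s * C' ≤ 1 / 6 := by
    calc s * C' ≤ 1 / (6 * C') * C' := by gcongr; exact min_le_left _ _
      _ = 1 / 6 := by field_simp
  have hs2 : 16 * s ^ 2 * C' ^ 2 ≤ s * δ / 2 := by
    have : s * C' ^ 2 * 32 ≤ δ := by
      calc s * C' ^ 2 * 32 ≤ δ / (32 * C' ^ 2) * C' ^ 2 * 32 := by gcongr; exact min_le_right _ _
        _ = δ := by field_simp
    nlinarith
  refine ⟨s * δ / 2, by positivity, fun d A hA => ?_⟩
  have hA' : opNorm A ≤ C' := hA.trans (le_max_left _ _)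
  have hg : ∀ w : Fin d → ℝ, ∑ j, (∑ i, (A i j + A j i) * w i) ^ 2 ≤ 4 * C' ^ 2 * ∑ i, w i ^ 2 := by
    intro w
    have h1 := opNorm_bound' hA' w
    have h2 := opNorm_transpose_bound hA' w
    calc ∑ j, (∑ i, (A i j + A j i) * w i) ^ 2 ≤ ∑ j, (2 * (∑ i, A i j * w i) ^ 2 + 2 * (∑ i, A j i * w i) ^ 2) := by
          refine Finset.sum_le_sum fun j _ => ?_
          simp only [add_mul, Finset.sum_add_distrib]
          nlinarith [sq_nonneg ((∑ i, A i j * w i) - (∑ i, A j i * w i))]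
      _ = 2 * ∑ j, (∑ i, A i j * w i) ^ 2 + 2 * ∑ j, (∑ i, A j i * w i) ^ 2 := by
          rw [Finset.sum_add_distrib, Finset.mul_sum, Finset.mul_sum]
      _ ≤ _ := by linarith
  have key : ∀ s' : ℝ, s' ^ 2 = s ^ 2 → ∫⁻ w, ENNReal.ofReal (Real.exp (s' * ((∑ i, ∑ j, w i * A i j * w j) - A.trace))) ∂(gaussianVec d) ≤
      ENNReal.ofReal (Real.exp (d * (16 * s ^ 2 * C' ^ 2))) := by
    intro s' hs'
    have := mp_exp (fun w : Fin d → ℝ => ∑ i, ∑ j, w i * A i j * w j) (fun w j => ∑ i, (A i j + A j i) * w i)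
      (quad_hasFDeriv A) (by fun_prop) (quad_mean A).1 s'
    rw [(quad_mean A).2] at this
    refine this.trans ?_
    calc _ ≤ ∫⁻ w, ENNReal.ofReal (Real.exp ((8 * s ^ 2 * C' ^ 2) * ∑ i, w i ^ 2)) ∂(gaussianVec d) := by
          refine lintegral_mono fun w => ?_
          refine ENNReal.ofReal_le_ofReal (Real.exp_le_exp.2 ?_)
          rw [hs']
          nlinarith [hg w, sq_nonneg s]
      _ ≤ _ := by
          refine (gv_exp_norm _ (by positivity) ?_).trans (le_of_eq ?_)
          · have : (s * C') ^ 2 ≤ (1 / 6) ^ 2 := by gcongr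
            nlinarith
          · ring_nf
  refine (two_sided _ _ (Measurable.sub_const (by fun_prop) _) s (δ * d) _ hs0.le (key s rfl) (key (-s) (neg_sq s))).trans ?_
  gcongr
  have : (0:ℝ) ≤ d := by positivity
  nlinarith

lemma net_lemma {E : Type*} [MeasurableSpace E] (μ : Measure E) [SFinite μ] {m n : ℕ} (M : E → Matrix (Fin m) (Fin n) ℝ)
    (hM : ∀ i j, Measurable (fun x => M x i j)) (t : ℝ) (η : ENNReal) (ht : 0 ≤ t)
    (h : ∀ v : Fin n → ℝ, ∑ j, v j ^ 2 ≤ 1 → μ {x | t ^ 2 < ∑ i, (∑ j, M x i j * v j) ^ 2} ≤ η) :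
    μ {x | 3 * t < opNorm (M x)} ≤ 3 ^ n * η := by
  let Q : E × (EuclideanSpace ℝ (Fin n)) → ℝ := fun p => ∑ i, (∑ j, M p.1 i j * p.2 j) ^ 2
  have hQ : Measurable Q := by
    have h1 : ∀ i j, Measurable fun p : E × (EuclideanSpace ℝ (Fin n)) => M p.1 i j := fun i j => (hM i j).comp measurable_fst
    have h2 : ∀ j, Measurable fun p : E × (EuclideanSpace ℝ (Fin n)) => p.2 j := fun j => by fun_prop
    exact Finset.measurable_sum _ fun i _ => (Finset.measurable_sum _ fun j _ => (h1 i j).mul (h2 j)).pow_const 2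
  let P : Set (E × (EuclideanSpace ℝ (Fin n))) := (Prod.snd ⁻¹' (Metric.ball (0 : (EuclideanSpace ℝ (Fin n))) (3/2))) ∩ {p | (3 / 2 * t) ^ 2 < Q p}
  have hP : MeasurableSet P := (measurable_snd Metric.isOpen_ball.measurableSet).inter (measurableSet_lt measurable_const hQ)
  have e1 := Measure.prod_apply (μ := μ) (ν := (volume : Measure (EuclideanSpace ℝ (Fin n)))) hP
  have e2 := Measure.prod_apply_symm (μ := μ) (ν := (volume : Measure (EuclideanSpace ℝ (Fin n)))) hP
  have hb : ∀ (x : (EuclideanSpace ℝ (Fin n))) (r : ℝ), 0 < r → volume (Metric.ball x r) = ENNReal.ofReal (r ^ n) * volume (Metric.ball (0 : (EuclideanSpace ℝ (Fin n))) 1) := by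
    intro x r hr
    have := Measure.addHaar_ball_of_pos (volume : Measure (EuclideanSpace ℝ (Fin n))) x hr
    simpa using this
  set b := volume (Metric.ball (0 : (EuclideanSpace ℝ (Fin n))) 1) with hbdef
  have hb0 : b ≠ 0 := (Metric.measure_ball_pos _ _ one_pos).ne'
  have hbt : b ≠ ⊤ := measure_ball_lt_top.ne
  have up : (μ.prod volume) P ≤ η * (ENNReal.ofReal ((3/2) ^ n) * b) := by
    rw [e2, ← hb 0 (3/2) (by norm_num), ← setLIntegral_const, ← lintegral_indicator Metric.isOpen_ball.measurableSet]
    refine lintegral_mono fun v => ?_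
    by_cases hv : v ∈ Metric.ball (0 : (EuclideanSpace ℝ (Fin n))) (3/2)
    · rw [Set.indicator_of_mem hv]
      have hv' : ‖v‖ < 3 / 2 := by simpa using hv
      have hv2 : ∑ j, ((2 / 3 : ℝ) * v j) ^ 2 ≤ 1 := by
        have : ‖v‖ ^ 2 = ∑ j, v j ^ 2 := eucl_norm_sq v.ofLp
        simp only [mul_pow, ← Finset.mul_sum, ← this]
        have := norm_nonneg v
        nlinarith
      refine le_trans (measure_mono ?_) (h (fun j => 2 / 3 * v j) hv2)
      intro x hx
      have hx2 := hx.2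
      simp only [Set.mem_ofPred_eq, Q] at hx2 ⊢
      have e : ∀ i, ∑ j, M x i j * (2 / 3 * v j) = 2 / 3 * ∑ j, M x i j * v j := by
        intro i; rw [Finset.mul_sum]; exact Finset.sum_congr rfl fun j _ => by ring
      simp only [e, mul_pow, ← Finset.mul_sum]
      nlinarith
    · rw [Set.indicator_of_notMem hv]
      have : (fun x => (x, v)) ⁻¹' P = ∅ := by
        ext x
        simp only [Set.mem_preimage, Set.mem_empty_iff_false, iff_false]
        exact fun hx => hv hx.1
      rw [this]; simp
  have low : (ENNReal.ofReal ((1/2) ^ n) * b) * μ {x | 3 * t < opNorm (M x)} ≤ (μ.prod volume) P := by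
    rw [e1]
    refine le_trans ?_ (mul_meas_ge_le_lintegral (measurable_measure_prodMk_left hP) (ENNReal.ofReal ((1/2) ^ n) * b))
    refine mul_le_mul_right (measure_mono fun x hx => ?_) _
    simp only [Set.mem_ofPred_eq] at hx ⊢
    unfold opNorm at hx
    set T := LinearMap.toContinuousLinearMap (Matrix.toEuclideanLin (M x)) with hT
    obtain ⟨v0, hv0, hv1⟩ := ContinuousLinearMap.exists_lt_apply_of_lt_opNorm T (r := ‖T‖ / 2 + 3 / 2 * t) (by linarith)
    rw [← hb v0 (1/2) (by norm_num)]
    refine measure_mono ?_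
    intro v hv
    have hv' : ‖v - v0‖ < 1 / 2 := by simpa [dist_eq_norm] using hv
    refine ⟨?_, ?_⟩
    · simp only [Set.mem_preimage, Metric.mem_ball, dist_zero_right]
      calc ‖v‖ = ‖(v - v0) + v0‖ := by simp
        _ ≤ ‖v - v0‖ + ‖v0‖ := norm_add_le _ _
        _ < _ := by linarith
    · simp only [Set.mem_ofPred_eq, Q]
      have e := opNorm_apply_norm (M x) v.ofLp
      rw [← e]
      have h3 : ‖T v0‖ ≤ ‖T v‖ + ‖T‖ * (1 / 2) := by
        calc ‖T v0‖ = ‖T v - T (v - v0)‖ := by simp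
          _ ≤ ‖T v‖ + ‖T (v - v0)‖ := norm_sub_le _ _
          _ ≤ ‖T v‖ + ‖T‖ * ‖v - v0‖ := by gcongr; exact T.le_opNorm _
          _ ≤ _ := by gcongr
      have h4 : 3 / 2 * t < ‖T v‖ := by linarith
      have : T (WithLp.toLp 2 v.ofLp) = T v := rfl
      rw [this]
      gcongr
  have tot := low.trans up
  have e3 : ENNReal.ofReal ((3/2) ^ n) = 3 ^ n * ENNReal.ofReal ((1/2) ^ n) := by
    rw [show (3/2 : ℝ) = 3 * (1/2) by norm_num, mul_pow, ENNReal.ofReal_mul (by positivity), ENNReal.ofReal_pow (by norm_num)]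
    norm_num
  rw [e3] at tot
  have hne : ENNReal.ofReal ((1/2) ^ n) * b ≠ 0 := by
    refine mul_ne_zero ?_ hb0
    simp
  have hnt : ENNReal.ofReal ((1/2) ^ n) * b ≠ ⊤ := ENNReal.mul_ne_top ENNReal.ofReal_ne_top hbt
  rw [← ENNReal.mul_le_mul_iff_right hne hnt]
  refine tot.trans (le_of_eq ?_)
  ring

lemma rows_opnorm {E : Type*} [MeasurableSpace E] (ν : Measure E) [IsProbabilityMeasure ν] {n : ℕ} (d : ℕ) (F : E → Fin n → ℝ)
    (hF : ∀ j, Measurable fun x => F x j) (c K T : ℝ) (hc : 0 ≤ c) (hT : 0 ≤ T)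
    (h : ∀ v : Fin n → ℝ, ∑ j, v j ^ 2 ≤ 1 → ∫⁻ x, ENNReal.ofReal (Real.exp (c * (∑ j, F x j * v j) ^ 2)) ∂ν ≤ ENNReal.ofReal (Real.exp K)) :
    (Measure.pi fun _ : Fin d => ν) {x | 3 * (T * √d) < opNorm (Matrix.of fun i j => F (x i) j)} ≤
      3 ^ n * ENNReal.ofReal (Real.exp (d * (K - c * T ^ 2))) := by
  refine net_lemma _ (fun x : Fin d → E => Matrix.of fun i j => F (x i) j) (fun i j => ?_) (T * √d) _ (by positivity) fun v hv => ?_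
  · exact (hF j).comp (measurable_pi_apply i)
  · have := chernoff_pi ν d (fun x => (∑ j, F x j * v j) ^ 2) (by fun_prop) c (T ^ 2) hc K (h v hv)
    simpa [mul_pow, Real.sq_sqrt (Nat.cast_nonneg d)] using this

lemma gmat_opnorm (a b : ℕ) (T : ℝ) (hT : 0 ≤ T) :
    gaussianMat a b {Y | 3 * (T * √a) < opNorm (Matrix.of Y)} ≤ 3 ^ b * ENNReal.ofReal (Real.exp (a * (1 / 2 - 1 / 4 * T ^ 2))) := by
  refine rows_opnorm (gaussianVec b) a (fun w => w) (fun j => measurable_pi_apply j) (1/4) (1/2) T (by norm_num) hT fun v hv => ?_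
  refine (gv_exp_sq v (1/4) (by norm_num) (by linarith)).trans ?_
  gcongr
  linarith

section act
variable {φ φ' : ℝ → ℝ} {lam : ℝ}

lemma act_cont (hd : ∀ x, HasDerivAt φ (φ' x) x) : Continuous φ :=
  continuous_iff_continuousAt.2 fun x => (hd x).continuousAt

lemma act_lip (hd : ∀ x, HasDerivAt φ (φ' x) x) (hb : ∀ x, |φ' x| ≤ lam) (x y : ℝ) : |φ x - φ y| ≤ lam * |x - y| := by
  have := Convex.norm_image_sub_le_of_norm_hasDerivWithin_le (f := φ) (f' := φ') (s := Set.univ) (C := lam) (x := y) (y := x)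
    (fun x _ => (hd x).hasDerivWithinAt) (fun x _ => hb x) convex_univ (Set.mem_univ _) (Set.mem_univ _)
  simpa using this

lemma act_lam (hb : ∀ x, |φ' x| ≤ lam) : 0 ≤ lam := (abs_nonneg _).trans (hb 0)

lemma act_growth (hd : ∀ x, HasDerivAt φ (φ' x) x) (hb : ∀ x, |φ' x| ≤ lam) (x : ℝ) : |φ x| ≤ |φ 0| + lam * |x| := by
  have h1 := act_lip hd hb x 0
  have h2 : |φ x| ≤ |φ 0| + |φ x - φ 0| := by
    calc |φ x| = |φ 0 + (φ x - φ 0)| := by ring_nf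
      _ ≤ _ := abs_add_le _ _
  simp only [sub_zero] at h1
  linarith

lemma act_growth_sq (hd : ∀ x, HasDerivAt φ (φ' x) x) (hb : ∀ x, |φ' x| ≤ lam) (x : ℝ) :
    φ x ^ 2 ≤ 2 * φ 0 ^ 2 + 2 * lam ^ 2 * x ^ 2 := by
  have h := act_growth hd hb x
  have h1 : φ x ^ 2 ≤ (|φ 0| + lam * |x|) ^ 2 := by
    rw [← sq_abs]; gcongr
  have h2 : (|φ 0| + lam * |x|) ^ 2 ≤ 2 * |φ 0| ^ 2 + 2 * (lam ^ 2 * |x| ^ 2) := by nlinarith [sq_nonneg (|φ 0| - lam * |x|)]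
  rw [sq_abs, sq_abs] at h2
  linarith

lemma gr_memLp (a : ℝ) : MemLp (fun t : ℝ => a * t) 2 (gaussianReal 0 1) := by
  have := (memLp_id_gaussianReal (μ := 0) (v := 1) 2)
  exact this.const_mul a

lemma gr_sq : ∫ t, t ^ 2 ∂(gaussianReal 0 1) = 1 := by
  have h := variance_id_gaussianReal (μ := 0) (v := 1)
  rw [variance_of_integral_eq_zero aemeasurable_id (by simp)] at h
  simpa using h

lemma gr_sq_int : Integrable (fun t : ℝ => t ^ 2) (gaussianReal 0 1) := by
  have := (gr_memLp 1).integrable_sq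
  simpa using this

lemma gr_abs_int : Integrable (fun t : ℝ => |t|) (gaussianReal 0 1) := by
  have := ((gr_memLp 1).integrable one_le_two).abs
  simpa using this

lemma gr_abs : ∫ t, |t| ∂(gaussianReal 0 1) ≤ 1 := by
  have : ∫ t, |t| ∂(gaussianReal 0 1) ≤ ∫ t, (1 / 2 + 1 / 2 * t ^ 2) ∂(gaussianReal 0 1) := by
    refine integral_mono gr_abs_int ((integrable_const _).add (gr_sq_int.const_mul _)) fun t => ?_
    show |t| ≤ 1 / 2 + 1 / 2 * t ^ 2
    nlinarith [sq_nonneg (|t| - 1), sq_abs t]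
  rw [integral_add (integrable_const _) (gr_sq_int.const_mul _), integral_const_mul, gr_sq] at this
  simp at this
  linarith

lemma act_memLp_of {E : Type*} [MeasurableSpace E] (μ : Measure E) [IsProbabilityMeasure μ] (hd : ∀ x, HasDerivAt φ (φ' x) x) (hb : ∀ x, |φ' x| ≤ lam)
    (h : E → ℝ) (hh : MemLp h 2 μ) : MemLp (fun x => φ (h x)) 2 μ := by
  have h1 : MemLp (fun x => |φ 0| + lam * |h x|) 2 μ := by
    have h2 : MemLp (fun x => lam * |h x|) 2 μ := hh.abs.const_mul lam
    have h3 : MemLp (fun _ : E => |φ 0|) 2 μ := memLp_const _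
    exact h3.add h2
  refine h1.mono ((act_cont hd).comp_aestronglyMeasurable hh.1) ?_
  filter_upwards with x
  rw [Real.norm_eq_abs, Real.norm_eq_abs]
  exact (act_growth hd hb _).trans (le_abs_self _)

lemma act_int (hd : ∀ x, HasDerivAt φ (φ' x) x) (hb : ∀ x, |φ' x| ≤ lam) (a : ℝ) :
    Integrable (fun t => φ (a * t)) (gaussianReal 0 1) :=
  (act_memLp_of _ hd hb _ (gr_memLp a)).integrable one_le_two

lemma act_int_sq (hd : ∀ x, HasDerivAt φ (φ' x) x) (hb : ∀ x, |φ' x| ≤ lam) (a : ℝ) :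
    Integrable (fun t => φ (a * t) ^ 2) (gaussianReal 0 1) :=
  (act_memLp_of _ hd hb _ (gr_memLp a)).integrable_sq

lemma sqrt_sub_one (s : ℝ) (hs : 0 ≤ s) : |√s - 1| ≤ |s - 1| := by
  have h : s - 1 = (√s - 1) * (√s + 1) := by
    have := Real.sq_sqrt hs
    nlinarith
  rw [h, abs_mul]
  have : 1 ≤ |√s + 1| := by
    rw [abs_of_nonneg (by positivity)]
    linarith [Real.sqrt_nonneg s]
  nlinarith [abs_nonneg (√s - 1)]

lemma act_scale (hd : ∀ x, HasDerivAt φ (φ' x) x) (hb : ∀ x, |φ' x| ≤ lam) (s : ℝ) (hs : 0 ≤ s) :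
    |(∫ t, φ (√s * t) ∂(gaussianReal 0 1)) - ∫ t, φ t ∂(gaussianReal 0 1)| ≤ lam * |s - 1| := by
  have i1 := act_int hd hb (√s)
  have i2 : Integrable (fun t => φ t) (gaussianReal 0 1) := by simpa using act_int hd hb 1
  have hl := act_lam hb
  rw [← integral_sub i1 i2]
  refine (abs_integral_le_integral_abs).trans ?_
  calc _ ≤ ∫ t, (lam * |s - 1|) * |t| ∂(gaussianReal 0 1) := by
        refine integral_mono (i1.sub i2).abs (gr_abs_int.const_mul _) fun t => ?_
        show |φ (√s * t) - φ t| ≤ _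
        refine (act_lip hd hb _ _).trans ?_
        rw [show √s * t - t = (√s - 1) * t by ring, abs_mul, ← mul_assoc]
        exact mul_le_mul_of_nonneg_right (mul_le_mul_of_nonneg_left (sqrt_sub_one s hs) hl) (abs_nonneg t)
    _ ≤ _ := by
        rw [integral_const_mul]
        have := gr_abs
        have h2 : 0 ≤ lam * |s - 1| := by positivity
        nlinarith

lemma act_scale_sq (hd : ∀ x, HasDerivAt φ (φ' x) x) (hb : ∀ x, |φ' x| ≤ lam) (s : ℝ) (hs : 0 ≤ s) (hs2 : s ≤ 4) :
    |(∫ t, φ (√s * t) ^ 2 ∂(gaussianReal 0 1)) - ∫ t, φ t ^ 2 ∂(gaussianReal 0 1)| ≤ lam * (2 * |φ 0| + 3 * lam) * |s - 1| := by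
  have i1 := act_int_sq hd hb (√s)
  have i2 : Integrable (fun t => φ t ^ 2) (gaussianReal 0 1) := by simpa using act_int_sq hd hb 1
  have hl := act_lam hb
  rw [← integral_sub i1 i2]
  refine (abs_integral_le_integral_abs).trans ?_
  have i3 : Integrable (fun t => (lam * |s - 1|) * (2 * |φ 0| * |t| + 3 * lam * t ^ 2)) (gaussianReal 0 1) :=
    ((gr_abs_int.const_mul _).add (gr_sq_int.const_mul _)).const_mul _
  have hr : √s ≤ 2 := by
    rw [Real.sqrt_le_left (by norm_num)]; linarith
  calc _ ≤ ∫ t, (lam * |s - 1|) * (2 * |φ 0| * |t| + 3 * lam * t ^ 2) ∂(gaussianReal 0 1) := by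
        refine integral_mono (i1.sub i2).abs i3 fun t => ?_
        show |φ (√s * t) ^ 2 - φ t ^ 2| ≤ (lam * |s - 1|) * (2 * |φ 0| * |t| + 3 * lam * t ^ 2)
        rw [sq_sub_sq, abs_mul, mul_comm]
        have h1 : |φ (√s * t) - φ t| ≤ lam * |s - 1| * |t| := by
          refine (act_lip hd hb _ _).trans ?_
          rw [show √s * t - t = (√s - 1) * t by ring, abs_mul, ← mul_assoc]
          exact mul_le_mul_of_nonneg_right (mul_le_mul_of_nonneg_left (sqrt_sub_one s hs) hl) (abs_nonneg t)
        have h2 : |φ (√s * t) + φ t| ≤ 2 * |φ 0| + 3 * lam * |t| := by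
          refine (abs_add_le _ _).trans ?_
          have a1 := act_growth hd hb (√s * t)
          have a2 := act_growth hd hb t
          rw [abs_mul, abs_of_nonneg (Real.sqrt_nonneg s)] at a1
          have : lam * (√s * |t|) ≤ lam * (2 * |t|) := by gcongr
          linarith
        calc _ ≤ (lam * |s - 1| * |t|) * (2 * |φ 0| + 3 * lam * |t|) := by gcongr
          _ = (lam * |s - 1|) * (2 * |φ 0| * |t| + 3 * lam * |t| ^ 2) := by ring
          _ = _ := by rw [sq_abs]
    _ ≤ _ := by
        rw [integral_const_mul, integral_add (gr_abs_int.const_mul _) (gr_sq_int.const_mul _), integral_const_mul, integral_const_mul, gr_sq]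
        have := gr_abs
        have h2 : 0 ≤ lam * |s - 1| := by positivity
        have h3 : 2 * |φ 0| * ∫ t, |t| ∂(gaussianReal 0 1) ≤ 2 * |φ 0| * 1 := by gcongr
        nlinarith

end act

section act
variable {φ φ' : ℝ → ℝ} {lam : ℝ}

/-- gradient of a ridge sum -/
lemma ridge_hasFDeriv {p n : ℕ} (hd : ∀ x, HasDerivAt φ (φ' x) x) (X : Matrix (Fin p) (Fin n) ℝ) (v : Fin n → ℝ) (w : Fin p → ℝ) :
    HasFDerivAt (fun w : Fin p → ℝ => ∑ a, v a * φ (∑ i, w i * X i a))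
      (dotL (fun j => ∑ a, X j a * (v a * φ' (∑ i, w i * X i a)))) w := by
  have h : HasFDerivAt (fun w : Fin p → ℝ => ∑ a, v a * φ (∑ i, w i * X i a))
      (∑ a, v a • (φ' (∑ i, w i * X i a) • dotL (fun i => X i a))) w := by
    refine HasFDerivAt.fun_sum fun a _ => HasFDerivAt.const_mul ?_ (v a)
    have h1 : HasFDerivAt (fun w : Fin p → ℝ => ∑ i, w i * X i a) (dotL fun i => X i a) w := by
      have := (dotL fun i => X i a).hasFDerivAt (x := w)
      refine this.congr_of_eventuallyEq ?_
      filter_upwards with u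
      exact (dotL_apply _ _).symm
    exact (hd _).comp_hasFDerivAt w h1
  refine h.congr_fderiv (ContinuousLinearMap.ext fun u => ?_)
  rw [dotL_apply]
  simp only [_root_.sum_apply, _root_.smul_apply, dotL_apply, smul_eq_mul, Finset.mul_sum]
  rw [Finset.sum_comm]
  exact Finset.sum_congr rfl fun i _ => Finset.sum_congr rfl fun j _ => by ring

lemma dot_memLp {p : ℕ} (x : Fin p → ℝ) : MemLp (fun w : Fin p → ℝ => ∑ i, w i * x i) 2 (gaussianVec p) :=
  memLp_finsetSum _ fun i _ => (gv_memLp i).mul_const _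

lemma act_vec_memLp {p : ℕ} (hd : ∀ x, HasDerivAt φ (φ' x) x) (hb : ∀ x, |φ' x| ≤ lam) (x : Fin p → ℝ) :
    MemLp (fun w : Fin p → ℝ => φ (∑ i, w i * x i)) 2 (gaussianVec p) :=
  act_memLp_of _ hd hb _ (dot_memLp x)

lemma act_layer_mgf {p n : ℕ} (hd : ∀ x, HasDerivAt φ (φ' x) x) (hb : ∀ x, |φ' x| ≤ lam) (hc' : Continuous φ')
    (h0 : ∫ t, φ t ∂(gaussianReal 0 1) = 0) (B : ℝ) (X : Matrix (Fin p) (Fin n) ℝ) (hX : opNorm X ≤ B)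
    (hX4 : ∑ a, ((∑ i, X i a ^ 2) - 1) ^ 2 ≤ B ^ 2) (v : Fin n → ℝ) (hv : ∑ a, v a ^ 2 ≤ 1) :
    ∫⁻ w, ENNReal.ofReal (Real.exp ((1 / (32 * (B ^ 2 * lam ^ 2 + 1))) * (∑ a, φ (∑ i, w i * X i a) * v a) ^ 2)) ∂(gaussianVec p)
      ≤ ENNReal.ofReal (Real.exp 2) := by
  set c := 1 / (32 * (B ^ 2 * lam ^ 2 + 1)) with hc
  have hc0 : 0 < c := by positivity
  have hcB : c * (B ^ 2 * lam ^ 2) ≤ 1 / 32 := by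
    rw [hc]
    rw [div_mul_eq_mul_div, div_le_div_iff₀ (by positivity) (by norm_num)]
    linarith
  set f : (Fin p → ℝ) → ℝ := fun w => ∑ a, v a * φ (∑ i, w i * X i a) with hf
  have hfi : Integrable f (gaussianVec p) := integrable_finsetSum _ fun a _ =>
    ((act_vec_memLp hd hb fun i => X i a).integrable one_le_two).const_mul _
  have hg : ∀ w : Fin p → ℝ, ∑ j, (∑ a, X j a * (v a * φ' (∑ i, w i * X i a))) ^ 2 ≤ B ^ 2 * lam ^ 2 := by
    intro w
    refine (opNorm_bound' hX _).trans ?_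
    gcongr
    calc ∑ a, (v a * φ' (∑ i, w i * X i a)) ^ 2 ≤ ∑ a, lam ^ 2 * v a ^ 2 := by
          refine Finset.sum_le_sum fun a _ => ?_
          rw [mul_pow, mul_comm]
          refine mul_le_mul_of_nonneg_right ?_ (sq_nonneg _)
          rw [← sq_abs]
          have := hb (∑ i, w i * X i a)
          gcongr
      _ ≤ lam ^ 2 := by
          rw [← Finset.mul_sum]
          nlinarith [sq_nonneg lam]
  have hm := mp_exp_sq f (fun w j => ∑ a, X j a * (v a * φ' (∑ i, w i * X i a))) (ridge_hasFDeriv hd X v) (by fun_prop) hfi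
    (2 * c) (B ^ 2 * lam ^ 2) (by positivity) hg (by linarith)
  set m := ∫ y, f y ∂(gaussianVec p) with hmdef
  have hmb : m ^ 2 ≤ B ^ 2 * lam ^ 2 := by
    have e : m = ∑ a, v a * ∫ t, φ (√(∑ i, X i a ^ 2) * t) ∂(gaussianReal 0 1) := by
      rw [hmdef, hf, integral_finsetSum _ fun a _ => ((act_vec_memLp hd hb fun i => X i a).integrable one_le_two).const_mul _]
      refine Finset.sum_congr rfl fun a _ => ?_
      rw [integral_const_mul, gv_integral (fun i => X i a) φ (act_cont hd).measurable]
    rw [e]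
    refine (Finset.sum_mul_sq_le_sq_mul_sq _ _ _).trans ?_
    have h2 : ∑ a, (∫ t, φ (√(∑ i, X i a ^ 2) * t) ∂(gaussianReal 0 1)) ^ 2 ≤ lam ^ 2 * B ^ 2 := by
      calc _ ≤ ∑ a, lam ^ 2 * ((∑ i, X i a ^ 2) - 1) ^ 2 := by
            refine Finset.sum_le_sum fun a _ => ?_
            have := act_scale hd hb (∑ i, X i a ^ 2) (Finset.sum_nonneg fun i _ => sq_nonneg _)
            rw [h0, sub_zero] at this
            rw [← sq_abs, ← sq_abs (_ - 1), ← mul_pow]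
            gcongr
        _ ≤ _ := by
            rw [← Finset.mul_sum]
            gcongr
    have h3 : 0 ≤ ∑ a, (∫ t, φ (√(∑ i, X i a ^ 2) * t) ∂(gaussianReal 0 1)) ^ 2 := Finset.sum_nonneg fun i _ => sq_nonneg _
    nlinarith
  calc _ ≤ ∫⁻ w, ENNReal.ofReal (Real.exp (2 * c * (f w - m) ^ 2)) * ENNReal.ofReal (Real.exp 1) ∂(gaussianVec p) := by
        refine lintegral_mono fun w => ?_
        rw [← ENNReal.ofReal_mul (by positivity), ← Real.exp_add]
        refine ENNReal.ofReal_le_ofReal (Real.exp_le_exp.2 ?_)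
        have : ∑ a, φ (∑ i, w i * X i a) * v a = f w := Finset.sum_congr rfl fun a _ => mul_comm _ _
        rw [this]
        have h1 : f w ^ 2 ≤ 2 * (f w - m) ^ 2 + 2 * m ^ 2 := by nlinarith [sq_nonneg (f w - 2 * m)]
        have h2 : c * m ^ 2 ≤ 1 / 32 := le_trans (by gcongr) hcB
        nlinarith
    _ = (∫⁻ w, ENNReal.ofReal (Real.exp (2 * c * (f w - m) ^ 2)) ∂(gaussianVec p)) * ENNReal.ofReal (Real.exp 1) := by
        have : Continuous f := by
          have := act_cont hd
          fun_prop
        rw [lintegral_mul_const _ (by fun_prop)]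
    _ ≤ ENNReal.ofReal (Real.exp 1) * ENNReal.ofReal (Real.exp 1) := by gcongr
    _ = _ := by
        rw [← ENNReal.ofReal_mul (by positivity), ← Real.exp_add]; norm_num

/-- operator norm of activated layer -/
lemma act_layer_opnorm {p n : ℕ} (d : ℕ) (hd : ∀ x, HasDerivAt φ (φ' x) x) (hb : ∀ x, |φ' x| ≤ lam) (hc' : Continuous φ')
    (h0 : ∫ t, φ t ∂(gaussianReal 0 1) = 0) (B : ℝ) (X : Matrix (Fin p) (Fin n) ℝ) (hX : opNorm X ≤ B)
    (hX4 : ∑ a, ((∑ i, X i a ^ 2) - 1) ^ 2 ≤ B ^ 2) (T : ℝ) (hT : 0 ≤ T) :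
    gaussianMat d p {Y | 3 * (T * √d) < opNorm ((Matrix.of Y * X).map φ)} ≤
      3 ^ n * ENNReal.ofReal (Real.exp (d * (2 - (1 / (32 * (B ^ 2 * lam ^ 2 + 1))) * T ^ 2))) := by
  have hφ := act_cont hd
  have := rows_opnorm (gaussianVec p) d (fun w (a : Fin n) => φ (∑ i, w i * X i a)) (fun j => Continuous.measurable (by fun_prop))
    (1 / (32 * (B ^ 2 * lam ^ 2 + 1))) 2 T (by positivity) hT (act_layer_mgf hd hb hc' h0 B X hX hX4)
  have e : ∀ Y : Fin d → Fin p → ℝ, (Matrix.of Y * X).map φ = Matrix.of fun i a => φ (∑ k, Y i k * X k a) := by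
    intro Y
    ext i j
    simp [Matrix.mul_apply]
  simp only [e]
  exact this

lemma exp_convex_sum {n : ℕ} (v y : Fin n → ℝ) (hv : ∑ a, v a ^ 2 ≤ 1) :
    Real.exp (∑ a, v a ^ 2 * y a) ≤ (∑ a, v a ^ 2 * Real.exp (y a)) + (1 - ∑ a, v a ^ 2) := by
  have := convexOn_exp.map_add_sum_le (t := Finset.univ) (w := fun a => v a ^ 2) (p := y) (v := 1 - ∑ a, v a ^ 2) (q := 0)
    (fun i _ => sq_nonneg _) (by ring) (fun i _ => Set.mem_univ _) (by linarith) (Set.mem_univ _)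
  simp only [smul_eq_mul, mul_zero, zero_add, Real.exp_zero, mul_one] at this
  linarith

/-- exponential moment of φ² -/
lemma act_exp_sq {p : ℕ} (hd : ∀ x, HasDerivAt φ (φ' x) x) (hb : ∀ x, |φ' x| ≤ lam) (x : Fin p → ℝ) (hx : ∑ i, x i ^ 2 ≤ 2)
    (c : ℝ) (hc : 0 ≤ c) (hcl : 4 * c * lam ^ 2 ≤ 1 / 4) :
    ∫⁻ w, ENNReal.ofReal (Real.exp (c * φ (∑ i, w i * x i) ^ 2)) ∂(gaussianVec p) ≤ ENNReal.ofReal (Real.exp (2 * c * φ 0 ^ 2 + 1 / 2)) := by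
  have hx0 : 0 ≤ ∑ i, x i ^ 2 := Finset.sum_nonneg fun i _ => sq_nonneg _
  calc _ ≤ ∫⁻ w, ENNReal.ofReal (Real.exp (2 * c * φ 0 ^ 2)) * ENNReal.ofReal (Real.exp (2 * c * lam ^ 2 * (∑ i, w i * x i) ^ 2)) ∂(gaussianVec p) := by
        refine lintegral_mono fun w => ?_
        rw [← ENNReal.ofReal_mul (by positivity), ← Real.exp_add]
        refine ENNReal.ofReal_le_ofReal (Real.exp_le_exp.2 ?_)
        have := act_growth_sq hd hb (∑ i, w i * x i)
        nlinarith
    _ = ENNReal.ofReal (Real.exp (2 * c * φ 0 ^ 2)) * ∫⁻ w, ENNReal.ofReal (Real.exp (2 * c * lam ^ 2 * (∑ i, w i * x i) ^ 2)) ∂(gaussianVec p) := by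
        rw [lintegral_const_mul _ (by fun_prop)]
    _ ≤ ENNReal.ofReal (Real.exp (2 * c * φ 0 ^ 2)) * ENNReal.ofReal (Real.exp (1 / 2)) := by
        have h1 : 2 * c * lam ^ 2 * ∑ i, x i ^ 2 ≤ 1 / 4 := by
          have : 0 ≤ 2 * c * lam ^ 2 := by positivity
          nlinarith
        refine mul_le_mul_right ((gv_exp_sq x _ (by positivity) h1).trans ?_) _
        refine ENNReal.ofReal_le_ofReal (Real.exp_le_exp.2 ?_)
        linarith
    _ = _ := by rw [← ENNReal.ofReal_mul (by positivity), ← Real.exp_add]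

/-- mgf of the weighted sum of squares -/
lemma act_sq_mgf {p n : ℕ} (hd : ∀ x, HasDerivAt φ (φ' x) x) (hb : ∀ x, |φ' x| ≤ lam) (hc' : Continuous φ')
    (B : ℝ) (X : Matrix (Fin p) (Fin n) ℝ) (hX : opNorm X ≤ B)
    (hX2 : ∀ a, ∑ i, X i a ^ 2 ≤ 2) (v : Fin n → ℝ) (hv : ∑ a, v a ^ 2 ≤ 1)
    (s : ℝ) (hs : 8 * s ^ 2 * B ^ 2 * lam ^ 2 * (2 * φ 0 ^ 2 + 16 * lam ^ 2) ≤ 1 / 2) :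
    ∫⁻ w, ENNReal.ofReal (Real.exp (s * ((∑ a, v a * φ (∑ i, w i * X i a) ^ 2) - ∫ w, (∑ a, v a * φ (∑ i, w i * X i a) ^ 2) ∂(gaussianVec p)))) ∂(gaussianVec p)
      ≤ ENNReal.ofReal (Real.exp 1) := by
  have hφ := act_cont hd
  have hd2 : ∀ x, HasDerivAt (fun x => φ x ^ 2) (2 * φ x * φ' x) x := by
    intro x
    have := (hd x).fun_pow 2
    simpa using this
  have hfi : Integrable (fun w : Fin p → ℝ => ∑ a, v a * φ (∑ i, w i * X i a) ^ 2) (gaussianVec p) := integrable_finsetSum _ fun a _ =>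
    ((act_vec_memLp hd hb fun i => X i a).integrable_sq).const_mul _
  have h1 := mp_exp (fun w : Fin p → ℝ => ∑ a, v a * φ (∑ i, w i * X i a) ^ 2)
    (fun w j => ∑ a, X j a * (v a * (2 * φ (∑ i, w i * X i a) * φ' (∑ i, w i * X i a)))) (ridge_hasFDeriv hd2 X v) (by fun_prop) hfi s
  refine h1.trans ?_
  set c := 8 * s ^ 2 * B ^ 2 * lam ^ 2 with hc
  have hc0 : 0 ≤ c := by positivity
  have hg : ∀ w : Fin p → ℝ, 2 * s ^ 2 * ∑ j, (∑ a, X j a * (v a * (2 * φ (∑ i, w i * X i a) * φ' (∑ i, w i * X i a)))) ^ 2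
      ≤ ∑ a, v a ^ 2 * (c * φ (∑ i, w i * X i a) ^ 2) := by
    intro w
    have h2 := opNorm_bound' hX (fun a => (v a * (2 * φ (∑ i, w i * X i a) * φ' (∑ i, w i * X i a))))
    have h3 : ∑ a, (v a * (2 * φ (∑ i, w i * X i a) * φ' (∑ i, w i * X i a))) ^ 2 ≤ ∑ a, 4 * lam ^ 2 * (v a ^ 2 * φ (∑ i, w i * X i a) ^ 2) := by
      refine Finset.sum_le_sum fun a _ => ?_
      have h4 : φ' (∑ i, w i * X i a) ^ 2 ≤ lam ^ 2 := by
        rw [← sq_abs]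
        have := hb (∑ i, w i * X i a)
        gcongr
      calc _ = 4 * φ' (∑ i, w i * X i a) ^ 2 * (v a ^ 2 * φ (∑ i, w i * X i a) ^ 2) := by ring
        _ ≤ _ := by gcongr
    calc _ ≤ 2 * s ^ 2 * (B ^ 2 * ∑ a, 4 * lam ^ 2 * (v a ^ 2 * φ (∑ i, w i * X i a) ^ 2)) := by
          refine mul_le_mul_of_nonneg_left (h2.trans ?_) (by positivity)
          gcongr
      _ = _ := by
          simp only [Finset.mul_sum, hc]
          exact Finset.sum_congr rfl fun a _ => by ring
  have hsum0 : 0 ≤ ∑ a, v a ^ 2 := Finset.sum_nonneg fun i _ => sq_nonneg _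
  have hmeas : ∀ a, Measurable fun w : Fin p → ℝ => ENNReal.ofReal (Real.exp (c * φ (∑ i, w i * X i a) ^ 2)) := fun a =>
    ENNReal.measurable_ofReal.comp (Continuous.measurable (by fun_prop))
  calc _ ≤ ∫⁻ w, ((∑ a, ENNReal.ofReal (v a ^ 2) * ENNReal.ofReal (Real.exp (c * φ (∑ i, w i * X i a) ^ 2))) + ENNReal.ofReal (1 - ∑ a, v a ^ 2)) ∂(gaussianVec p) := by
        refine lintegral_mono fun w => ?_
        refine (ENNReal.ofReal_le_ofReal ((Real.exp_le_exp.2 (hg w)).trans (exp_convex_sum v _ hv))).trans ?_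
        rw [ENNReal.ofReal_add (Finset.sum_nonneg fun i _ => by positivity) (by linarith), ENNReal.ofReal_sum_of_nonneg (fun i _ => by positivity)]
        gcongr with a
        rw [ENNReal.ofReal_mul (sq_nonneg _)]
    _ = (∑ a, ENNReal.ofReal (v a ^ 2) * ∫⁻ w, ENNReal.ofReal (Real.exp (c * φ (∑ i, w i * X i a) ^ 2)) ∂(gaussianVec p)) + ENNReal.ofReal (1 - ∑ a, v a ^ 2) := by
        rw [lintegral_add_right _ measurable_const, lintegral_finsetSum _ fun a _ => (hmeas a).const_mul _]
        congr 1
        · refine Finset.sum_congr rfl fun a _ => ?_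
          rw [lintegral_const_mul _ (hmeas a)]
        · simp
    _ ≤ (∑ a, ENNReal.ofReal (v a ^ 2) * ENNReal.ofReal (Real.exp 1)) + ENNReal.ofReal (1 - ∑ a, v a ^ 2) := by
        gcongr with a
        refine (act_exp_sq hd hb (fun i => X i a) (hX2 a) c hc0 ?_).trans ?_
        · nlinarith [mul_nonneg hc0 (sq_nonneg (φ 0))]
        · gcongr
          nlinarith [mul_nonneg hc0 (sq_nonneg (lam))]
    _ ≤ _ := by
        rw [← Finset.sum_mul, ← ENNReal.ofReal_sum_of_nonneg (fun i _ => by positivity), ← ENNReal.ofReal_mul hsum0,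
          ← ENNReal.ofReal_add (by positivity) (by linarith)]
        gcongr
        have := Real.add_one_le_exp 1
        nlinarith

lemma act_fourth {p n : ℕ} (d : ℕ) (hd : ∀ x, HasDerivAt φ (φ' x) x) (hb : ∀ x, |φ' x| ≤ lam) (hc' : Continuous φ')
    (B : ℝ) (X : Matrix (Fin p) (Fin n) ℝ) (hX : opNorm X ≤ B)
    (hX2 : ∀ a, ∑ i, X i a ^ 2 ≤ 2)
    (s : ℝ) (hs0 : 0 ≤ s) (hs : 8 * s ^ 2 * B ^ 2 * lam ^ 2 * (2 * φ 0 ^ 2 + 16 * lam ^ 2) ≤ 1 / 2) (T : ℝ) (hT : 0 ≤ T) :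
    gaussianMat d p {Y | (3 * (T * d)) ^ 2 < ∑ a, (∑ i, (φ (∑ k, Y i k * X k a) ^ 2 - ∫ t, φ (√(∑ k, X k a ^ 2) * t) ^ 2 ∂(gaussianReal 0 1))) ^ 2} ≤
      3 ^ n * ENNReal.ofReal (2 * Real.exp (d * (1 - s * T))) := by
  have hφ := act_cont hd
  set m : Fin n → ℝ := fun a => ∫ t, φ (√(∑ k, X k a ^ 2) * t) ^ 2 ∂(gaussianReal 0 1) with hm
  have hmean : ∀ v : Fin n → ℝ, ∫ w, (∑ a, v a * φ (∑ i, w i * X i a) ^ 2) ∂(gaussianVec p) = ∑ a, v a * m a := by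
    intro v
    rw [integral_finsetSum _ fun a _ => ((act_vec_memLp hd hb fun i => X i a).integrable_sq).const_mul _]
    refine Finset.sum_congr rfl fun a _ => ?_
    rw [integral_const_mul, gv_integral (fun i => X i a) (fun t => φ t ^ 2) (by fun_prop)]
  let M : (Fin d → Fin p → ℝ) → Matrix (Fin 1) (Fin n) ℝ := fun Y => Matrix.of fun _ a => ∑ i, (φ (∑ k, Y i k * X k a) ^ 2 - m a)
  have hnet := net_lemma (gaussianMat d p) M (fun i j => Continuous.measurable (by simp only [M, Matrix.of_apply]; fun_prop)) (T * d)
    (ENNReal.ofReal (2 * Real.exp (d * (1 - s * T)))) (by positivity) ?_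
  · refine le_trans (measure_mono ?_) hnet
    intro Y hY
    simp only [Set.mem_ofPred_eq] at hY ⊢
    by_contra hcon
    push Not at hcon
    have := opNorm_transpose_bound hcon (fun _ => 1)
    simp [M] at this
    simp [Finset.sum_sub_distrib] at hY
    linarith
  · intro v hv
    have key : ∀ s' : ℝ, s' ^ 2 = s ^ 2 → ∫⁻ w, ENNReal.ofReal (Real.exp (s' * ((∑ a, v a * φ (∑ i, w i * X i a) ^ 2) - ∑ a, v a * m a))) ∂(gaussianVec p)
      ≤ ENNReal.ofReal (Real.exp 1) := by
      intro s' hs'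
      have := act_sq_mgf hd hb hc' B X hX hX2 v hv s' (by rw [hs']; exact hs)
      rwa [hmean] at this
    have c1 := chernoff_pi (gaussianVec p) d (fun w => (∑ a, v a * φ (∑ i, w i * X i a) ^ 2) - ∑ a, v a * m a)
      (Continuous.measurable (by fun_prop)) s T hs0 1 (key s rfl)
    have c2 := chernoff_pi (gaussianVec p) d (fun w => -((∑ a, v a * φ (∑ i, w i * X i a) ^ 2) - ∑ a, v a * m a))
      (Continuous.measurable (by fun_prop)) s T hs0 1 (by
        refine le_trans (le_of_eq (lintegral_congr fun w => ?_)) (key (-s) (neg_sq s))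
        congr 2
        ring)
    refine le_trans (measure_mono ?_) ((measure_union_le _ _).trans ((add_le_add c1 c2).trans ?_))
    · intro Y hY
      simp only [Set.mem_ofPred_eq, Set.mem_union] at hY ⊢
      rw [Finset.sum_neg_distrib, ← lt_abs]
      have e : ∑ a, M Y 0 a * v a = ∑ i, ((∑ a, v a * φ (∑ k, Y i k * X k a) ^ 2) - ∑ a, v a * m a) := by
        simp only [M, Matrix.of_apply, Finset.sum_mul]
        rw [Finset.sum_comm]
        refine Finset.sum_congr rfl fun i _ => ?_
        rw [← Finset.sum_sub_distrib]
        exact Finset.sum_congr rfl fun a _ => by ring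
      rw [Fin.sum_univ_one, e] at hY
      rw [← sq_abs (∑ i, _)] at hY
      exact lt_of_pow_lt_pow_left₀ 2 (abs_nonneg _) hY
    · rw [← ENNReal.ofReal_add (by positivity) (by positivity)]
      gcongr
      linarith

end act

section act
variable {φ φ' : ℝ → ℝ} {lam : ℝ}

lemma gv_dot_sq {p : ℕ} (x : Fin p → ℝ) : ∫ w, (∑ i, w i * x i) ^ 2 ∂(gaussianVec p) = ∑ i, x i ^ 2 := by
  rw [gv_integral x (fun t => t ^ 2) (by fun_prop)]
  simp only [mul_pow, integral_const_mul, gr_sq, mul_one]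
  exact Real.sq_sqrt (Finset.sum_nonneg fun i _ => sq_nonneg _)

lemma two_point {p : ℕ} (hd : ∀ x, HasDerivAt φ (φ' x) x) (hb : ∀ x, |φ' x| ≤ lam) (x y : Fin p → ℝ)
    (δ : ℝ) (hδ : δ ≤ 1 / 4) (hx : |(∑ i, x i ^ 2) - 1| ≤ δ) (hy : |(∑ i, y i ^ 2) - 1| ≤ δ) (hxy : |∑ i, x i * y i| ≤ δ) :
    |(∫ w, φ (∑ i, w i * x i) * φ (∑ i, w i * y i) ∂(gaussianVec p)) - (∫ t, φ t ∂(gaussianReal 0 1)) ^ 2|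
      ≤ (2 * lam * (2 * φ 0 ^ 2 + 4 * lam ^ 2 + 2 + 1) + 3 * lam * (|∫ t, φ t ∂(gaussianReal 0 1)| + lam)) * δ := by
  have hl := act_lam hb
  have hφ := act_cont hd
  have hδ0 : 0 ≤ δ := (abs_nonneg _).trans hx
  set sx := ∑ i, x i ^ 2 with hsx
  set sy := ∑ i, y i ^ 2 with hsy
  set r := ∑ i, x i * y i with hr
  have hx' := abs_le.1 hx
  have hy' := abs_le.1 hy
  have hr' := abs_le.1 hxy
  have hsx0 : 0 < sx := by linarith
  set ρ := r / sx with hρ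
  have hρb : |ρ| ≤ 2 * δ := by
    rw [hρ, abs_div, abs_of_pos hsx0, div_le_iff₀ hsx0]
    nlinarith
  set z : Fin p → ℝ := fun i => y i - ρ * x i with hz
  have hxz : ∑ i, x i * z i = 0 := by
    have : ∑ i, x i * z i = r - ρ * sx := by
      rw [hr, hsx, Finset.mul_sum, ← Finset.sum_sub_distrib]
      exact Finset.sum_congr rfl fun i _ => by simp only [hz]; ring
    rw [this, hρ]; field_simp; ring
  have hsz : ∑ i, z i ^ 2 = sy - ρ * r := by
    have h1 : ∑ i, z i ^ 2 = sy - ρ * r - ρ * ∑ i, x i * z i := by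
      rw [hsy, hr, Finset.mul_sum, Finset.mul_sum, ← Finset.sum_sub_distrib, ← Finset.sum_sub_distrib]
      exact Finset.sum_congr rfl fun i _ => by simp only [hz]; ring
    rw [h1, hxz]; ring
  have hρr : |ρ * r| ≤ δ := by
    rw [abs_mul]
    calc |ρ| * |r| ≤ (2 * δ) * δ := by gcongr
      _ ≤ δ := by nlinarith
  have hzb : |(∑ i, z i ^ 2) - 1| ≤ 2 * δ := by
    rw [hsz]
    have := abs_le.1 hρr
    rw [abs_le]; constructor <;> linarith
  set μ := ∫ t, φ t ∂(gaussianReal 0 1) with hμ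
  set ex := ∫ w, φ (∑ i, w i * x i) ∂(gaussianVec p) with hex
  set ez := ∫ w, φ (∑ i, w i * z i) ∂(gaussianVec p) with hez
  have hexb : |ex - μ| ≤ lam * δ := by
    rw [hex, gv_integral x φ hφ.measurable]
    exact (act_scale hd hb _ hsx0.le).trans (by gcongr)
  have hezb : |ez - μ| ≤ lam * (2 * δ) := by
    rw [hez, gv_integral z φ hφ.measurable]
    exact (act_scale hd hb _ (Finset.sum_nonneg fun i _ => sq_nonneg _)).trans (by gcongr)
  have hind : ∫ w, φ (∑ i, w i * x i) * φ (∑ i, w i * z i) ∂(gaussianVec p) = ex * ez := by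
    have := (gv_pair_indep x z hxz).comp hφ.measurable hφ.measurable
    exact this.integral_fun_mul_eq_mul_integral (Continuous.aestronglyMeasurable (by fun_prop)) (Continuous.aestronglyMeasurable (by fun_prop))
  have mx := act_vec_memLp hd hb x
  have my := act_vec_memLp hd hb y
  have mz := act_vec_memLp hd hb z
  have ixy : Integrable (fun w : Fin p → ℝ => φ (∑ i, w i * x i) * φ (∑ i, w i * y i)) (gaussianVec p) := mx.integrable_mul my
  have ixz : Integrable (fun w : Fin p → ℝ => φ (∑ i, w i * x i) * φ (∑ i, w i * z i)) (gaussianVec p) := mx.integrable_mul mz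
  have isq : Integrable (fun w : Fin p → ℝ => (∑ i, w i * x i) ^ 2) (gaussianVec p) := (dot_memLp x).integrable_sq
  have hdiff : |(∫ w, φ (∑ i, w i * x i) * φ (∑ i, w i * y i) ∂(gaussianVec p)) - ex * ez| ≤ lam * (2 * δ) * (2 * φ 0 ^ 2 + 4 * lam ^ 2 + 2 + 1) := by
    rw [← hind, ← integral_sub ixy ixz]
    refine abs_integral_le_integral_abs.trans ?_
    calc _ ≤ ∫ w, lam * (2 * δ) * (2 * φ 0 ^ 2 + (2 * lam ^ 2 + 1) * (∑ i, w i * x i) ^ 2) ∂(gaussianVec p) := by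
          refine integral_mono (ixy.sub ixz).abs (((integrable_const _).add (isq.const_mul _)).const_mul _) fun w => ?_
          show |φ (∑ i, w i * x i) * φ (∑ i, w i * y i) - φ (∑ i, w i * x i) * φ (∑ i, w i * z i)| ≤ lam * (2 * δ) * (2 * φ 0 ^ 2 + (2 * lam ^ 2 + 1) * (∑ i, w i * x i) ^ 2)
          set u := ∑ i, w i * x i with hu
          have e : (∑ i, w i * y i) - ∑ i, w i * z i = ρ * u := by
            rw [hu, Finset.mul_sum, ← Finset.sum_sub_distrib]
            exact Finset.sum_congr rfl fun i _ => by simp only [hz]; ring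
          have h1 := act_lip hd hb (∑ i, w i * y i) (∑ i, w i * z i)
          rw [e, abs_mul] at h1
          rw [← mul_sub, abs_mul]
          have h2 := act_growth_sq hd hb u
          have h3 : |φ u| * |u| ≤ 2 * φ 0 ^ 2 + (2 * lam ^ 2 + 1) * u ^ 2 := by
            nlinarith [sq_nonneg (|φ u| - |u|), sq_abs (φ u), sq_abs u, sq_nonneg (φ u), sq_nonneg u, sq_nonneg (φ 0), mul_nonneg (sq_nonneg lam) (sq_nonneg u)]
          calc _ ≤ |φ u| * (lam * (|ρ| * |u|)) := by gcongr
            _ = lam * |ρ| * (|φ u| * |u|) := by ring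
            _ ≤ _ := by gcongr
      _ ≤ _ := by
          rw [integral_const_mul, integral_add (integrable_const _) (isq.const_mul _)]
          simp only [integral_const_mul, gv_dot_sq]
          simp only [integral_const, probReal_univ, smul_eq_mul, one_mul]
          rw [← hsx]
          refine mul_le_mul_of_nonneg_left ?_ (by positivity)
          have : sx ≤ 5 / 4 := by linarith
          nlinarith [sq_nonneg lam]
  have hprod : |ex * ez - μ ^ 2| ≤ 3 * lam * (|μ| + lam) * δ := by
    have e : ex * ez - μ ^ 2 = (ex - μ) * (ez - μ) + μ * (ex - μ) + μ * (ez - μ) := by ring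
    rw [e]
    refine (abs_add_le _ _).trans ((add_le_add (abs_add_le _ _) le_rfl).trans ?_)
    rw [abs_mul, abs_mul, abs_mul]
    have h1 : |ex - μ| * |ez - μ| ≤ (lam * δ) * (lam * (2 * δ)) := by gcongr
    have h2 : |μ| * |ex - μ| ≤ |μ| * (lam * δ) := by gcongr
    have h3 : |μ| * |ez - μ| ≤ |μ| * (lam * (2 * δ)) := by gcongr
    have h4 : (lam * δ) * (lam * (2 * δ)) ≤ 3 * lam * lam * δ := by
      calc (lam * δ) * (lam * (2 * δ)) = lam * lam * δ * (2 * δ) := by ring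
        _ ≤ lam * lam * δ * 3 := by gcongr; linarith
        _ = _ := by ring
    have h5 : 3 * lam * (|μ| + lam) * δ = 3 * lam * lam * δ + |μ| * (lam * δ) + |μ| * (lam * (2 * δ)) := by ring
    linarith
  have := abs_sub_le (∫ w, φ (∑ i, w i * x i) * φ (∑ i, w i * y i) ∂(gaussianVec p)) (ex * ez) (μ ^ 2)
  have h5 : (2 * lam * (2 * φ 0 ^ 2 + 4 * lam ^ 2 + 2 + 1) + 3 * lam * (|μ| + lam)) * δ =
    lam * (2 * δ) * (2 * φ 0 ^ 2 + 4 * lam ^ 2 + 2 + 1) + 3 * lam * (|μ| + lam) * δ := by ring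
  linarith

noncomputable def kap (φ : ℝ → ℝ) {n : ℕ} (a b : Fin n) : ℝ :=
  if a = b then ∫ t, φ t ^ 2 ∂(gaussianReal 0 1) else (∫ t, φ t ∂(gaussianReal 0 1)) ^ 2

/-- near orthonormality (no norm bounds) -/
def NearO {p n : ℕ} (δ : ℝ) (X : Matrix (Fin p) (Fin n) ℝ) : Prop :=
  (∀ a : Fin n, |(∑ i, X i a ^ 2) - 1| ≤ δ) ∧ (∀ a b : Fin n, a ≠ b → |∑ i, X i a * X i b| ≤ δ)

lemma corr_mean (hd : ∀ x, HasDerivAt φ (φ' x) x) (hb : ∀ x, |φ' x| ≤ lam) :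
    ∃ C : ℝ, 0 < C ∧ ∀ (p n : ℕ) (X : Matrix (Fin p) (Fin n) ℝ) (δ : ℝ), δ ≤ 1 / 4 → NearO δ X → ∀ a b : Fin n,
      |(∫ w, φ (∑ i, w i * X i a) * φ (∑ i, w i * X i b) ∂(gaussianVec p)) - kap φ a b| ≤ C * δ := by
  have hl := act_lam hb
  refine ⟨(2 * lam * (2 * φ 0 ^ 2 + 4 * lam ^ 2 + 2 + 1) + 3 * lam * (|∫ t, φ t ∂(gaussianReal 0 1)| + lam)) + lam * (2 * |φ 0| + 3 * lam) + 1, by positivity, ?_⟩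
  intro p n X δ hδ hX a b
  have hδ0 : 0 ≤ δ := (abs_nonneg _).trans (hX.1 a)
  have hφ := act_cont hd
  by_cases hab : a = b
  · subst hab
    simp only [kap, if_true, ← sq]
    rw [gv_integral (fun i => X i a) (fun t => φ t ^ 2) (by fun_prop)]
    have h1 := abs_le.1 (hX.1 a)
    refine (act_scale_sq hd hb _ (Finset.sum_nonneg fun i _ => sq_nonneg _) (by linarith)).trans ?_
    refine mul_le_mul ?_ (hX.1 a) (abs_nonneg _) (by positivity)
    have : 0 ≤ (2 * lam * (2 * φ 0 ^ 2 + 4 * lam ^ 2 + 2 + 1) + 3 * lam * (|∫ t, φ t ∂(gaussianReal 0 1)| + lam)) := by positivity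
    linarith
  · simp only [kap, if_neg hab]
    refine (two_point hd hb (fun i => X i a) (fun i => X i b) δ hδ (hX.1 a) (hX.1 b) (hX.2 a b hab)).trans ?_
    refine mul_le_mul_of_nonneg_right ?_ hδ0
    have : 0 ≤ lam * (2 * |φ 0| + 3 * lam) := by positivity
    linarith

lemma corr_tail (hd : ∀ x, HasDerivAt φ (φ' x) x) (hb : ∀ x, |φ' x| ≤ lam) (δ : ℝ) (hδ : 0 < δ) :
    ∃ δ' c' : ℝ, 0 < δ' ∧ 0 < c' ∧ ∀ (p n d : ℕ) (X : Matrix (Fin p) (Fin n) ℝ), NearO δ' X →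
      gaussianMat d p {Y | ∃ a b : Fin n, δ * d < |(∑ i, φ (∑ k, Y i k * X k a) * φ (∑ k, Y i k * X k b)) - d * kap φ a b|}
        ≤ ENNReal.ofReal ((n : ℝ) ^ 2 * (2 * Real.exp (-(c' * d)))) := by
  have hφ := act_cont hd
  obtain ⟨C, hC, hCm⟩ := corr_mean hd hb
  set c := 1 / (16 * (lam ^ 2 + 1)) with hc
  have hc0 : 0 < c := by positivity
  have hcl : 4 * c * lam ^ 2 ≤ 1 / 4 := by
    rw [hc]
    have : 4 * (1 / (16 * (lam ^ 2 + 1))) * lam ^ 2 = lam ^ 2 / (4 * (lam ^ 2 + 1)) := by field_simp; norm_num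
    rw [this, div_le_div_iff₀ (by positivity) (by norm_num)]
    linarith
  obtain ⟨c', hc', hbern⟩ := bernstein_tail c (Real.exp (2 * c * φ 0 ^ 2 + 1 / 2)) (δ / 2) hc0 (Real.one_le_exp (by positivity)) (by positivity)
  refine ⟨min (1 / 4) (δ / (2 * C)), c', by positivity, hc', ?_⟩
  intro p n d X hX
  set δ' := min (1 / 4) (δ / (2 * C)) with hδ'
  have hCδ : C * δ' ≤ δ / 2 := by
    calc C * δ' ≤ C * (δ / (2 * C)) := by gcongr; exact min_le_right _ _
      _ = δ / 2 := by field_simp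
  have h4 : δ' ≤ 1 / 4 := min_le_left _ _
  have hX2 : ∀ a, ∑ i, X i a ^ 2 ≤ 2 := fun a => by have := abs_le.1 (hX.1 a); linarith
  have one : ∀ a b : Fin n, gaussianMat d p {Y | δ * d < |(∑ i, φ (∑ k, Y i k * X k a) * φ (∑ k, Y i k * X k b)) - d * kap φ a b|}
      ≤ ENNReal.ofReal (2 * Real.exp (-(c' * d))) := by
    intro a b
    have := hbern (Fin p → ℝ) (gaussianVec p) (fun w => φ (∑ k, w k * X k a) * φ (∑ k, w k * X k b)) (Continuous.measurable (by fun_prop)) ?_ d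
    · refine le_trans (measure_mono ?_) this
      intro Y hY
      simp only [Set.mem_ofPred_eq] at hY ⊢
      rw [Finset.sum_sub_distrib]
      simp only [Finset.sum_const, Finset.card_univ, Fintype.card_fin, nsmul_eq_mul]
      have hm := hCm p n X δ' h4 hX a b
      set S := ∑ i, φ (∑ k, Y i k * X k a) * φ (∑ k, Y i k * X k b)
      set I := ∫ w, φ (∑ i, w i * X i a) * φ (∑ i, w i * X i b) ∂(gaussianVec p)
      have h5 := abs_sub_le S (d * I) (d * kap φ a b)
      rw [← mul_sub, abs_mul, Nat.abs_cast] at h5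
      have hd0 : (0 : ℝ) ≤ d := by positivity
      have h6 : (d : ℝ) * |I - kap φ a b| ≤ d * (δ / 2) := by gcongr; linarith
      linarith
    · have hA : ∀ a : Fin n, ∫⁻ w, ENNReal.ofReal (Real.exp (c * φ (∑ i, w i * X i a) ^ 2)) ∂(gaussianVec p) ≤ ENNReal.ofReal (Real.exp (2 * c * φ 0 ^ 2 + 1 / 2)) :=
        fun a => act_exp_sq hd hb (fun i => X i a) (hX2 a) c hc0.le hcl
      have hmeas : ∀ a, Measurable fun w : Fin p → ℝ => ENNReal.ofReal (Real.exp (c * φ (∑ i, w i * X i a) ^ 2)) := fun a =>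
        ENNReal.measurable_ofReal.comp (Continuous.measurable (by fun_prop))
      calc _ ≤ ∫⁻ w, (ENNReal.ofReal (1 / 2) * ENNReal.ofReal (Real.exp (c * φ (∑ i, w i * X i a) ^ 2)) + ENNReal.ofReal (1 / 2) * ENNReal.ofReal (Real.exp (c * φ (∑ i, w i * X i b) ^ 2))) ∂(gaussianVec p) := by
            refine lintegral_mono fun w => ?_
            rw [← ENNReal.ofReal_mul (by positivity), ← ENNReal.ofReal_mul (by positivity), ← ENNReal.ofReal_add (by positivity) (by positivity)]
            refine ENNReal.ofReal_le_ofReal ?_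
            have hcv := convexOn_exp.2 (Set.mem_univ (c * φ (∑ i, w i * X i a) ^ 2)) (Set.mem_univ (c * φ (∑ i, w i * X i b) ^ 2)) (show (0:ℝ) ≤ 1 / 2 by norm_num) (show (0:ℝ) ≤ 1 / 2 by norm_num) (by norm_num)
            simp only [smul_eq_mul] at hcv
            refine le_trans (Real.exp_le_exp.2 ?_) hcv
            rw [abs_mul]
            have : |φ (∑ i, w i * X i a)| * |φ (∑ i, w i * X i b)| ≤ 1 / 2 * φ (∑ i, w i * X i a) ^ 2 + 1 / 2 * φ (∑ i, w i * X i b) ^ 2 := by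
              nlinarith [sq_nonneg (|φ (∑ i, w i * X i a)| - |φ (∑ i, w i * X i b)|), sq_abs (φ (∑ i, w i * X i a)), sq_abs (φ (∑ i, w i * X i b))]
            nlinarith
        _ = ENNReal.ofReal (1 / 2) * (∫⁻ w, ENNReal.ofReal (Real.exp (c * φ (∑ i, w i * X i a) ^ 2)) ∂(gaussianVec p)) + ENNReal.ofReal (1 / 2) * ∫⁻ w, ENNReal.ofReal (Real.exp (c * φ (∑ i, w i * X i b) ^ 2)) ∂(gaussianVec p) := by
            rw [lintegral_add_left ((hmeas a).const_mul _), lintegral_const_mul _ (hmeas a), lintegral_const_mul _ (hmeas b)]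
        _ ≤ ENNReal.ofReal (1 / 2) * ENNReal.ofReal (Real.exp (2 * c * φ 0 ^ 2 + 1 / 2)) + ENNReal.ofReal (1 / 2) * ENNReal.ofReal (Real.exp (2 * c * φ 0 ^ 2 + 1 / 2)) := by
            gcongr
            · exact hA a
            · exact hA b
        _ = _ := by
            rw [← ENNReal.ofReal_mul (by positivity), ← ENNReal.ofReal_add (by positivity) (by positivity)]
            congr 1; ring
  have hsub : {Y : Fin d → Fin p → ℝ | ∃ a b : Fin n, δ * d < |(∑ i, φ (∑ k, Y i k * X k a) * φ (∑ k, Y i k * X k b)) - d * kap φ a b|}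
      ⊆ ⋃ ab : Fin n × Fin n, {Y | δ * d < |(∑ i, φ (∑ k, Y i k * X k ab.1) * φ (∑ k, Y i k * X k ab.2)) - d * kap φ ab.1 ab.2|} := by
    rintro Y ⟨a, b, h⟩
    exact Set.mem_iUnion.2 ⟨(a, b), h⟩
  refine (measure_mono hsub).trans ((measure_iUnion_fintype_le _ _).trans ((Finset.sum_le_sum fun ab _ => one ab.1 ab.2).trans ?_))
  rw [Finset.sum_const, nsmul_eq_mul]
  have e : ((Finset.univ : Finset (Fin n × Fin n)).card : ENNReal) = ENNReal.ofReal ((n : ℝ) ^ 2) := by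
    rw [ENNReal.ofReal_pow (by positivity)]; simp [sq]
  rw [e, ← ENNReal.ofReal_mul (by positivity)]

end act

lemma slice_pi {ι : Type} [Fintype ι] [DecidableEq ι] {X : ι → Type} [∀ i, MeasurableSpace (X i)]
    (μ : ∀ i, Measure (X i)) [∀ i, IsProbabilityMeasure (μ i)] (k : ι) (E : Set (∀ i, X i))
    (hE : MeasurableSet E) (η : ENNReal) (h : ∀ x, μ k {y | Function.update x k y ∈ E} ≤ η) :
    Measure.pi μ E ≤ η := by
  have : ∀ i, Nonempty (X i) := fun i => (nonempty_of_isProbabilityMeasure (μ i))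
  have x0 : ∀ i, X i := fun i => Classical.arbitrary _
  have hm : Measurable (E.indicator (fun _ => (1 : ENNReal))) := measurable_const.indicator hE
  rw [← lintegral_indicator_one hE]
  change ∫⁻ x, E.indicator (fun _ => (1 : ENNReal)) x ∂_ ≤ _
  rw [lintegral_eq_lmarginal_univ x0, lmarginal_erase' _ hm (Finset.mem_univ k)]
  have hle : (fun x => ∫⁻ y, E.indicator (fun _ => (1 : ENNReal)) (Function.update x k y) ∂(μ k)) ≤ fun _ => η := by
    intro x
    refine le_trans (le_of_eq ?_) (h x)
    have hm2 : MeasurableSet {y | Function.update x k y ∈ E} := (measurable_update x) hE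
    rw [← lintegral_indicator_one hm2]
    rfl
  refine (lmarginal_mono hle x0).trans ?_
  simp [lmarginal]

lemma bc_event {Ω : Type*} [MeasurableSpace Ω] (Pr : Measure Ω) [IsProbabilityMeasure Pr] (s : ℕ → Set Ω) (a : ℕ → ℝ)
    (ha : Summable a) (h : ∀ᶠ n in atTop, Pr (s n) ≤ ENNReal.ofReal (a n)) :
    ∀ᵐ ω ∂Pr, ∀ᶠ n in atTop, ω ∉ s n := by
  obtain ⟨N, hN⟩ := eventually_atTop.1 h
  have h1 : (∑' i, Pr ((fun n => if N ≤ n then s n else ∅) i)) ≠ ⊤ := by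
    have hs : Summable fun n => |a n| := ha.abs
    have := hs.tsum_ofReal_ne_top
    refine ne_top_of_le_ne_top this (ENNReal.tsum_le_tsum fun n => ?_)
    by_cases hn : N ≤ n
    · simp only [hn, if_true]
      exact (hN n hn).trans (ENNReal.ofReal_le_ofReal (le_abs_self _))
    · simp [hn]
  filter_upwards [ae_eventually_notMem h1] with ω hω
  filter_upwards [hω, eventually_ge_atTop N] with n hn hNn
  simpa [hNn] using hn

/-- sequences of weight matrices -/
abbrev WS (d : ℕ → ℕ) : Type := (ℓ : ℕ) → Fin (d (ℓ + 1)) → Fin (d ℓ) → ℝ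

abbrev WF (Lm : ℕ) (d : ℕ → ℕ) : Type := (ℓ : Fin (Lm + 1)) → Fin (d ((ℓ : ℕ) + 1)) → Fin (d (ℓ : ℕ)) → ℝ

def extW (Lm : ℕ) (d : ℕ → ℕ) (x : WF Lm d) : WS d := fun m =>
  if h : m < Lm + 1 then x ⟨m, h⟩ else fun _ _ => 0

lemma extW_measurable (Lm : ℕ) (d : ℕ → ℕ) : Measurable (extW Lm d) := by
  refine measurable_pi_iff.2 fun m => ?_
  by_cases h : m < Lm + 1
  · simp only [extW, h, dif_pos]
    exact measurable_pi_apply _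
  · simp only [extW, h, dif_neg, not_false_iff]
    exact measurable_const

lemma extW_update (Lm : ℕ) (d : ℕ → ℕ) (x : WF Lm d) (k : Fin (Lm + 1)) (y : Fin (d ((k : ℕ) + 1)) → Fin (d (k : ℕ)) → ℝ) :
    extW Lm d (Function.update x k y) = Function.update (extW Lm d x) (k : ℕ) y := by
  funext m
  by_cases hm : m = k
  · subst hm
    simp [extW]
    intro h
    have := k.2
    omega
  · rw [Function.update_of_ne hm]
    by_cases h : m < Lm + 1
    · simp only [extW, h, dif_pos]
      rw [Function.update_of_ne]
      intro hh
      exact hm (by rw [← hh])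
    · simp only [extW, h, dif_neg, not_false_iff]

lemma prod_ae {Ω Y : Type*} [MeasurableSpace Ω] [MeasurableSpace Y] (Pr : Measure Ω) (f : Ω → Y) (ν : Measure Y) [IsProbabilityMeasure ν]
    (h : Measure.map f Pr = ν) : AEMeasurable f Pr := by
  by_contra hc
  rw [Measure.map_of_not_aemeasurable hc] at h
  have := measure_univ (μ := ν)
  rw [← h] at this
  simp at this

section steps
variable {Lm : ℕ} {d : ℕ → ℕ → ℕ} {Ω : Type*} [MeasurableSpace Ω] {Pr : Measure Ω} [IsProbabilityMeasure Pr]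
  {W : (n : ℕ) → (ℓ : ℕ) → Ω → Fin (d n (ℓ + 1)) → Fin (d n ℓ) → ℝ}
  {wOut : (n : ℕ) → Ω → Fin (d n (Lm + 1)) → ℝ}

/-- the law of the weights -/
def LawW (Lm : ℕ) (d : ℕ → ℕ → ℕ) {Ω : Type*} [MeasurableSpace Ω] (Pr : Measure Ω)
    (W : (n : ℕ) → (ℓ : ℕ) → Ω → Fin (d n (ℓ + 1)) → Fin (d n ℓ) → ℝ)
    (wOut : (n : ℕ) → Ω → Fin (d n (Lm + 1)) → ℝ) : Prop :=
    ∀ n : ℕ,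
      Measure.map (fun ω => (fun ℓ : Fin (Lm + 1) => W n ℓ ω, wOut n ω)) Pr =
        (Measure.pi fun ℓ : Fin (Lm + 1) =>
          gaussianMat (d n ((ℓ : ℕ) + 1)) (d n (ℓ : ℕ))).prod
          (gaussianVec (d n (Lm + 1)))

lemma step_W (hW : LawW Lm d Pr W wOut) (k : ℕ) (hk : k ≤ Lm) (G Bad : (n : ℕ) → WS (d n) → Prop)
    (hG : ∀ n (V : WS (d n)) y, G n V → G n (Function.update V k y))
    (hG' : ∀ n (V V' : WS (d n)), (∀ m, m ≤ Lm → V m = V' m) → G n V → G n V')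
    (hB : ∀ n (V V' : WS (d n)), (∀ m, m ≤ Lm → V m = V' m) → Bad n V → Bad n V')
    (hm : ∀ n, MeasurableSet {V : WS (d n) | G n V ∧ Bad n V})
    (a : ℕ → ℝ) (ha : Summable a)
    (hbd : ∀ᶠ n in atTop, ∀ V : WS (d n), G n V → gaussianMat (d n (k + 1)) (d n k) {Y | Bad n (Function.update V k Y)} ≤ ENNReal.ofReal (a n))
    (hg : ∀ᵐ ω ∂Pr, ∀ᶠ n in atTop, G n (fun m => W n m ω)) :
    ∀ᵐ ω ∂Pr, ∀ᶠ n in atTop, ¬ Bad n (fun m => W n m ω) := by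
  have key := bc_event Pr (fun n => {ω | G n (fun m => W n m ω) ∧ Bad n (fun m => W n m ω)}) a ha ?_
  · filter_upwards [key, hg] with ω h1 h2
    filter_upwards [h1, h2] with n h3 h4 h5
    exact h3 ⟨h4, h5⟩
  · filter_upwards [hbd] with n hn
    set E : Set (WF Lm (d n)) := extW Lm (d n) ⁻¹' {V | G n V ∧ Bad n V} with hE
    have hEm : MeasurableSet E := extW_measurable Lm (d n) (hm n)
    have hae := prod_ae Pr _ _ (hW n)
    have hagree : ∀ ω, ∀ m, m ≤ Lm → W n m ω = extW Lm (d n) (fun ℓ : Fin (Lm + 1) => W n ℓ ω) m := by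
      intro ω m hm
      simp [extW, Nat.lt_succ_of_le hm]
    have hsub : {ω | G n (fun m => W n m ω) ∧ Bad n (fun m => W n m ω)} ⊆
        (fun ω => ((fun ℓ : Fin (Lm + 1) => W n ℓ ω : WF Lm (d n)), wOut n ω)) ⁻¹' (E ×ˢ Set.univ) := by
      rintro ω ⟨h1, h2⟩
      refine ⟨⟨hG' n _ _ (hagree ω) h1, hB n _ _ (hagree ω) h2⟩, Set.mem_univ _⟩
    refine (measure_mono hsub).trans ((Measure.le_map_apply hae _).trans ?_)
    rw [hW n, Measure.prod_prod, measure_univ, mul_one]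
    refine slice_pi _ ⟨k, Nat.lt_succ_of_le hk⟩ E hEm _ fun x => ?_
    by_cases hx : G n (extW Lm (d n) x)
    · refine le_trans (measure_mono ?_) (hn _ hx)
      intro y hy
      have hy' : Function.update x ⟨k, Nat.lt_succ_of_le hk⟩ y ∈ E := hy
      rw [hE, Set.mem_preimage, extW_update] at hy'
      exact hy'.2
    · have : {y | Function.update x ⟨k, Nat.lt_succ_of_le hk⟩ y ∈ E} = ∅ := by
        ext y
        simp only [Set.mem_ofPred_eq, Set.mem_empty_iff_false, iff_false]
        intro hy'
        rw [hE, Set.mem_preimage, extW_update] at hy'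
        have := hG n _ (extW Lm (d n) x k) hy'.1
        rw [Function.update_idem, Function.update_eq_self] at this
        exact hx this
      rw [this]; simp

lemma step_out (hW : LawW Lm d Pr W wOut) (G : (n : ℕ) → WS (d n) → Prop) (Bad : (n : ℕ) → WS (d n) → (Fin (d n (Lm + 1)) → ℝ) → Prop)
    (hG' : ∀ n (V V' : WS (d n)), (∀ m, m ≤ Lm → V m = V' m) → G n V → G n V')
    (hB : ∀ n (V V' : WS (d n)) w, (∀ m, m ≤ Lm → V m = V' m) → Bad n V w → Bad n V' w)
    (hm : ∀ n, MeasurableSet {V : WS (d n) × (Fin (d n (Lm + 1)) → ℝ) | G n V.1 ∧ Bad n V.1 V.2})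
    (a : ℕ → ℝ) (ha : Summable a)
    (hbd : ∀ᶠ n in atTop, ∀ V : WS (d n), G n V → gaussianVec (d n (Lm + 1)) {w | Bad n V w} ≤ ENNReal.ofReal (a n))
    (hg : ∀ᵐ ω ∂Pr, ∀ᶠ n in atTop, G n (fun m => W n m ω)) :
    ∀ᵐ ω ∂Pr, ∀ᶠ n in atTop, ¬ Bad n (fun m => W n m ω) (wOut n ω) := by
  have key := bc_event Pr (fun n => {ω | G n (fun m => W n m ω) ∧ Bad n (fun m => W n m ω) (wOut n ω)}) a ha ?_
  · filter_upwards [key, hg] with ω h1 h2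
    filter_upwards [h1, h2] with n h3 h4 h5
    exact h3 ⟨h4, h5⟩
  · filter_upwards [hbd] with n hn
    set E : Set (WF Lm (d n) × (Fin (d n (Lm + 1)) → ℝ)) := (fun p => (extW Lm (d n) p.1, p.2)) ⁻¹' {V | G n V.1 ∧ Bad n V.1 V.2} with hE
    have hEm : MeasurableSet E := (((extW_measurable Lm (d n)).comp measurable_fst).prodMk measurable_snd) (hm n)
    have hae := prod_ae Pr _ _ (hW n)
    have hagree : ∀ ω, ∀ m, m ≤ Lm → W n m ω = extW Lm (d n) (fun ℓ : Fin (Lm + 1) => W n ℓ ω) m := by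
      intro ω m hm
      simp [extW, Nat.lt_succ_of_le hm]
    have hsub : {ω | G n (fun m => W n m ω) ∧ Bad n (fun m => W n m ω) (wOut n ω)} ⊆
        (fun ω => ((fun ℓ : Fin (Lm + 1) => W n ℓ ω : WF Lm (d n)), wOut n ω)) ⁻¹' E := by
      rintro ω ⟨h1, h2⟩
      exact ⟨hG' n _ _ (hagree ω) h1, hB n _ _ _ (hagree ω) h2⟩
    refine (measure_mono hsub).trans ((Measure.le_map_apply hae _).trans ?_)
    rw [hW n, Measure.prod_apply hEm]
    refine le_trans (lintegral_mono (g := fun _ => ENNReal.ofReal (a n)) fun x => ?_) (by simp)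
    by_cases hx : G n (extW Lm (d n) x)
    · exact le_trans (measure_mono fun y hy => hy.2) (hn _ hx)
    · have : Prod.mk x ⁻¹' E = ∅ := by
        ext y
        simp only [Set.mem_preimage, Set.mem_empty_iff_false, iff_false]
        intro hy
        exact hx hy.1
      rw [this]; simp

end steps

section net
variable {σ σ' : ℝ → ℝ} {d : ℕ → ℕ} {n : ℕ} {X0 : Matrix (Fin (d 0)) (Fin n) ℝ}

lemma preact_apply (V : WS d) (k : ℕ) (i : Fin (d (k + 1))) (a : Fin n) :
    preact σ d n V X0 k i a = ∑ p, V k i p * netLayer σ d n V X0 k p a := by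
  simp [preact, Matrix.mul_apply]

lemma netLayer_succ_apply (V : WS d) (k : ℕ) (i : Fin (d (k + 1))) (a : Fin n) :
    netLayer σ d n V X0 (k + 1) i a = (√(d (k + 1)))⁻¹ * σ (∑ p, V k i p * netLayer σ d n V X0 k p a) := by
  simp [netLayer, Matrix.mul_apply]

lemma netLayer_congr (V V' : WS d) (k : ℕ) (h : ∀ m, m < k → V m = V' m) :
    netLayer σ d n V X0 k = netLayer σ d n V' X0 k := by
  induction k with
  | zero => rfl
  | succ k ih =>
    simp only [netLayer]
    rw [ih fun m hm => h m (by omega), h k (by omega)]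

lemma preact_congr (V V' : WS d) (k : ℕ) (h : ∀ m, m ≤ k → V m = V' m) :
    preact σ d n V X0 k = preact σ d n V' X0 k := by
  unfold preact
  rw [netLayer_congr V V' k fun m hm => h m hm.le, h k le_rfl]

lemma netLayer_cont (hσ : Continuous σ) (k : ℕ) : Continuous fun V : WS d => netLayer σ d n V X0 k := by
  induction k with
  | zero => exact continuous_const
  | succ k ih =>
    refine continuous_pi fun i => continuous_pi fun a => ?_
    simp only [netLayer_succ_apply]
    have h : ∀ p, Continuous fun V : WS d => netLayer σ d n V X0 k p a := fun p =>
      (continuous_apply a).comp ((continuous_apply p).comp ih)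
    fun_prop

lemma preact_cont (hσ : Continuous σ) (k : ℕ) (i : Fin (d (k + 1))) (a : Fin n) :
    Continuous fun V : WS d => preact σ d n V X0 k i a := by
  simp only [preact_apply]
  have h : ∀ p, Continuous fun V : WS d => netLayer σ d n V X0 k p a := fun p =>
    (continuous_apply a).comp ((continuous_apply p).comp (netLayer_cont hσ k))
  fun_prop

noncomputable def bp (d : ℕ → ℕ) (V : WS d) (u v : (k : ℕ) → Fin (d (k + 1)) → ℝ) (l0 : ℕ) :
    (k : ℕ) → Matrix (Fin (d (k + 1))) (Fin (d (k + 1))) ℝ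
  | 0 => Matrix.diagonal fun i => u 0 i * v 0 i
  | k + 1 => if k + 1 ≤ l0 then Matrix.diagonal fun i => u (k + 1) i * v (k + 1) i else
      ((d (k + 1) : ℝ))⁻¹ • (Matrix.diagonal (u (k + 1)) * (Matrix.of (V (k + 1)) * bp d V u v l0 k * (Matrix.of (V (k + 1)))ᵀ) * Matrix.diagonal (v (k + 1)))

lemma bp_diag (V : WS d) (u v : (k : ℕ) → Fin (d (k + 1)) → ℝ) (l0 k : ℕ) (h : k ≤ l0) :
    bp d V u v l0 k = Matrix.diagonal fun i => u k i * v k i := by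
  cases k with
  | zero => rfl
  | succ k => simp only [bp, h, if_true]

lemma bp_succ (V : WS d) (u v : (k : ℕ) → Fin (d (k + 1)) → ℝ) (l0 k : ℕ) (h : l0 ≤ k) :
    bp d V u v l0 (k + 1) =
      ((d (k + 1) : ℝ))⁻¹ • (Matrix.diagonal (u (k + 1)) * (Matrix.of (V (k + 1)) * bp d V u v l0 k * (Matrix.of (V (k + 1)))ᵀ) * Matrix.diagonal (v (k + 1))) := by
  simp only [bp, show ¬ (k + 1 ≤ l0) by omega, if_false]

lemma bp_congr (V V' : WS d) (u v u' v' : (k : ℕ) → Fin (d (k + 1)) → ℝ) (l0 k : ℕ)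
    (hV : ∀ m, m ≤ k → V m = V' m) (hu : ∀ m, m ≤ k → u m = u' m) (hv : ∀ m, m ≤ k → v m = v' m) :
    bp d V u v l0 k = bp d V' u' v' l0 k := by
  induction k with
  | zero => simp only [bp, hu 0 le_rfl, hv 0 le_rfl]
  | succ k ih =>
    simp only [bp, hu (k + 1) le_rfl, hv (k + 1) le_rfl, hV (k + 1) le_rfl,
      ih (fun m hm => hV m (by omega)) (fun m hm => hu m (by omega)) (fun m hm => hv m (by omega))]

lemma bp_cont (u v : WS d → (k : ℕ) → Fin (d (k + 1)) → ℝ) (hu : Continuous u) (hv : Continuous v) (l0 k : ℕ) :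
    Continuous fun V : WS d => bp d V (u V) (v V) l0 k := by
  have hu' : ∀ k, Continuous fun V : WS d => u V k := fun k => (continuous_apply k).comp hu
  have hv' : ∀ k, Continuous fun V : WS d => v V k := fun k => (continuous_apply k).comp hv
  induction k with
  | zero =>
    simp only [bp]
    exact Continuous.matrix_diagonal ((hu' 0).mul (hv' 0))
  | succ k ih =>
    by_cases h : k + 1 ≤ l0
    · simp only [bp, h, if_true]
      exact Continuous.matrix_diagonal ((hu' _).mul (hv' _))
    · simp only [bp, h, if_false]
      have hV : Continuous fun V : WS d => Matrix.of (V (k + 1)) := continuous_apply (k + 1)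
      exact (((hu' _).matrix_diagonal.matrix_mul ((hV.matrix_mul ih).matrix_mul hV.matrix_transpose)).matrix_mul (hv' _).matrix_diagonal).const_smul ((d (k + 1) : ℝ)⁻¹)

lemma bp_trace (V : WS d) (u v : (k : ℕ) → Fin (d (k + 1)) → ℝ) (l0 k : ℕ) (h : l0 ≤ k) :
    (bp d V u v l0 (k + 1)).trace =
      (d (k + 1) : ℝ)⁻¹ * ∑ i, u (k + 1) i * v (k + 1) i * ∑ p, ∑ q, V (k + 1) i p * bp d V u v l0 k p q * V (k + 1) i q := by
  rw [bp_succ V u v l0 k h, Matrix.trace_smul, smul_eq_mul]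
  congr 1
  unfold Matrix.trace
  refine Finset.sum_congr rfl fun i _ => ?_
  rw [Matrix.diag_apply, Matrix.mul_diagonal, Matrix.diagonal_mul, Matrix.mul_apply]
  have : ∑ j, (Matrix.of (V (k + 1)) * bp d V u v l0 k) i j * (Matrix.of (V (k + 1)))ᵀ j i =
      ∑ p, ∑ q, V (k + 1) i p * bp d V u v l0 k p q * V (k + 1) i q := by
    rw [Finset.sum_comm]
    refine Finset.sum_congr rfl fun q _ => ?_
    rw [Matrix.mul_apply, Finset.sum_mul]
    rfl
  rw [this]; ring

lemma bp_opNorm_diag (u v : (k : ℕ) → Fin (d (k + 1)) → ℝ) (k : ℕ) (lam : ℝ) 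
    (hu : ∀ i, |u k i| ≤ lam) (hv : ∀ i, |v k i| ≤ lam) :
    opNorm (Matrix.diagonal fun i => u k i * v k i) ≤ lam ^ 2 := by
  refine opNorm_diagonal (sq_nonneg _) fun i => ?_
  rw [abs_mul, sq]
  exact mul_le_mul (hu i) (hv i) (abs_nonneg _) ((abs_nonneg _).trans (hu i))

lemma bp_opNorm_succ (V : WS d) (u v : (k : ℕ) → Fin (d (k + 1)) → ℝ) (l0 k : ℕ) (h : l0 ≤ k) (lam C D : ℝ) (hl : 0 ≤ lam)
    (hu : ∀ i, |u (k + 1) i| ≤ lam) (hv : ∀ i, |v (k + 1) i| ≤ lam) (hC : 0 ≤ C)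
    (hV : opNorm (Matrix.of (V (k + 1))) ≤ C * √(d (k + 1))) (hb : opNorm (bp d V u v l0 k) ≤ D) :
    opNorm (bp d V u v l0 (k + 1)) ≤ lam ^ 2 * C ^ 2 * D := by
  rw [bp_succ V u v l0 k h, opNorm_smul]
  have hD : 0 ≤ D := (opNorm_nonneg _).trans hb
  have h1 := opNorm_diagonal hl hu
  have h2 := opNorm_diagonal hl hv
  have h3 := (opNorm_transpose_le (Matrix.of (V (k + 1)))).trans hV
  have h4 : opNorm (Matrix.diagonal (u (k + 1)) * (Matrix.of (V (k + 1)) * bp d V u v l0 k * (Matrix.of (V (k + 1)))ᵀ) * Matrix.diagonal (v (k + 1)))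
      ≤ (lam * (((C * √(d (k + 1))) * D) * (C * √(d (k + 1))))) * lam := by
    refine (opNorm_mul _ _).trans (mul_le_mul ?_ h2 (opNorm_nonneg _) (by positivity))
    refine (opNorm_mul _ _).trans (mul_le_mul h1 ?_ (opNorm_nonneg _) hl)
    refine (opNorm_mul _ _).trans (mul_le_mul ?_ h3 (opNorm_nonneg _) (by positivity))
    exact (opNorm_mul _ _).trans (mul_le_mul hV hb (opNorm_nonneg _) (by positivity))
  have h5 : (lam * (((C * √(d (k + 1))) * D) * (C * √(d (k + 1))))) * lam = lam ^ 2 * C ^ 2 * D * d (k + 1) := by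
    have := Real.mul_self_sqrt (Nat.cast_nonneg (α := ℝ) (d (k + 1)))
    calc _ = lam ^ 2 * C ^ 2 * D * (√(d (k + 1)) * √(d (k + 1))) := by ring
      _ = _ := by rw [this]
  rw [h5] at h4
  rw [abs_of_nonneg (by positivity)]
  by_cases h0 : (d (k + 1) : ℝ) = 0
  · rw [h0]; simp; positivity
  · have hp : (0 : ℝ) < d (k + 1) := lt_of_le_of_ne (by positivity) (Ne.symm h0)
    calc _ ≤ (d (k + 1) : ℝ)⁻¹ * (lam ^ 2 * C ^ 2 * D * d (k + 1)) := by gcongr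
      _ = _ := by field_simp

lemma quad_eq {m : ℕ} (A : Matrix (Fin m) (Fin m) ℝ) (x y : Fin m → ℝ) :
    ∑ i, ∑ j, x i * A i j * y j = x ⬝ᵥ (A *ᵥ y) := by
  simp only [dotProduct, Matrix.mulVec, Finset.mul_sum, mul_assoc]

lemma bp_backprop (Lm l0 : ℕ) (hl : l0 ≤ Lm) (V : WS d) (u v : (k : ℕ) → Fin (d (k + 1)) → ℝ)
    (w : Fin (d (Lm + 1)) → ℝ) (s t : (k : ℕ) → Fin (d k) → ℝ)
    (hs : ∀ i, s (Lm + 1) i = u Lm i * w i * (√(d (Lm + 1)))⁻¹)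
    (ht : ∀ i, t (Lm + 1) i = v Lm i * w i * (√(d (Lm + 1)))⁻¹)
    (hs' : ∀ l, l < Lm → ∀ i, s (l + 1) i = u l i * (√(d (l + 1)))⁻¹ * ∑ j, V (l + 1) j i * s (l + 2) j)
    (ht' : ∀ l, l < Lm → ∀ i, t (l + 1) i = v l i * (√(d (l + 1)))⁻¹ * ∑ j, V (l + 1) j i * t (l + 2) j) :
    ∑ i, s (l0 + 1) i * t (l0 + 1) i = (d (Lm + 1) : ℝ)⁻¹ * ∑ i, ∑ j, w i * bp d V u v l0 Lm i j * w j := by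
  have key : ∀ k, l0 ≤ k → k ≤ Lm → ∀ x y : Fin (d (k + 1)) → ℝ, (∀ i, s (k + 1) i = u k i * x i) →
      (∀ i, t (k + 1) i = v k i * y i) →
      ∑ i, s (l0 + 1) i * t (l0 + 1) i = x ⬝ᵥ (bp d V u v l0 k *ᵥ y) := by
    intro k hk
    induction k, hk using Nat.le_induction with
    | base =>
      intro _ x y hx hy
      rw [bp_diag V u v l0 l0 le_rfl]
      simp only [dotProduct, Matrix.mulVec_diagonal]
      refine Finset.sum_congr rfl fun i _ => ?_
      rw [hx, hy]; ring
    | succ k hk ih =>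
      intro hkL x y hx hy
      have := ih (by omega) (fun i => (√(d (k + 1)))⁻¹ * ∑ j, V (k + 1) j i * s (k + 2) j)
        (fun i => (√(d (k + 1)))⁻¹ * ∑ j, V (k + 1) j i * t (k + 2) j)
        (fun i => by rw [hs' k (by omega) i]; ring) (fun i => by rw [ht' k (by omega) i]; ring)
      rw [this, bp_succ V u v l0 k hk]
      have e1 : (fun i => (√(d (k + 1)))⁻¹ * ∑ j, V (k + 1) j i * s (k + 2) j) =
          (√(d (k + 1)))⁻¹ • ((Matrix.of (V (k + 1)))ᵀ *ᵥ (Matrix.diagonal (u (k + 1)) *ᵥ x)) := by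
        funext i
        simp only [Pi.smul_apply, smul_eq_mul]
        congr 1
        simp only [Matrix.mulVec, dotProduct, Matrix.transpose_apply, Matrix.of_apply]
        refine Finset.sum_congr rfl fun j _ => ?_
        rw [hx]
        have := Matrix.mulVec_diagonal (u (k + 1)) x j
        rw [Matrix.mulVec, dotProduct] at this
        rw [this]
      have e2 : (fun i => (√(d (k + 1)))⁻¹ * ∑ j, V (k + 1) j i * t (k + 2) j) =
          (√(d (k + 1)))⁻¹ • ((Matrix.of (V (k + 1)))ᵀ *ᵥ (Matrix.diagonal (v (k + 1)) *ᵥ y)) := by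
        funext i
        simp only [Pi.smul_apply, smul_eq_mul]
        congr 1
        simp only [Matrix.mulVec, dotProduct, Matrix.transpose_apply, Matrix.of_apply]
        refine Finset.sum_congr rfl fun j _ => ?_
        rw [hy]
        have := Matrix.mulVec_diagonal (v (k + 1)) y j
        rw [Matrix.mulVec, dotProduct] at this
        rw [this]
      rw [e1, e2, Matrix.mulVec_smul, smul_dotProduct, dotProduct_smul, Matrix.smul_mulVec, dotProduct_smul]
      simp only [smul_eq_mul]
      rw [← mul_assoc, ← mul_inv, Real.mul_self_sqrt (by positivity)]
      congr 1
      rw [Matrix.mulVec_transpose, ← Matrix.dotProduct_mulVec]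
      simp only [Matrix.mulVec_mulVec]
      rw [← Matrix.vecMul_transpose, Matrix.diagonal_transpose, ← Matrix.dotProduct_mulVec]
      simp only [Matrix.mulVec_mulVec, Matrix.mul_assoc]
  rw [key Lm hl le_rfl (fun i => w i * (√(d (Lm + 1)))⁻¹) (fun i => w i * (√(d (Lm + 1)))⁻¹)
    (fun i => by rw [hs]; ring) (fun i => by rw [ht]; ring), ← quad_eq, Finset.mul_sum]
  refine Finset.sum_congr rfl fun i _ => ?_
  rw [Finset.mul_sum]
  refine Finset.sum_congr rfl fun j _ => ?_
  have : (d (Lm + 1) : ℝ)⁻¹ = (√(d (Lm + 1)))⁻¹ * (√(d (Lm + 1)))⁻¹ := by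
    rw [← mul_inv, Real.mul_self_sqrt (by positivity)]
  rw [this]; ring

end net

lemma sum_exp (j : ℕ) {c : ℝ} (hc : 0 < c) (K : ℝ) : Summable fun n : ℕ => K * ((n : ℝ) ^ j * Real.exp (-(c * n))) := by
  have := Real.summable_pow_mul_exp_neg_nat_mul j hc
  simp only [neg_mul] at this
  exact this.mul_left K

lemma three_pow (n : ℕ) (x : ℝ) (hx : 0 ≤ x) : (3 : ENNReal) ^ n * ENNReal.ofReal x ≤ ENNReal.ofReal (Real.exp (2 * n) * x) := by
  rw [ENNReal.ofReal_mul (by positivity)]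
  gcongr
  have h3 : (3 : ENNReal) ^ n = ENNReal.ofReal ((3 : ℝ) ^ n) := by
    rw [ENNReal.ofReal_pow (by norm_num)]; norm_num
  rw [h3]
  refine ENNReal.ofReal_le_ofReal ?_
  have : Real.exp (2 * n) = Real.exp 2 ^ n := by rw [← Real.exp_nat_mul]; ring_nf
  rw [this]
  gcongr
  have := Real.add_one_le_exp (2 : ℝ)
  linarith

lemma meas_le {α : Type*} [TopologicalSpace α] [MeasurableSpace α] [OpensMeasurableSpace α] {f g : α → ℝ} (hf : Continuous f) (hg : Continuous g) :
    Measurable fun x => f x ≤ g x := measurableSet_setOfPred.1 (isClosed_le hf hg).measurableSet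

lemma meas_lt {α : Type*} [TopologicalSpace α] [MeasurableSpace α] [OpensMeasurableSpace α] {f g : α → ℝ} (hf : Continuous f) (hg : Continuous g) :
    Measurable fun x => f x < g x := measurableSet_setOfPred.1 (isOpen_lt hf hg).measurableSet

lemma meas_nearO {α : Type*} [TopologicalSpace α] [MeasurableSpace α] [OpensMeasurableSpace α] {p n : ℕ} {f : α → Matrix (Fin p) (Fin n) ℝ}
    (hf : Continuous f) (δ : ℝ) : Measurable fun x => NearO δ (f x) := by
  have h : ∀ i a, Continuous fun x => f x i a := fun i a => (continuous_apply a).comp ((continuous_apply i).comp hf)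
  unfold NearO
  refine Measurable.and (Measurable.forall fun a => meas_le (by fun_prop) continuous_const)
    (Measurable.forall fun a => Measurable.forall fun b => Measurable.imp measurable_const (meas_le (by fun_prop) continuous_const))

def FourB {p n : ℕ} (B : ℝ) (X : Matrix (Fin p) (Fin n) ℝ) : Prop :=
  opNorm X ≤ B ∧ ∑ a, ((∑ i, X i a ^ 2) - 1) ^ 2 ≤ B ^ 2

lemma meas_fourB {α : Type*} [TopologicalSpace α] [MeasurableSpace α] [OpensMeasurableSpace α] {p n : ℕ} {f : α → Matrix (Fin p) (Fin n) ℝ}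
    (hf : Continuous f) (B : ℝ) : Measurable fun x => FourB B (f x) := by
  have h : ∀ i a, Continuous fun x => f x i a := fun i a => (continuous_apply a).comp ((continuous_apply i).comp hf)
  exact Measurable.and (meas_le (continuous_opNorm.comp hf) continuous_const) (meas_le (by fun_prop) continuous_const)

structure Hyp (Lm : ℕ) (d : ℕ → ℕ → ℕ) (σ σ' σ'' : ℝ → ℝ) (lam : ℝ) {Ω : Type*} [MeasurableSpace Ω] (Pr : Measure Ω)
    (W : (n : ℕ) → (ℓ : ℕ) → Ω → Fin (d n (ℓ + 1)) → Fin (d n ℓ) → ℝ)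
    (wOut : (n : ℕ) → Ω → Fin (d n (Lm + 1)) → ℝ)
    (X0 : (n : ℕ) → Matrix (Fin (d n 0)) (Fin n) ℝ) : Prop where
  d1 : ∀ x, HasDerivAt σ (σ' x) x
  d2 : ∀ x, HasDerivAt σ' (σ'' x) x
  b1 : ∀ x, |σ' x| ≤ lam
  b2 : ∀ x, |σ'' x| ≤ lam
  mean : (∫ x, σ x ∂(gaussianReal 0 1)) = 0
  var : (∫ x, (σ x) ^ 2 ∂(gaussianReal 0 1)) = 1
  law : LawW Lm d Pr W wOut
  dims : ∀ k, k ≤ Lm → ∃ c C : ℝ, 0 < c ∧ 0 < C ∧ ∀ᶠ n : ℕ in atTop, c * n ≤ d n (k + 1) ∧ (d n (k + 1) : ℝ) ≤ C * n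
  near0 : ∀ δ : ℝ, 0 < δ → ∀ᶠ n in atTop, NearO δ (X0 n)
  four0 : ∃ B : ℝ, 0 ≤ B ∧ ∀ᶠ n in atTop, FourB B (X0 n)

section layers
variable {Lm : ℕ} {d : ℕ → ℕ → ℕ} {σ σ' σ'' : ℝ → ℝ} {lam : ℝ} {Ω : Type*} [MeasurableSpace Ω] {Pr : Measure Ω} [IsProbabilityMeasure Pr]
  {W : (n : ℕ) → (ℓ : ℕ) → Ω → Fin (d n (ℓ + 1)) → Fin (d n ℓ) → ℝ}
  {wOut : (n : ℕ) → Ω → Fin (d n (Lm + 1)) → ℝ}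
  {X0 : (n : ℕ) → Matrix (Fin (d n 0)) (Fin n) ℝ}

lemma preact_update {n : ℕ} (dn : ℕ → ℕ) (X : Matrix (Fin (dn 0)) (Fin n) ℝ) (V : WS dn) (k : ℕ) (Y : Fin (dn (k + 1)) → Fin (dn k) → ℝ) :
    preact σ dn n (Function.update V k Y) X k = Matrix.of Y * netLayer σ dn n V X k := by
  unfold preact
  rw [Function.update_self, netLayer_congr _ V k fun m hm => Function.update_of_ne (by omega) _ _]

lemma netLayer_update {n : ℕ} (dn : ℕ → ℕ) (X : Matrix (Fin (dn 0)) (Fin n) ℝ) (V : WS dn) (k : ℕ) (Y : Fin (dn (k + 1)) → Fin (dn k) → ℝ) :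
    netLayer σ dn n (Function.update V k Y) X k = netLayer σ dn n V X k :=
  netLayer_congr _ V k fun m hm => Function.update_of_ne (by omega) _ _

lemma corr_ae (H : Hyp Lm d σ σ' σ'' lam Pr W wOut X0) (k : ℕ) (hk : k ≤ Lm)
    (hnear : ∀ δ : ℝ, 0 < δ → ∀ᵐ ω ∂Pr, ∀ᶠ n in atTop, NearO δ (netLayer σ (d n) n (fun m => W n m ω) (X0 n) k))
    {φ φ' : ℝ → ℝ} (hφ : ∀ x, HasDerivAt φ (φ' x) x) (hφb : ∀ x, |φ' x| ≤ lam) (δ : ℝ) (hδ : 0 < δ) :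
    ∀ᵐ ω ∂Pr, ∀ᶠ n in atTop, ∀ a b : Fin n, |(∑ i, φ (preact σ (d n) n (fun m => W n m ω) (X0 n) k i a) * φ (preact σ (d n) n (fun m => W n m ω) (X0 n) k i b)) -
      d n (k + 1) * kap φ a b| ≤ δ * d n (k + 1) := by
  obtain ⟨δ', c', hδ', hc', htail⟩ := corr_tail hφ hφb δ hδ
  obtain ⟨c, C, hc, hC, hdim⟩ := H.dims k hk
  have hσ := act_cont H.d1
  have hφc := act_cont hφ
  have key := step_W H.law k hk (fun n V => NearO δ' (netLayer σ (d n) n V (X0 n) k))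
    (fun n V => ∃ a b : Fin n, δ * d n (k + 1) < |(∑ i, φ (preact σ (d n) n V (X0 n) k i a) * φ (preact σ (d n) n V (X0 n) k i b)) - d n (k + 1) * kap φ a b|)
    (fun n V y h => by rw [netLayer_update]; exact h)
    (fun n V V' hV h => by rw [← netLayer_congr V V' k fun m hm => hV m (by omega)]; exact h)
    (fun n V V' hV h => by rw [← preact_congr V V' k fun m hm => hV m (by omega)]; exact h)
    (fun n => measurableSet_setOfPred.2 (Measurable.and (meas_nearO (netLayer_cont hσ k) δ')
      (Measurable.exists fun a => Measurable.exists fun b => meas_lt continuous_const (by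
        have := fun i a => preact_cont (σ := σ) (d := d n) (X0 := X0 n) hσ k i a
        fun_prop))))
    (fun n => 2 * ((n : ℝ) ^ 2 * Real.exp (-((c' * c) * n)))) (sum_exp 2 (by positivity) 2) ?_ (hnear δ' hδ')
  · filter_upwards [key] with ω h
    filter_upwards [h] with n hn a b
    push Not at hn
    exact hn a b
  · filter_upwards [hdim] with n hn V hV
    have h1 := htail (d n k) n (d n (k + 1)) _ hV
    simp only [preact_update, Matrix.mul_apply, Matrix.of_apply]
    refine h1.trans (ENNReal.ofReal_le_ofReal ?_)
    have : Real.exp (-(c' * d n (k + 1))) ≤ Real.exp (-((c' * c) * n)) := by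
      refine Real.exp_le_exp.2 ?_
      have := mul_le_mul_of_nonneg_left hn.1 hc'.le
      linarith
    have h2 := mul_le_mul_of_nonneg_left this (show (0 : ℝ) ≤ 2 * (n : ℝ) ^ 2 by positivity)
    linarith

lemma opnorm_ae (H : Hyp Lm d σ σ' σ'' lam Pr W wOut X0) (k : ℕ) (hk : k ≤ Lm) (B : ℝ)
    (hfour : ∀ᵐ ω ∂Pr, ∀ᶠ n in atTop, FourB B (netLayer σ (d n) n (fun m => W n m ω) (X0 n) k)) :
    ∃ T : ℝ, 0 ≤ T ∧ ∀ᵐ ω ∂Pr, ∀ᶠ n in atTop, opNorm ((preact σ (d n) n (fun m => W n m ω) (X0 n) k).map σ) ≤ T * √(d n (k + 1)) := by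
  obtain ⟨c, C, hc, hC, hdim⟩ := H.dims k hk
  have hσ := act_cont H.d1
  have hσ' := act_cont H.d2
  set s : ℝ := 1 / (32 * (B ^ 2 * lam ^ 2 + 1)) with hs
  have hs0 : 0 < s := by positivity
  set T : ℝ := √((2 + 3 / c) / s) with hT
  have hT2 : s * T ^ 2 = 2 + 3 / c := by
    rw [hT, Real.sq_sqrt (by positivity)]; field_simp
  have key := step_W H.law k hk (fun n V => FourB B (netLayer σ (d n) n V (X0 n) k))
    (fun n V => 3 * (T * √(d n (k + 1))) < opNorm ((preact σ (d n) n V (X0 n) k).map σ))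
    (fun n V y h => by rw [netLayer_update]; exact h)
    (fun n V V' hV h => by rw [← netLayer_congr V V' k fun m hm => hV m (by omega)]; exact h)
    (fun n V V' hV h => by rw [← preact_congr V V' k fun m hm => hV m (by omega)]; exact h)
    (fun n => measurableSet_setOfPred.2 (Measurable.and (meas_fourB (netLayer_cont hσ k) B)
      (meas_lt continuous_const (continuous_opNorm.comp (by
        refine continuous_pi fun i => continuous_pi fun a => ?_
        exact hσ.comp (preact_cont (σ := σ) (d := d n) (X0 := X0 n) hσ k i a))))))
    (fun n => 1 * ((n : ℝ) ^ 0 * Real.exp (-(1 * n)))) (sum_exp 0 one_pos 1) ?_ hfour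
  · refine ⟨3 * T, by positivity, ?_⟩
    filter_upwards [key] with ω h
    filter_upwards [h] with n hn
    push Not at hn
    linarith
  · filter_upwards [hdim] with n hn V hV
    have h1 := act_layer_opnorm (d n (k + 1)) H.d1 H.b1 hσ' H.mean B _ hV.1 hV.2 T (Real.sqrt_nonneg _)
    simp only [preact_update]
    refine h1.trans ((three_pow _ _ (Real.exp_pos _).le).trans (ENNReal.ofReal_le_ofReal ?_))
    rw [← Real.exp_add, pow_zero, one_mul, one_mul]
    refine Real.exp_le_exp.2 ?_
    rw [← hs, hT2]
    have : 3 / c * (c * n) ≤ 3 / c * d n (k + 1) := mul_le_mul_of_nonneg_left hn.1 (by positivity)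
    have e : 3 / c * (c * n) = 3 * n := by field_simp
    rw [e] at this
    linarith

lemma fourth_ae (H : Hyp Lm d σ σ' σ'' lam Pr W wOut X0) (k : ℕ) (hk : k ≤ Lm) (B : ℝ)
    (hnear : ∀ δ : ℝ, 0 < δ → ∀ᵐ ω ∂Pr, ∀ᶠ n in atTop, NearO δ (netLayer σ (d n) n (fun m => W n m ω) (X0 n) k))
    (hfour : ∀ᵐ ω ∂Pr, ∀ᶠ n in atTop, FourB B (netLayer σ (d n) n (fun m => W n m ω) (X0 n) k)) :
    ∃ T : ℝ, 0 ≤ T ∧ ∀ᵐ ω ∂Pr, ∀ᶠ n in atTop,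
      ∑ a, (∑ i, (σ (preact σ (d n) n (fun m => W n m ω) (X0 n) k i a) ^ 2 - ∫ t, σ (√(∑ p, netLayer σ (d n) n (fun m => W n m ω) (X0 n) k p a ^ 2) * t) ^ 2 ∂(gaussianReal 0 1))) ^ 2
        ≤ (T * d n (k + 1)) ^ 2 := by
  obtain ⟨c, C, hc, hC, hdim⟩ := H.dims k hk
  have hσ := act_cont H.d1
  have hσ' := act_cont H.d2
  set M : ℝ := 8 * B ^ 2 * lam ^ 2 * (2 * σ 0 ^ 2 + 16 * lam ^ 2) with hM
  have hM0 : 0 ≤ M := by positivity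
  set s : ℝ := 1 / (2 * (M + 1)) with hs
  have hs0 : 0 < s := by positivity
  have hs1 : 8 * s ^ 2 * B ^ 2 * lam ^ 2 * (2 * σ 0 ^ 2 + 16 * lam ^ 2) ≤ 1 / 2 := by
    have e : 8 * s ^ 2 * B ^ 2 * lam ^ 2 * (2 * σ 0 ^ 2 + 16 * lam ^ 2) = s ^ 2 * M := by rw [hM]; ring
    rw [e, hs]
    rw [div_pow, one_pow, div_mul_eq_mul_div, one_mul, div_le_iff₀ (by positivity)]
    nlinarith
  set T : ℝ := (1 + 3 / c) / s with hT
  have hT2 : s * T = 1 + 3 / c := by rw [hT]; field_simp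
  have hT0 : 0 ≤ T := by positivity
  have key := step_W H.law k hk (fun n V => NearO 1 (netLayer σ (d n) n V (X0 n) k) ∧ FourB B (netLayer σ (d n) n V (X0 n) k))
    (fun n V => (3 * (T * d n (k + 1))) ^ 2 < ∑ a, (∑ i, (σ (preact σ (d n) n V (X0 n) k i a) ^ 2 - ∫ t, σ (√(∑ p, netLayer σ (d n) n V (X0 n) k p a ^ 2) * t) ^ 2 ∂(gaussianReal 0 1))) ^ 2)
    (fun n V y h => by rw [netLayer_update]; exact h)
    (fun n V V' hV h => by rw [← netLayer_congr V V' k fun m hm => hV m (by omega)]; exact h)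
    (fun n V V' hV h => by rw [← preact_congr V V' k fun m hm => hV m (by omega), ← netLayer_congr V V' k fun m hm => hV m (by omega)]; exact h)
    (fun n => measurableSet_setOfPred.2 (Measurable.and ((meas_nearO (netLayer_cont hσ k) 1).and (meas_fourB (netLayer_cont hσ k) B))
      (measurableSet_setOfPred.1 (measurableSet_lt measurable_const (by
        have h1 := fun i a => (preact_cont (σ := σ) (d := d n) (X0 := X0 n) hσ k i a).measurable
        have h2 : ∀ p a, Continuous fun V : WS (d n) => netLayer σ (d n) n V (X0 n) k p a := fun p a =>
          (continuous_apply a).comp ((continuous_apply p).comp (netLayer_cont hσ k))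
        have h3 : StronglyMeasurable fun r : ℝ => ∫ t, σ (r * t) ^ 2 ∂(gaussianReal 0 1) := by
          refine StronglyMeasurable.integral_prod_right (f := fun r t => σ (r * t) ^ 2) ?_
          exact Continuous.stronglyMeasurable (by fun_prop)
        have h4 := h3.measurable
        have h5 : ∀ a, Measurable fun V : WS (d n) => ∫ t, σ (√(∑ p, netLayer σ (d n) n V (X0 n) k p a ^ 2) * t) ^ 2 ∂(gaussianReal 0 1) := fun a =>
          h4.comp (Continuous.measurable (by fun_prop))
        have h6 := hσ.measurable
        refine Finset.measurable_sum _ fun a _ => Measurable.pow_const (Finset.measurable_sum _ fun i _ => Measurable.sub (Measurable.pow_const (h6.comp (h1 i a)) 2) (h5 a)) 2)))))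
    (fun n => 2 * ((n : ℝ) ^ 0 * Real.exp (-(1 * n)))) (sum_exp 0 one_pos 2) ?_ ?_
  · refine ⟨3 * T, by positivity, ?_⟩
    filter_upwards [key] with ω h
    filter_upwards [h] with n hn
    push Not at hn
    rw [mul_assoc]
    exact hn
  · filter_upwards [hdim] with n hn V hV
    have h1 := act_fourth (d n (k + 1)) H.d1 H.b1 hσ' B _ hV.2.1 (fun a => by have := (abs_le.1 (hV.1.1 a)).2; linarith) s hs0.le hs1 T hT0
    simp only [preact_update, netLayer_update, Matrix.mul_apply, Matrix.of_apply]
    refine h1.trans ((three_pow _ _ (by positivity)).trans (ENNReal.ofReal_le_ofReal ?_))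
    rw [pow_zero, one_mul, one_mul, mul_left_comm, ← Real.exp_add]
    refine mul_le_mul_of_nonneg_left (Real.exp_le_exp.2 ?_) (by norm_num)
    rw [hT2]
    have : 3 / c * (c * n) ≤ 3 / c * d n (k + 1) := mul_le_mul_of_nonneg_left hn.1 (by positivity)
    have e : 3 / c * (c * n) = 3 * n := by field_simp
    rw [e] at this
    linarith
  · filter_upwards [hnear 1 one_pos, hfour] with ω h1 h2
    exact h1.and h2

end layers

lemma scaled_sum {D n : ℕ} (P : Matrix (Fin D) (Fin n) ℝ) (σ : ℝ → ℝ) (a b : Fin n) :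
    ∑ i, ((√D)⁻¹ • P.map σ) i a * ((√D)⁻¹ • P.map σ) i b = (D : ℝ)⁻¹ * ∑ i, σ (P i a) * σ (P i b) := by
  have : (D : ℝ)⁻¹ = (√D)⁻¹ * (√D)⁻¹ := by
    rw [← mul_inv, Real.mul_self_sqrt (by positivity)]
  rw [this, Finset.mul_sum]
  refine Finset.sum_congr rfl fun i _ => ?_
  simp only [Matrix.smul_apply, Matrix.map_apply, smul_eq_mul]
  ring

section layers
variable {Lm : ℕ} {d : ℕ → ℕ → ℕ} {σ σ' σ'' : ℝ → ℝ} {lam : ℝ} {Ω : Type*} [MeasurableSpace Ω] {Pr : Measure Ω} [IsProbabilityMeasure Pr]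
  {W : (n : ℕ) → (ℓ : ℕ) → Ω → Fin (d n (ℓ + 1)) → Fin (d n ℓ) → ℝ}
  {wOut : (n : ℕ) → Ω → Fin (d n (Lm + 1)) → ℝ}
  {X0 : (n : ℕ) → Matrix (Fin (d n 0)) (Fin n) ℝ}

lemma dpos (H : Hyp Lm d σ σ' σ'' lam Pr W wOut X0) (k : ℕ) (hk : k ≤ Lm) : ∀ᶠ n : ℕ in atTop, (0 : ℝ) < d n (k + 1) := by
  obtain ⟨c, C, hc, hC, hdim⟩ := H.dims k hk
  filter_upwards [hdim, eventually_gt_atTop 0] with n hn h0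
  have : (0 : ℝ) < n := by exact_mod_cast h0
  exact lt_of_lt_of_le (by positivity) hn.1

lemma layer_all (H : Hyp Lm d σ σ' σ'' lam Pr W wOut X0) (k : ℕ) (hk : k ≤ Lm + 1) :
    (∀ δ : ℝ, 0 < δ → ∀ᵐ ω ∂Pr, ∀ᶠ n in atTop, NearO δ (netLayer σ (d n) n (fun m => W n m ω) (X0 n) k)) ∧
    ∃ B : ℝ, 0 ≤ B ∧ ∀ᵐ ω ∂Pr, ∀ᶠ n in atTop, FourB B (netLayer σ (d n) n (fun m => W n m ω) (X0 n) k) := by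
  induction k with
  | zero =>
    obtain ⟨B, hB, h⟩ := H.four0
    exact ⟨fun δ hδ => Eventually.of_forall fun ω => H.near0 δ hδ, B, hB, Eventually.of_forall fun ω => h⟩
  | succ k ih =>
    obtain ⟨hnear, B, hB, hfour⟩ := ih (by omega)
    have hkL : k ≤ Lm := by omega
    have hnet : ∀ n ω, netLayer σ (d n) n (fun m => W n m ω) (X0 n) (k + 1) =
      (√(d n (k + 1)))⁻¹ • (preact σ (d n) n (fun m => W n m ω) (X0 n) k).map σ := fun n ω => rfl
    have hsq : ∀ {D n : ℕ} (P : Matrix (Fin D) (Fin n) ℝ) (a : Fin n), ∑ i, ((√D)⁻¹ • P.map σ) i a ^ 2 = (D : ℝ)⁻¹ * ∑ i, σ (P i a) ^ 2 := by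
      intro D n P a
      have := scaled_sum P σ a a
      simpa only [← sq] using this
    refine ⟨fun δ hδ => ?_, ?_⟩
    · have hc := corr_ae H k hkL hnear H.d1 H.b1 δ hδ
      filter_upwards [hc] with ω h
      filter_upwards [h, dpos H k hkL] with n hn hd
      rw [hnet]
      set P := preact σ (d n) n (fun m => W n m ω) (X0 n) k
      have gen : ∀ (S x : ℝ), |S - d n (k + 1) * x| ≤ δ * d n (k + 1) → |(d n (k + 1) : ℝ)⁻¹ * S - x| ≤ δ := by
        intro S x hS
        have e : (d n (k + 1) : ℝ)⁻¹ * S - x = (d n (k + 1) : ℝ)⁻¹ * (S - d n (k + 1) * x) := by field_simp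
        rw [e, abs_mul, abs_of_pos (inv_pos.2 hd), inv_mul_le_iff₀ hd]
        linarith
      refine ⟨fun a => ?_, fun a b hab => ?_⟩
      · rw [hsq]
        have := hn a a
        simp only [kap, if_true, H.var, ← sq] at this
        exact gen _ _ this
      · rw [scaled_sum]
        have := gen _ _ (hn a b)
        simpa only [kap, if_neg hab, H.mean, ne_eq, OfNat.ofNat_ne_zero, not_false_iff, zero_pow, sub_zero] using this
    · obtain ⟨T1, hT1, h1⟩ := opnorm_ae H k hkL B hfour
      obtain ⟨T2, hT2, h2⟩ := fourth_ae H k hkL B hnear hfour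
      set Q : ℝ := lam * (2 * |σ 0| + 3 * lam) with hQ
      refine ⟨T1 + √(2 * T2 ^ 2 + 2 * Q ^ 2 * B ^ 2), by positivity, ?_⟩
      filter_upwards [h1, h2, hnear 1 one_pos, hfour] with ω h1 h2 h3 h4
      filter_upwards [h1, h2, h3, h4, dpos H k hkL] with n h1 h2 h3 h4 hd
      have hsd : 0 < √(d n (k + 1)) := Real.sqrt_pos.2 hd
      rw [hnet]
      set X := netLayer σ (d n) n (fun m => W n m ω) (X0 n) k
      set P := preact σ (d n) n (fun m => W n m ω) (X0 n) k
      refine ⟨?_, ?_⟩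
      · rw [opNorm_smul, abs_of_pos (inv_pos.2 hsd)]
        refine le_trans ?_ (le_add_of_nonneg_right (Real.sqrt_nonneg _))
        rw [inv_mul_le_iff₀ hsd]
        linarith
      · have hfin : ∑ a, ((∑ i, ((√(d n (k + 1)))⁻¹ • P.map σ) i a ^ 2) - 1) ^ 2 ≤ 2 * T2 ^ 2 + 2 * Q ^ 2 * B ^ 2 := by
          have hpt : ∀ a, ((∑ i, ((√(d n (k + 1)))⁻¹ • P.map σ) i a ^ 2) - 1) ^ 2 ≤
              2 * ((d n (k + 1) : ℝ)⁻¹ ^ 2 * (∑ i, (σ (P i a) ^ 2 - ∫ t, σ (√(∑ p, X p a ^ 2) * t) ^ 2 ∂(gaussianReal 0 1))) ^ 2)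
                + 2 * (Q ^ 2 * ((∑ p, X p a ^ 2) - 1) ^ 2) := by
            intro a
            rw [hsq]
            set s := ∑ p, X p a ^ 2 with hs
            set m := ∫ t, σ (√s * t) ^ 2 ∂(gaussianReal 0 1) with hm
            have hs2 := (abs_le.1 (h3.1 a)).2
            have hsc := act_scale_sq H.d1 H.b1 s (Finset.sum_nonneg fun i _ => sq_nonneg _) (by linarith)
            rw [H.var, ← hm, ← hQ] at hsc
            have hsc2 : (m - 1) ^ 2 ≤ Q ^ 2 * (s - 1) ^ 2 := by
              rw [← sq_abs (m - 1), ← sq_abs (s - 1), ← mul_pow]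
              exact pow_le_pow_left₀ (abs_nonneg _) hsc 2
            have e : (d n (k + 1) : ℝ)⁻¹ * ∑ i, σ (P i a) ^ 2 - 1 = (d n (k + 1) : ℝ)⁻¹ * (∑ i, (σ (P i a) ^ 2 - m)) + (m - 1) := by
              rw [Finset.sum_sub_distrib]
              simp only [Finset.sum_const, Finset.card_univ, Fintype.card_fin, nsmul_eq_mul]
              field_simp
              ring
            rw [e]
            set u := (d n (k + 1) : ℝ)⁻¹ * (∑ i, (σ (P i a) ^ 2 - m)) with hu
            have : (d n (k + 1) : ℝ)⁻¹ ^ 2 * (∑ i, (σ (P i a) ^ 2 - m)) ^ 2 = u ^ 2 := by rw [hu]; ring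
            rw [this]
            nlinarith [sq_nonneg (u - (m - 1))]
          refine (Finset.sum_le_sum fun a _ => hpt a).trans ?_
          rw [Finset.sum_add_distrib]
          simp only [← Finset.mul_sum]
          have g1 : (d n (k + 1) : ℝ)⁻¹ ^ 2 * ∑ a, (∑ i, (σ (P i a) ^ 2 - ∫ t, σ (√(∑ p, X p a ^ 2) * t) ^ 2 ∂(gaussianReal 0 1))) ^ 2 ≤ T2 ^ 2 := by
            refine (mul_le_mul_of_nonneg_left h2 (by positivity)).trans (le_of_eq ?_)
            field_simp
          have g2 : Q ^ 2 * ∑ a, ((∑ p, X p a ^ 2) - 1) ^ 2 ≤ Q ^ 2 * B ^ 2 := mul_le_mul_of_nonneg_left h4.2 (sq_nonneg _)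
          linarith
        refine hfin.trans ?_
        set R := 2 * T2 ^ 2 + 2 * Q ^ 2 * B ^ 2
        have hR : 0 ≤ R := by positivity
        have := Real.sq_sqrt hR
        nlinarith [Real.sqrt_nonneg R, mul_nonneg hT1 (Real.sqrt_nonneg R), sq_nonneg T1]

end layers

noncomputable def nbp (σ σ' : ℝ → ℝ) (d : ℕ → ℕ) (n : ℕ) (V : WS d) (X0 : Matrix (Fin (d 0)) (Fin n) ℝ) (l0 : ℕ) (a b : Fin n) (k : ℕ) :
    Matrix (Fin (d (k + 1))) (Fin (d (k + 1))) ℝ :=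
  bp d V (fun k i => σ' (preact σ d n V X0 k i a)) (fun k i => σ' (preact σ d n V X0 k i b)) l0 k

lemma nbp_congr {σ σ' : ℝ → ℝ} {d : ℕ → ℕ} {n : ℕ} {X0 : Matrix (Fin (d 0)) (Fin n) ℝ} (V V' : WS d) (l0 : ℕ) (a b : Fin n) (k : ℕ)
    (h : ∀ m, m ≤ k → V m = V' m) : nbp σ σ' d n V X0 l0 a b k = nbp σ σ' d n V' X0 l0 a b k :=
  bp_congr _ _ _ _ _ _ _ _ h (fun m hm => by rw [preact_congr V V' m fun j hj => h j (by omega)])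
    (fun m hm => by rw [preact_congr V V' m fun j hj => h j (by omega)])

lemma nbp_cont {σ σ' : ℝ → ℝ} {d : ℕ → ℕ} {n : ℕ} {X0 : Matrix (Fin (d 0)) (Fin n) ℝ} (hσ : Continuous σ) (hσ' : Continuous σ')
    (l0 : ℕ) (a b : Fin n) (k : ℕ) : Continuous fun V : WS d => nbp σ σ' d n V X0 l0 a b k :=
  bp_cont (fun V k i => σ' (preact σ d n V X0 k i a)) (fun V k i => σ' (preact σ d n V X0 k i b))
    (continuous_pi fun k => continuous_pi fun i => hσ'.comp (preact_cont hσ k i a))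
    (continuous_pi fun k => continuous_pi fun i => hσ'.comp (preact_cont hσ k i b)) l0 k

lemma row_le {a b : ℕ} (s : Set (Fin b → ℝ)) (i : Fin a) : gaussianMat a b {Y | Y i ∈ s} ≤ gaussianVec b s := by
  have h := measurePreserving_eval (fun _ : Fin a => gaussianVec b) i
  have := Measure.le_map_apply (μ := Measure.pi fun _ : Fin a => gaussianVec b) h.measurable.aemeasurable s
  rw [h.map_eq] at this
  exact this

section bps
variable {Lm : ℕ} {d : ℕ → ℕ → ℕ} {σ σ' σ'' : ℝ → ℝ} {lam : ℝ} {Ω : Type*} [MeasurableSpace Ω] {Pr : Measure Ω} [IsProbabilityMeasure Pr]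
  {W : (n : ℕ) → (ℓ : ℕ) → Ω → Fin (d n (ℓ + 1)) → Fin (d n ℓ) → ℝ}
  {wOut : (n : ℕ) → Ω → Fin (d n (Lm + 1)) → ℝ}
  {X0 : (n : ℕ) → Matrix (Fin (d n 0)) (Fin n) ℝ}

lemma weight_ae (H : Hyp Lm d σ σ' σ'' lam Pr W wOut X0) (k : ℕ) (hk : k + 1 ≤ Lm) :
    ∃ T : ℝ, 0 ≤ T ∧ ∀ᵐ ω ∂Pr, ∀ᶠ n in atTop, opNorm (Matrix.of (W n (k + 1) ω)) ≤ T * √(d n (k + 1)) := by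
  obtain ⟨c, C, hc, hC, hdim⟩ := H.dims (k + 1) hk
  obtain ⟨c2, C2, hc2, hC2, hdim2⟩ := H.dims k (by omega)
  set T : ℝ := √(4 * (1 / 2 + (2 * C2 + 1) / c)) with hT
  have hT2 : 1 / 4 * T ^ 2 = 1 / 2 + (2 * C2 + 1) / c := by
    rw [hT, Real.sq_sqrt (by positivity)]; ring
  have key := step_W H.law (k + 1) hk (fun n V => True)
    (fun n V => 3 * (T * √(d n (k + 2))) < opNorm (Matrix.of (V (k + 1))))
    (fun n V y h => trivial) (fun n V V' hV h => trivial) (fun n V V' hV h => by rw [← hV (k + 1) hk]; exact h)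
    (fun n => measurableSet_setOfPred.2 (Measurable.and measurable_const
      (meas_lt continuous_const (continuous_opNorm.comp (continuous_apply (k + 1))))))
    (fun n => 1 * ((n : ℝ) ^ 0 * Real.exp (-(1 * n)))) (sum_exp 0 one_pos 1) ?_ (Eventually.of_forall fun ω => Eventually.of_forall fun n => trivial)
  · refine ⟨3 * T * √(C / c2), by positivity, ?_⟩
    filter_upwards [key] with ω h
    filter_upwards [h, hdim, hdim2] with n hn h1 h2
    push Not at hn
    have e : √(d n (k + 2) : ℝ) ≤ √(C / c2) * √(d n (k + 1)) := by
      rw [← Real.sqrt_mul (by positivity)]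
      refine Real.sqrt_le_sqrt ?_
      have e1 : C * n = C / c2 * (c2 * n) := by field_simp
      have e2 := mul_le_mul_of_nonneg_left h2.1 (show 0 ≤ C / c2 by positivity)
      have e3 := h1.2
      have e4 : d n (k + 2) = d n (k + 1 + 1) := rfl
      rw [e4]
      linarith
    have := mul_le_mul_of_nonneg_left e (show 0 ≤ 3 * T by positivity)
    linarith
  · filter_upwards [hdim, hdim2] with n hn hn2 V hV
    have h1 := gmat_opnorm (d n (k + 2)) (d n (k + 1)) T (Real.sqrt_nonneg _)
    simp only [Function.update_self]
    refine h1.trans ((three_pow _ _ (Real.exp_pos _).le).trans (ENNReal.ofReal_le_ofReal ?_))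
    rw [← Real.exp_add, pow_zero, one_mul, one_mul]
    refine Real.exp_le_exp.2 ?_
    rw [hT2]
    have : (2 * C2 + 1) / c * (c * n) ≤ (2 * C2 + 1) / c * d n (k + 1 + 1) := mul_le_mul_of_nonneg_left hn.1 (by positivity)
    have e : (2 * C2 + 1) / c * (c * n) = (2 * C2 + 1) * n := by field_simp
    rw [e] at this
    have e2 : d n (k + 2) = d n (k + 1 + 1) := rfl
    rw [e2]
    linarith [hn2.2]

lemma bpnorm_ae (H : Hyp Lm d σ σ' σ'' lam Pr W wOut X0) (l0 k : ℕ) (hk : k ≤ Lm) :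
    ∃ D : ℝ, 0 ≤ D ∧ ∀ᵐ ω ∂Pr, ∀ᶠ n in atTop, ∀ a b : Fin n, opNorm (nbp σ σ' (d n) n (fun m => W n m ω) (X0 n) l0 a b k) ≤ D := by
  have hdiag : ∀ k, k ≤ l0 → ∀ n ω (a b : Fin n), opNorm (nbp σ σ' (d n) n (fun m => W n m ω) (X0 n) l0 a b k) ≤ lam ^ 2 := by
    intro k hk n ω a b
    unfold nbp
    rw [bp_diag _ _ _ _ _ hk]
    exact bp_opNorm_diag (fun k i => σ' (preact σ (d n) n (fun m => W n m ω) (X0 n) k i a)) (fun k i => σ' (preact σ (d n) n (fun m => W n m ω) (X0 n) k i b)) k lam (fun i => H.b1 _) (fun i => H.b1 _)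
  induction k with
  | zero => exact ⟨lam ^ 2, sq_nonneg _, Eventually.of_forall fun ω => Eventually.of_forall fun n a b => hdiag 0 (Nat.zero_le _) n ω a b⟩
  | succ k ih =>
    by_cases h : k + 1 ≤ l0
    · exact ⟨lam ^ 2, sq_nonneg _, Eventually.of_forall fun ω => Eventually.of_forall fun n a b => hdiag (k + 1) h n ω a b⟩
    · obtain ⟨D, hD, hd⟩ := ih (by omega)
      obtain ⟨T, hT, hw⟩ := weight_ae H k hk
      refine ⟨lam ^ 2 * T ^ 2 * D, by positivity, ?_⟩
      filter_upwards [hd, hw] with ω h1 h2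
      filter_upwards [h1, h2] with n h1 h2 a b
      exact bp_opNorm_succ _ _ _ l0 k (by omega) lam T D (act_lam H.b1) (fun i => H.b1 _) (fun i => H.b1 _) hT h2 (h1 a b)

lemma quad_ae (H : Hyp Lm d σ σ' σ'' lam Pr W wOut X0) (l0 k : ℕ) (hk : k + 1 ≤ Lm) (δ : ℝ) (hδ : 0 < δ) :
    ∀ᵐ ω ∂Pr, ∀ᶠ n in atTop, ∀ (a b : Fin n) (i : Fin (d n (k + 2))),
      |(∑ p, ∑ q, W n (k + 1) ω i p * nbp σ σ' (d n) n (fun m => W n m ω) (X0 n) l0 a b k p q * W n (k + 1) ω i q) -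
        (nbp σ σ' (d n) n (fun m => W n m ω) (X0 n) l0 a b k).trace| ≤ δ * d n (k + 1) := by
  obtain ⟨D, hD, hd⟩ := bpnorm_ae H l0 k (by omega)
  obtain ⟨c', hc', htail⟩ := hanson_wright D δ hδ
  obtain ⟨c, C, hc, hC, hdim⟩ := H.dims (k + 1) hk
  obtain ⟨c2, C2, hc2, hC2, hdim2⟩ := H.dims k (by omega)
  have hσ := act_cont H.d1
  have hσ' := act_cont H.d2
  have hup : ∀ n (V : WS (d n)) y (a b : Fin n), nbp σ σ' (d n) n (Function.update V (k + 1) y) (X0 n) l0 a b k = nbp σ σ' (d n) n V (X0 n) l0 a b k := by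
    intro n V y a b
    exact nbp_congr _ _ _ _ _ _ fun m hm => Function.update_of_ne (by omega) _ _
  have hcg : ∀ n (V V' : WS (d n)), (∀ m, m ≤ Lm → V m = V' m) → ∀ (a b : Fin n), nbp σ σ' (d n) n V (X0 n) l0 a b k = nbp σ σ' (d n) n V' (X0 n) l0 a b k :=
    fun n V V' hV a b => nbp_congr _ _ _ _ _ _ fun m hm => hV m (by omega)
  have key := step_W H.law (k + 1) hk (fun n V => ∀ a b : Fin n, opNorm (nbp σ σ' (d n) n V (X0 n) l0 a b k) ≤ D)
    (fun n V => ∃ (a b : Fin n) (i : Fin (d n (k + 2))), δ * d n (k + 1) <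
      |(∑ p, ∑ q, V (k + 1) i p * nbp σ σ' (d n) n V (X0 n) l0 a b k p q * V (k + 1) i q) - (nbp σ σ' (d n) n V (X0 n) l0 a b k).trace|)
    (fun n V y h a b => by rw [hup]; exact h a b)
    (fun n V V' hV h a b => by rw [← hcg n V V' hV]; exact h a b)
    (fun n V V' hV h => by
      obtain ⟨a, b, i, h⟩ := h
      refine ⟨a, b, i, ?_⟩
      rw [← hcg n V V' hV, ← hV (k + 1) hk]; exact h)
    (fun n => measurableSet_setOfPred.2 (Measurable.and
      (Measurable.forall fun a => Measurable.forall fun b => meas_le (continuous_opNorm.comp (nbp_cont hσ hσ' l0 a b k)) continuous_const)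
      (Measurable.exists fun a => Measurable.exists fun b => Measurable.exists fun i => meas_lt continuous_const (by
        have h1 := nbp_cont (d := d n) (X0 := X0 n) hσ hσ' l0 a b k
        have h2 : ∀ p q, Continuous fun V : WS (d n) => nbp σ σ' (d n) n V (X0 n) l0 a b k p q := fun p q =>
          (continuous_apply q).comp ((continuous_apply p).comp h1)
        have h3 := h1.matrix_trace
        have h4 : ∀ p, Continuous fun V : WS (d n) => V (k + 1) i p := fun p => by fun_prop
        fun_prop))))
    (fun n => (2 * C) * ((n : ℝ) ^ 3 * Real.exp (-((c' * c2) * n)))) (sum_exp 3 (by positivity) _) ?_ hd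
  · filter_upwards [key] with ω h
    filter_upwards [h] with n hn a b i
    push Not at hn
    exact hn a b i
  · filter_upwards [hdim, hdim2] with n hn hn2 V hV
    simp only [hup, Function.update_self]
    have hsub : {Y : Fin (d n (k + 2)) → Fin (d n (k + 1)) → ℝ | ∃ (a b : Fin n) (i : Fin (d n (k + 2))), δ * d n (k + 1) <
          |(∑ p, ∑ q, Y i p * nbp σ σ' (d n) n V (X0 n) l0 a b k p q * Y i q) - (nbp σ σ' (d n) n V (X0 n) l0 a b k).trace|} ⊆
        ⋃ x : Fin n × Fin n × Fin (d n (k + 2)), {Y | Y x.2.2 ∈ {w | δ * d n (k + 1) <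
          |(∑ p, ∑ q, w p * nbp σ σ' (d n) n V (X0 n) l0 x.1 x.2.1 k p q * w q) - (nbp σ σ' (d n) n V (X0 n) l0 x.1 x.2.1 k).trace|}} := by
      rintro Y ⟨a, b, i, h⟩
      exact Set.mem_iUnion.2 ⟨(a, b, i), h⟩
    have one : ∀ x : Fin n × Fin n × Fin (d n (k + 2)), gaussianMat (d n (k + 2)) (d n (k + 1)) {Y | Y x.2.2 ∈ {w | δ * d n (k + 1) <
          |(∑ p, ∑ q, w p * nbp σ σ' (d n) n V (X0 n) l0 x.1 x.2.1 k p q * w q) - (nbp σ σ' (d n) n V (X0 n) l0 x.1 x.2.1 k).trace|}} ≤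
        ENNReal.ofReal (2 * Real.exp (-(c' * d n (k + 1)))) := by
      intro x
      have hVx := hV x.1 x.2.1
      generalize nbp σ σ' (d n) n V (X0 n) l0 x.1 x.2.1 k = A at hVx ⊢
      exact (row_le _ _).trans (htail (d n (k + 1)) A hVx)
    refine (measure_mono hsub).trans ((measure_iUnion_fintype_le _ _).trans
      ((Finset.sum_le_sum fun x _ => one x).trans ?_))
    rw [Finset.sum_const, nsmul_eq_mul]
    have e : ((Finset.univ : Finset (Fin n × Fin n × Fin (d n (k + 2)))).card : ENNReal) = ENNReal.ofReal ((n : ℝ) * (n * d n (k + 2))) := by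
      rw [ENNReal.ofReal_mul (by positivity), ENNReal.ofReal_mul (by positivity)]; simp
    rw [e, ← ENNReal.ofReal_mul (by positivity)]
    refine ENNReal.ofReal_le_ofReal ?_
    have h1 : Real.exp (-(c' * d n (k + 1))) ≤ Real.exp (-((c' * c2) * n)) := by
      refine Real.exp_le_exp.2 ?_
      have := mul_le_mul_of_nonneg_left hn2.1 hc'.le
      linarith
    calc (n : ℝ) * (n * d n (k + 2)) * (2 * Real.exp (-(c' * d n (k + 1))))
        ≤ (n : ℝ) * (n * (C * n)) * (2 * Real.exp (-((c' * c2) * n))) := by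
          refine mul_le_mul ?_ (by linarith) (by positivity) (by positivity)
          have := hn.2
          have e2 : d n (k + 2) = d n (k + 1 + 1) := rfl
          rw [e2]
          exact mul_le_mul_of_nonneg_left (mul_le_mul_of_nonneg_left this (by positivity)) (by positivity)
      _ = _ := by ring

lemma quad_out (H : Hyp Lm d σ σ' σ'' lam Pr W wOut X0) (l0 : ℕ) (δ : ℝ) (hδ : 0 < δ) :
    ∀ᵐ ω ∂Pr, ∀ᶠ n in atTop, ∀ (a b : Fin n),
      |(∑ p, ∑ q, wOut n ω p * nbp σ σ' (d n) n (fun m => W n m ω) (X0 n) l0 a b Lm p q * wOut n ω q) -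
        (nbp σ σ' (d n) n (fun m => W n m ω) (X0 n) l0 a b Lm).trace| ≤ δ * d n (Lm + 1) := by
  obtain ⟨D, hD, hd⟩ := bpnorm_ae H l0 Lm le_rfl
  obtain ⟨c', hc', htail⟩ := hanson_wright D δ hδ
  obtain ⟨c2, C2, hc2, hC2, hdim2⟩ := H.dims Lm le_rfl
  have hσ := act_cont H.d1
  have hσ' := act_cont H.d2
  have hcg : ∀ n (V V' : WS (d n)), (∀ m, m ≤ Lm → V m = V' m) → ∀ (a b : Fin n), nbp σ σ' (d n) n V (X0 n) l0 a b Lm = nbp σ σ' (d n) n V' (X0 n) l0 a b Lm :=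
    fun n V V' hV a b => nbp_congr _ _ _ _ _ _ fun m hm => hV m (by omega)
  have key := step_out H.law (fun n V => ∀ a b : Fin n, opNorm (nbp σ σ' (d n) n V (X0 n) l0 a b Lm) ≤ D)
    (fun n V w => ∃ (a b : Fin n), δ * d n (Lm + 1) <
      |(∑ p, ∑ q, w p * nbp σ σ' (d n) n V (X0 n) l0 a b Lm p q * w q) - (nbp σ σ' (d n) n V (X0 n) l0 a b Lm).trace|)
    (fun n V V' hV h a b => by rw [← hcg n V V' hV]; exact h a b)
    (fun n V V' w hV h => by
      obtain ⟨a, b, h⟩ := h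
      refine ⟨a, b, ?_⟩
      rw [← hcg n V V' hV]; exact h)
    (fun n => measurableSet_setOfPred.2 (Measurable.and
      (Measurable.forall fun a => Measurable.forall fun b => meas_le (continuous_opNorm.comp ((nbp_cont hσ hσ' l0 a b Lm).comp continuous_fst)) continuous_const)
      (Measurable.exists fun a => Measurable.exists fun b => meas_lt continuous_const (by
        have h1 := (nbp_cont (d := d n) (X0 := X0 n) hσ hσ' l0 a b Lm).comp (continuous_fst (X := WS (d n)) (Y := Fin (d n (Lm + 1)) → ℝ))
        have h2 : ∀ p q, Continuous fun V : WS (d n) × (Fin (d n (Lm + 1)) → ℝ) => nbp σ σ' (d n) n V.1 (X0 n) l0 a b Lm p q := fun p q =>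
          (continuous_apply q).comp ((continuous_apply p).comp h1)
        have h3 : Continuous fun V : WS (d n) × (Fin (d n (Lm + 1)) → ℝ) => (nbp σ σ' (d n) n V.1 (X0 n) l0 a b Lm).trace := h1.matrix_trace
        fun_prop))))
    (fun n => 2 * ((n : ℝ) ^ 2 * Real.exp (-((c' * c2) * n)))) (sum_exp 2 (by positivity) _) ?_ hd
  · filter_upwards [key] with ω h
    filter_upwards [h] with n hn a b
    push Not at hn
    exact hn a b
  · filter_upwards [hdim2] with n hn2 V hV
    have hsub : {w : Fin (d n (Lm + 1)) → ℝ | ∃ (a b : Fin n), δ * d n (Lm + 1) <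
          |(∑ p, ∑ q, w p * nbp σ σ' (d n) n V (X0 n) l0 a b Lm p q * w q) - (nbp σ σ' (d n) n V (X0 n) l0 a b Lm).trace|} ⊆
        ⋃ x : Fin n × Fin n, {w | δ * d n (Lm + 1) <
          |(∑ p, ∑ q, w p * nbp σ σ' (d n) n V (X0 n) l0 x.1 x.2 Lm p q * w q) - (nbp σ σ' (d n) n V (X0 n) l0 x.1 x.2 Lm).trace|} := by
      rintro Y ⟨a, b, h⟩
      exact Set.mem_iUnion.2 ⟨(a, b), h⟩
    have one : ∀ x : Fin n × Fin n, gaussianVec (d n (Lm + 1)) {w | δ * d n (Lm + 1) <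
          |(∑ p, ∑ q, w p * nbp σ σ' (d n) n V (X0 n) l0 x.1 x.2 Lm p q * w q) - (nbp σ σ' (d n) n V (X0 n) l0 x.1 x.2 Lm).trace|} ≤
        ENNReal.ofReal (2 * Real.exp (-(c' * d n (Lm + 1)))) := by
      intro x
      have hVx := hV x.1 x.2
      generalize nbp σ σ' (d n) n V (X0 n) l0 x.1 x.2 Lm = A at hVx ⊢
      exact htail (d n (Lm + 1)) A hVx
    refine (measure_mono hsub).trans ((measure_iUnion_fintype_le _ _).trans
      ((Finset.sum_le_sum fun x _ => one x).trans ?_))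
    rw [Finset.sum_const, nsmul_eq_mul]
    have e : ((Finset.univ : Finset (Fin n × Fin n)).card : ENNReal) = ENNReal.ofReal ((n : ℝ) ^ 2) := by
      rw [ENNReal.ofReal_pow (by positivity)]; simp [sq]
    rw [e, ← ENNReal.ofReal_mul (by positivity)]
    refine ENNReal.ofReal_le_ofReal ?_
    have h1 : Real.exp (-(c' * d n (Lm + 1))) ≤ Real.exp (-((c' * c2) * n)) := by
      refine Real.exp_le_exp.2 ?_
      have := mul_le_mul_of_nonneg_left hn2.1 hc'.le
      linarith
    have h2 := mul_le_mul_of_nonneg_left h1 (show (0 : ℝ) ≤ 2 * (n : ℝ) ^ 2 by positivity)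
    linarith

end bps

lemma trace_step (N : ℕ) (D1 lam M δ1 δ2 κ κm tr : ℝ) (hD : 0 < D1) (hM : |κm| ≤ M) (hl : 0 ≤ lam) (h1 : 0 ≤ δ1)
    (u v Q : Fin N → ℝ) (hu : ∀ i, |u i| ≤ lam) (hv : ∀ i, |v i| ≤ lam) (hQ : ∀ i, |Q i - tr| ≤ δ1 * D1)
    (htr : |tr - D1 * κm| ≤ δ1 * D1) (hc : |(∑ i, u i * v i) - N * κ| ≤ δ2 * N) :
    |D1⁻¹ * (∑ i, u i * v i * Q i) - N * (κ * κm)| ≤ (2 * δ1 * lam ^ 2 + M * δ2) * N := by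
  have e : D1⁻¹ * (∑ i, u i * v i * Q i) - N * (κ * κm) = (∑ i, u i * v i * (D1⁻¹ * Q i - κm)) + κm * ((∑ i, u i * v i) - N * κ) := by
    simp only [mul_sub, Finset.sum_sub_distrib, Finset.mul_sum]
    have e1 : ∑ i, u i * v i * κm = ∑ i, κm * (u i * v i) := Finset.sum_congr rfl fun i _ => by ring
    have e2 : ∑ i, D1⁻¹ * (u i * v i * Q i) = ∑ i, u i * v i * (D1⁻¹ * Q i) := Finset.sum_congr rfl fun i _ => by ring
    rw [e1, e2]; ring
  rw [e]
  refine (abs_add_le _ _).trans ?_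
  have t1 : |∑ i, u i * v i * (D1⁻¹ * Q i - κm)| ≤ (2 * δ1 * lam ^ 2) * N := by
    refine (Finset.abs_sum_le_sum_abs _ _).trans ?_
    have : ∀ i ∈ Finset.univ, |u i * v i * (D1⁻¹ * Q i - κm)| ≤ 2 * δ1 * lam ^ 2 := by
      intro i _
      have q : |D1⁻¹ * Q i - κm| ≤ 2 * δ1 := by
        have : D1⁻¹ * Q i - κm = D1⁻¹ * ((Q i - tr) + (tr - D1 * κm)) := by field_simp; ring
        rw [this, abs_mul, abs_of_pos (inv_pos.2 hD)]
        have := (abs_add_le (Q i - tr) (tr - D1 * κm)).trans (add_le_add (hQ i) htr)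
        have := mul_le_mul_of_nonneg_left this (inv_pos.2 hD).le
        refine this.trans (le_of_eq ?_)
        field_simp; ring
      rw [abs_mul, abs_mul]
      have := mul_le_mul (mul_le_mul (hu i) (hv i) (abs_nonneg _) hl) q (abs_nonneg _) (by positivity)
      refine this.trans (le_of_eq (by ring))
    refine (Finset.sum_le_card_nsmul _ _ _ this).trans (le_of_eq ?_)
    simp [mul_comm]
  have t2 : |κm * ((∑ i, u i * v i) - N * κ)| ≤ M * (δ2 * N) := by
    rw [abs_mul]
    exact mul_le_mul hM hc (abs_nonneg _) ((abs_nonneg _).trans hM)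
  linarith

lemma kap_bound (φ : ℝ → ℝ) : ∃ M : ℝ, 0 ≤ M ∧ ∀ {n : ℕ} (a b : Fin n), |kap φ a b| ≤ M := by
  refine ⟨|∫ t, φ t ^ 2 ∂(gaussianReal 0 1)| + (∫ t, φ t ∂(gaussianReal 0 1)) ^ 2, by positivity, ?_⟩
  intro n a b
  unfold kap
  split_ifs
  · nlinarith [sq_nonneg (∫ t, φ t ∂(gaussianReal 0 1))]
  · rw [abs_of_nonneg (sq_nonneg _)]
    have := abs_nonneg (∫ t, φ t ^ 2 ∂(gaussianReal 0 1))
    linarith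

section tr
variable {Lm : ℕ} {d : ℕ → ℕ → ℕ} {σ σ' σ'' : ℝ → ℝ} {lam : ℝ} {Ω : Type*} [MeasurableSpace Ω] {Pr : Measure Ω} [IsProbabilityMeasure Pr]
  {W : (n : ℕ) → (ℓ : ℕ) → Ω → Fin (d n (ℓ + 1)) → Fin (d n ℓ) → ℝ}
  {wOut : (n : ℕ) → Ω → Fin (d n (Lm + 1)) → ℝ}
  {X0 : (n : ℕ) → Matrix (Fin (d n 0)) (Fin n) ℝ}

lemma trace_ae (H : Hyp Lm d σ σ' σ'' lam Pr W wOut X0) (l0 k : ℕ) (hlk : l0 ≤ k) (hk : k ≤ Lm) (δ : ℝ) (hδ : 0 < δ) :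
    ∀ᵐ ω ∂Pr, ∀ᶠ n in atTop, ∀ a b : Fin n,
      |(nbp σ σ' (d n) n (fun m => W n m ω) (X0 n) l0 a b k).trace - d n (k + 1) * kap σ' a b ^ (k - l0 + 1)| ≤ δ * d n (k + 1) := by
  induction k, hlk using Nat.le_induction generalizing δ with
  | base =>
    filter_upwards [corr_ae H l0 hk (layer_all H l0 (by omega)).1 H.d2 H.b2 δ hδ] with ω h
    filter_upwards [h] with n h a b
    have := h a b
    unfold nbp
    rw [bp_diag _ _ _ _ _ le_rfl, Matrix.trace_diagonal]
    simpa using this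
  | succ k hlk ih =>
    obtain ⟨M, hM, hMb⟩ := kap_bound σ'
    have hl := act_lam H.b1
    set δ1 := δ / (4 * (lam ^ 2 + 1)) with hδ1
    set δ2 := δ / (2 * (M ^ (k - l0 + 1) + 1)) with hδ2
    have p1 : 0 < δ1 := by positivity
    have p2 : 0 < δ2 := by positivity
    have b1 : 2 * δ1 * lam ^ 2 ≤ δ / 2 := by
      have : 2 * δ1 * (lam ^ 2 + 1) = δ / 2 := by rw [hδ1]; field_simp; norm_num
      nlinarith
    have b2 : M ^ (k - l0 + 1) * δ2 ≤ δ / 2 := by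
      have : (M ^ (k - l0 + 1) + 1) * δ2 = δ / 2 := by rw [hδ2]; field_simp
      nlinarith
    filter_upwards [corr_ae H (k + 1) hk (layer_all H (k + 1) (by omega)).1 H.d2 H.b2 δ2 p2, ih (by omega) δ1 p1, quad_ae H l0 k hk δ1 p1] with ω h1 h2 h3
    filter_upwards [h1, h2, h3, dpos H k (by omega)] with n h1 h2 h3 hd a b
    have key := trace_step (d n (k + 2)) (d n (k + 1)) lam (M ^ (k - l0 + 1)) δ1 δ2 (kap σ' a b) (kap σ' a b ^ (k - l0 + 1)) _ hd
      (by rw [abs_pow]; exact pow_le_pow_left₀ (abs_nonneg _) (hMb a b) _) hl p1.le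
      (fun i => σ' (preact σ (d n) n (fun m => W n m ω) (X0 n) (k + 1) i a)) (fun i => σ' (preact σ (d n) n (fun m => W n m ω) (X0 n) (k + 1) i b))
      _ (fun i => H.b1 _) (fun i => H.b1 _) (h3 a b) (h2 a b) (h1 a b)
    have e : k + 1 - l0 + 1 = (k - l0 + 1) + 1 := by omega
    rw [e, pow_succ' _ (k - l0 + 1)]
    have e3 : (nbp σ σ' (d n) n (fun m => W n m ω) (X0 n) l0 a b (k + 1)).trace = _ := bp_trace _ _ _ l0 k hlk
    rw [e3]
    refine key.trans (mul_le_mul_of_nonneg_right (by linarith) (by positivity))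

lemma sdot_ae (H : Hyp Lm d σ σ' σ'' lam Pr W wOut X0)
    (S : (n : ℕ) → Ω → (ℓ : ℕ) → Matrix (Fin (d n ℓ)) (Fin n) ℝ)
    (hStop : ∀ n ω (i : Fin (d n (Lm + 1))) (a : Fin n),
      S n ω (Lm + 1) i a =
        σ' (preact σ (d n) n (fun m => W n m ω) (X0 n) Lm i a) * wOut n ω i *
          (Real.sqrt (d n (Lm + 1)))⁻¹)
    (hSrec : ∀ n ω (ℓ : ℕ), ℓ < Lm → ∀ (i : Fin (d n (ℓ + 1))) (a : Fin n),
      S n ω (ℓ + 1) i a =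
        σ' (preact σ (d n) n (fun m => W n m ω) (X0 n) ℓ i a) *
          (Real.sqrt (d n (ℓ + 1)))⁻¹ *
          ∑ j, W n (ℓ + 1) ω j i * S n ω (ℓ + 2) j a)
    (l0 : ℕ) (hl0 : l0 ≤ Lm) (δ : ℝ) (hδ : 0 < δ) :
    ∀ᵐ ω ∂Pr, ∀ᶠ n in atTop, ∀ a b : Fin n,
      |(∑ i, S n ω (l0 + 1) i a * S n ω (l0 + 1) i b) - kap σ' a b ^ (Lm + 1 - l0)| ≤ δ := by
  filter_upwards [trace_ae H l0 Lm hl0 le_rfl (δ / 2) (by positivity), quad_out H l0 (δ / 2) (by positivity)] with ω h1 h2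
  filter_upwards [h1, h2, dpos H Lm le_rfl] with n h1 h2 hd a b
  have e : (∑ i, S n ω (l0 + 1) i a * S n ω (l0 + 1) i b) = (d n (Lm + 1) : ℝ)⁻¹ * ∑ i, ∑ j, wOut n ω i *
      nbp σ σ' (d n) n (fun m => W n m ω) (X0 n) l0 a b Lm i j * wOut n ω j :=
    bp_backprop Lm l0 hl0 (fun m => W n m ω) (fun k i => σ' (preact σ (d n) n (fun m => W n m ω) (X0 n) k i a))
      (fun k i => σ' (preact σ (d n) n (fun m => W n m ω) (X0 n) k i b)) (wOut n ω) (fun k i => S n ω k i a) (fun k i => S n ω k i b)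
      (fun i => hStop n ω i a) (fun i => hStop n ω i b) (fun l hl i => hSrec n ω l hl i a) (fun l hl i => hSrec n ω l hl i b)
  rw [e]
  have h1 := h1 a b
  have h2 := h2 a b
  have ee : Lm - l0 + 1 = Lm + 1 - l0 := by omega
  rw [ee] at h1
  generalize (∑ i, ∑ j, wOut n ω i * nbp σ σ' (d n) n (fun m => W n m ω) (X0 n) l0 a b Lm i j * wOut n ω j) = Q at *
  generalize (nbp σ σ' (d n) n (fun m => W n m ω) (X0 n) l0 a b Lm).trace = t at *
  generalize kap σ' a b ^ (Lm + 1 - l0) = κ at *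
  have : (d n (Lm + 1) : ℝ)⁻¹ * Q - κ = (d n (Lm + 1) : ℝ)⁻¹ * ((Q - t) + (t - d n (Lm + 1) * κ)) := by field_simp; ring
  rw [this, abs_mul, abs_of_pos (inv_pos.2 hd)]
  have := (abs_add_le (Q - t) (t - d n (Lm + 1) * κ)).trans (add_le_add h2 h1)
  have := mul_le_mul_of_nonneg_left this (inv_pos.2 hd).le
  refine this.trans (le_of_eq ?_)
  field_simp; ring

end tr

lemma frobSq_trace {m n : ℕ} (X : Matrix (Fin m) (Fin n) ℝ) : frobSq X = (Xᵀ * X).trace := by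
  unfold frobSq Matrix.trace
  rw [Finset.sum_comm]
  refine Finset.sum_congr rfl fun i _ => ?_
  rw [Matrix.diag_apply, Matrix.mul_apply]
  exact Finset.sum_congr rfl fun j _ => by rw [Matrix.transpose_apply]; ring

lemma frobSq_orth {n : ℕ} (U V A : Matrix (Fin n) (Fin n) ℝ) (hU : U * Uᵀ = 1) (hV : V * Vᵀ = 1) :
    frobSq (Uᵀ * A * V) = frobSq A := by
  rw [frobSq_trace, frobSq_trace]
  simp only [Matrix.transpose_mul, Matrix.transpose_transpose]
  rw [Matrix.trace_mul_comm]
  have : Uᵀ * A * V * (Vᵀ * (Aᵀ * U)) = Uᵀ * (A * Aᵀ * U) := by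
    rw [Matrix.mul_assoc (Uᵀ * A), ← Matrix.mul_assoc V, hV, Matrix.one_mul]
    simp only [Matrix.mul_assoc]
  rw [this, Matrix.trace_mul_comm, Matrix.mul_assoc, hU, Matrix.mul_one, Matrix.trace_mul_comm]

lemma spec_real {n : ℕ} {K : Matrix (Fin n) (Fin n) ℝ} (h : K.IsHermitian) :
    ∃ U : Matrix (Fin n) (Fin n) ℝ, U * Uᵀ = 1 ∧ Uᵀ * U = 1 ∧ K * U = U * Matrix.diagonal h.eigenvalues ∧
      Uᵀ * K = Matrix.diagonal h.eigenvalues * Uᵀ := by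
  have h1 : (h.eigenvectorUnitary : Matrix (Fin n) (Fin n) ℝ) * (h.eigenvectorUnitary : Matrix (Fin n) (Fin n) ℝ)ᵀ = 1 := by
    have := Unitary.coe_mul_star_self h.eigenvectorUnitary
    rwa [Unitary.coe_star, Matrix.star_eq_conjTranspose, Matrix.conjTranspose_eq_transpose_of_trivial] at this
  have h2 : (h.eigenvectorUnitary : Matrix (Fin n) (Fin n) ℝ)ᵀ * (h.eigenvectorUnitary : Matrix (Fin n) (Fin n) ℝ) = 1 := by
    have := Unitary.coe_star_mul_self h.eigenvectorUnitary
    rwa [Matrix.star_eq_conjTranspose, Matrix.conjTranspose_eq_transpose_of_trivial] at this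
  have h3 : K = (h.eigenvectorUnitary : Matrix (Fin n) (Fin n) ℝ) * Matrix.diagonal h.eigenvalues * (h.eigenvectorUnitary : Matrix (Fin n) (Fin n) ℝ)ᵀ := by
    have := h.spectral_theorem
    rw [Unitary.conjStarAlgAut_apply, Matrix.star_eq_conjTranspose, Matrix.conjTranspose_eq_transpose_of_trivial] at this
    exact this
  generalize (h.eigenvectorUnitary : Matrix (Fin n) (Fin n) ℝ) = U at h1 h2 h3
  generalize h.eigenvalues = lam at h3
  refine ⟨U, h1, h2, ?_, ?_⟩
  · rw [h3, Matrix.mul_assoc, h2, Matrix.mul_one]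
  · rw [h3, Matrix.mul_assoc, ← Matrix.mul_assoc, h2, Matrix.one_mul]

lemma orth_row {n : ℕ} {Q : Matrix (Fin n) (Fin n) ℝ} (h : Q * Qᵀ = 1) (i : Fin n) : ∑ j, Q i j ^ 2 = 1 := by
  have := congrFun (congrFun h i) i
  rw [Matrix.mul_apply, Matrix.one_apply_eq] at this
  rw [← this]
  exact Finset.sum_congr rfl fun j _ => by rw [Matrix.transpose_apply]; ring

lemma orth_col {n : ℕ} {Q : Matrix (Fin n) (Fin n) ℝ} (h : Qᵀ * Q = 1) (j : Fin n) : ∑ i, Q i j ^ 2 = 1 := by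
  have := congrFun (congrFun h j) j
  rw [Matrix.mul_apply, Matrix.one_apply_eq] at this
  rw [← this]
  exact Finset.sum_congr rfl fun j _ => by rw [Matrix.transpose_apply]; ring

lemma eig_bound {n : ℕ} {K : Matrix (Fin n) (Fin n) ℝ} (h : K.IsHermitian) {C : ℝ} (hC : opNorm K ≤ C) (i : Fin n) : |h.eigenvalues i| ≤ C := by
  obtain ⟨U, h1, h2, h3, _⟩ := spec_real h
  have := opNorm_bound' hC (fun j => U j i)
  rw [orth_col h2, mul_one] at this
  have e : ∀ a, ∑ j, K a j * U j i = U a i * h.eigenvalues i := by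
    intro a
    have := congrFun (congrFun h3 a) i
    rwa [Matrix.mul_apply, Matrix.mul_diagonal] at this
  simp only [e, mul_pow] at this
  rw [← Finset.sum_mul, orth_col h2, one_mul] at this
  exact abs_le_of_sq_le_sq this ((opNorm_nonneg _).trans hC)

lemma esd_diff {n : ℕ} (hn : 0 < n) {K T : Matrix (Fin n) (Fin n) ℝ} (hK : K.IsHermitian) (hT : T.IsHermitian) (f : ℝ → ℝ) (C η M : ℝ)
    (hC : opNorm K ≤ C) (hf : ∀ x y, |x| ≤ C → |f x - f y| ≤ η + M * (x - y) ^ 2) :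
    |esd K f - esd T f| ≤ η + M * ((n : ℝ)⁻¹ * frobSq (K - T)) := by
  unfold esd
  rw [dif_pos hK, dif_pos hT]
  have hb := eig_bound hK hC
  obtain ⟨U, u1, u2, u3, u4⟩ := spec_real hK
  obtain ⟨V, v1, v2, v3, v4⟩ := spec_real hT
  generalize hK.eigenvalues = lam at *
  generalize hT.eigenvalues = mu at *
  set Q := Uᵀ * V with hQ
  have q1 : Q * Qᵀ = 1 := by
    rw [hQ, Matrix.transpose_mul, Matrix.transpose_transpose, Matrix.mul_assoc, ← Matrix.mul_assoc V, v1, Matrix.one_mul, u2]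
  have q2 : Qᵀ * Q = 1 := by
    rw [hQ, Matrix.transpose_mul, Matrix.transpose_transpose, Matrix.mul_assoc, ← Matrix.mul_assoc U, u1, Matrix.one_mul, v2]
  have hF : frobSq (K - T) = ∑ i, ∑ j, (lam i - mu j) ^ 2 * Q i j ^ 2 := by
    rw [← frobSq_orth U V (K - T) u1 v1]
    have : Uᵀ * (K - T) * V = Matrix.diagonal lam * Q - Q * Matrix.diagonal mu := by
      rw [Matrix.mul_sub, Matrix.sub_mul, u4, Matrix.mul_assoc, Matrix.mul_assoc, v3, hQ, Matrix.mul_assoc]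
    rw [this]
    unfold frobSq
    refine Finset.sum_congr rfl fun i _ => Finset.sum_congr rfl fun j _ => ?_
    rw [Matrix.sub_apply, Matrix.diagonal_mul, Matrix.mul_diagonal]; ring
  have e1 : ∑ i, f (lam i) = ∑ i, ∑ j, f (lam i) * Q i j ^ 2 := by
    refine Finset.sum_congr rfl fun i _ => ?_
    rw [← Finset.mul_sum, orth_row q1, mul_one]
  have e2 : ∑ j, f (mu j) = ∑ i, ∑ j, f (mu j) * Q i j ^ 2 := by
    rw [Finset.sum_comm]
    refine Finset.sum_congr rfl fun i _ => ?_
    rw [← Finset.mul_sum, orth_col q2, mul_one]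
  have e3 : ∑ i, ∑ j, Q i j ^ 2 = n := by
    simp [orth_row q1]
  have n0 : (0 : ℝ) < n := by exact_mod_cast hn
  rw [← mul_sub, abs_mul, abs_of_pos (inv_pos.2 n0), e1, e2, ← Finset.sum_sub_distrib]
  simp only [← Finset.sum_sub_distrib]
  have main : |∑ i, ∑ j, (f (lam i) * Q i j ^ 2 - f (mu j) * Q i j ^ 2)| ≤ η * n + M * frobSq (K - T) := by
    refine (Finset.abs_sum_le_sum_abs _ _).trans ((Finset.sum_le_sum fun i _ => Finset.abs_sum_le_sum_abs _ _).trans ?_)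
    rw [← e3, hF]
    simp only [Finset.mul_sum, ← Finset.sum_add_distrib]
    refine Finset.sum_le_sum fun i _ => Finset.sum_le_sum fun j _ => ?_
    rw [← sub_mul, abs_mul, abs_of_nonneg (sq_nonneg (Q i j))]
    have := mul_le_mul_of_nonneg_right (hf (lam i) (mu j) (hb i)) (sq_nonneg (Q i j))
    linarith
  have := mul_le_mul_of_nonneg_left main (inv_pos.2 n0).le
  refine this.trans (le_of_eq ?_)
  field_simp

lemma bcf_mod (f : BoundedContinuousFunction ℝ ℝ) (C η : ℝ) (hη : 0 < η) :
    ∃ M : ℝ, 0 ≤ M ∧ ∀ x y, |x| ≤ C → |f x - f y| ≤ η + M * (x - y) ^ 2 := by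
  have hK : IsCompact (Set.Icc (-(C + 1)) (C + 1)) := isCompact_Icc
  have hu := hK.uniformContinuousOn_of_continuous f.continuous.continuousOn
  rw [Metric.uniformContinuousOn_iff] at hu
  obtain ⟨δ, hδ, h⟩ := hu η hη
  set δ' := min δ 1 with hδ'
  have hp : 0 < δ' := by positivity
  refine ⟨2 * ‖f‖ / δ' ^ 2, by positivity, fun x y hx => ?_⟩
  have hxx := abs_le.1 hx
  by_cases hxy : |x - y| < δ'
  · have h3 : |x - y| < δ := hxy.trans_le (min_le_left _ _)
    have h4 := abs_lt.1 (hxy.trans_le (min_le_right _ _))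
    have := h x ⟨by linarith, by linarith⟩ y ⟨by linarith, by linarith⟩ (by rwa [Real.dist_eq])
    rw [Real.dist_eq] at this
    have : 0 ≤ 2 * ‖f‖ / δ' ^ 2 * (x - y) ^ 2 := by positivity
    linarith
  · push Not at hxy
    have h1 : |f x - f y| ≤ 2 * ‖f‖ := by
      have := f.norm_coe_le_norm x
      have := f.norm_coe_le_norm y
      have := norm_sub_le (f x) (f y)
      rw [← Real.norm_eq_abs]; linarith
    have h2 : δ' ^ 2 ≤ (x - y) ^ 2 := by
      rw [← sq_abs (x - y)]; exact pow_le_pow_left₀ hp.le hxy 2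
    have h3 : 2 * ‖f‖ ≤ 2 * ‖f‖ / δ' ^ 2 * (x - y) ^ 2 := by
      rw [div_mul_eq_mul_div, le_div_iff₀ (by positivity)]
      exact mul_le_mul_of_nonneg_left h2 (by positivity)
    linarith

lemma esd_tendsto (K T : (n : ℕ) → Matrix (Fin n) (Fin n) ℝ) (hK : ∀ n, (K n).IsHermitian) (hT : ∀ n, (T n).IsHermitian) (C : ℝ)
    (hC : ∀ᶠ n in atTop, opNorm (K n) ≤ C) (hF : Tendsto (fun n : ℕ => (n : ℝ)⁻¹ * frobSq (K n - T n)) atTop (𝓝 0))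
    (f : BoundedContinuousFunction ℝ ℝ) : Tendsto (fun n => esd (K n) f - esd (T n) f) atTop (𝓝 0) := by
  rw [Metric.tendsto_atTop']
  intro η hη
  obtain ⟨M, hM, hf⟩ := bcf_mod f C (η / 2) (by positivity)
  have h1 := hF.const_mul M
  rw [mul_zero] at h1
  have h2 := h1.eventually (gt_mem_nhds (show (0 : ℝ) < η / 2 by positivity))
  have h3 : ∀ᶠ n : ℕ in atTop, dist (esd (K n) f - esd (T n) f) 0 < η := by
    filter_upwards [h2, hC, eventually_gt_atTop 0] with n h2 hC hn
    rw [Real.dist_eq, sub_zero]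
    have := esd_diff hn (hK n) (hT n) f C (η / 2) M hC hf
    linarith
  obtain ⟨N, hN⟩ := eventually_atTop.1 h3
  exact ⟨N, fun n hn => hN n hn.le⟩

lemma frobSq_mul_le {m n p : ℕ} (X : Matrix (Fin m) (Fin n) ℝ) (Y : Matrix (Fin n) (Fin p) ℝ) {C : ℝ} (h : opNorm X ≤ C) :
    frobSq (X * Y) ≤ C ^ 2 * frobSq Y := by
  unfold frobSq
  rw [Finset.sum_comm, Finset.sum_comm (f := fun i j => Y i j ^ 2), Finset.mul_sum]
  refine Finset.sum_le_sum fun j _ => ?_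
  simpa only [Matrix.mul_apply] using opNorm_bound' h fun i => Y i j

lemma frobSq_sum_le {ι : Type*} {m n : ℕ} (s : Finset ι) (E : ι → Matrix (Fin m) (Fin n) ℝ) :
    frobSq (∑ l ∈ s, E l) ≤ s.card * ∑ l ∈ s, frobSq (E l) := by
  unfold frobSq
  rw [Finset.sum_comm, Finset.mul_sum]
  rw [Finset.sum_comm]
  have : ∑ l ∈ s, (s.card : ℝ) * ∑ i, ∑ j, E l i j ^ 2 = ∑ i, ∑ j, s.card * ∑ l ∈ s, E l i j ^ 2 := by
    simp only [Finset.mul_sum]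
    rw [Finset.sum_comm]
    refine Finset.sum_congr rfl fun i _ => ?_
    rw [Finset.sum_comm]
  rw [this]
  refine Finset.sum_le_sum fun i _ => Finset.sum_le_sum fun j _ => ?_
  rw [Matrix.sum_apply]
  exact sq_sum_le_card_mul_sum_sq

lemma opNorm_had {m p n : ℕ} (S : Matrix (Fin m) (Fin n) ℝ) (X : Matrix (Fin p) (Fin n) ℝ) (s B : ℝ) (hs0 : 0 ≤ s) (hB : 0 ≤ B)
    (hs : ∀ a, ∑ i, S i a * S i a ≤ s) (hX : opNorm X ≤ B) :
    opNorm (Matrix.hadamard (Sᵀ * S) (Xᵀ * X)) ≤ s * B ^ 2 := by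
  refine opNorm_le_of _ _ (by positivity) fun v => ?_
  have hG : opNorm (Xᵀ * X) ≤ B ^ 2 := by
    refine (opNorm_mul _ _).trans ?_
    rw [sq]
    exact mul_le_mul ((opNorm_transpose_le X).trans hX) hX (opNorm_nonneg _) hB
  set G := Xᵀ * X
  have e : ∀ a, ∑ b, Matrix.hadamard (Sᵀ * S) G a b * v b = ∑ i, S i a * ∑ b, G a b * (S i b * v b) := by
    intro a
    simp only [Matrix.hadamard_apply, Matrix.mul_apply, Matrix.transpose_apply, Finset.sum_mul, Finset.mul_sum]
    rw [Finset.sum_comm]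
    exact Finset.sum_congr rfl fun i _ => Finset.sum_congr rfl fun b _ => by ring
  have h1 : ∀ a, (∑ b, Matrix.hadamard (Sᵀ * S) G a b * v b) ^ 2 ≤ s * ∑ i, (∑ b, G a b * (S i b * v b)) ^ 2 := by
    intro a
    rw [e]
    refine (Finset.sum_mul_sq_le_sq_mul_sq _ _ _).trans ?_
    refine mul_le_mul_of_nonneg_right ?_ (Finset.sum_nonneg fun i _ => sq_nonneg _)
    simpa only [sq] using hs a
  refine (Finset.sum_le_sum fun a _ => h1 a).trans ?_
  rw [← Finset.mul_sum, Finset.sum_comm]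
  have h2 : ∑ i, ∑ a, (∑ b, G a b * (S i b * v b)) ^ 2 ≤ (B ^ 2) ^ 2 * (s * ∑ b, v b ^ 2) := by
    refine (Finset.sum_le_sum fun i _ => opNorm_bound' hG _).trans ?_
    rw [← Finset.mul_sum, Finset.sum_comm, Finset.mul_sum (f := fun b => v b ^ 2)]
    refine mul_le_mul_of_nonneg_left (Finset.sum_le_sum fun b _ => ?_) (show (0 : ℝ) ≤ (B ^ 2) ^ 2 by positivity)
    have : ∑ i, (S i b * v b) ^ 2 = (∑ i, S i b * S i b) * v b ^ 2 := by
      rw [Finset.sum_mul]; exact Finset.sum_congr rfl fun i _ => by ring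
    rw [this]
    exact mul_le_mul_of_nonneg_right (hs b) (sq_nonneg _)
  have := mul_le_mul_of_nonneg_left h2 hs0
  refine this.trans (le_of_eq (by ring))

lemma layer_err {m p n : ℕ} (S : Matrix (Fin m) (Fin n) ℝ) (X : Matrix (Fin p) (Fin n) ℝ) (r q δ B : ℝ) (hδ1 : δ ≤ 1) (hB : 0 ≤ B)
    (hd : ∀ a, |(∑ i, S i a * S i a) - r| ≤ δ) (ho : ∀ a b, a ≠ b → |(∑ i, S i a * S i b) - q| ≤ δ)
    (hX : NearO δ X) (hXB : opNorm X ≤ B) :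
    frobSq (Matrix.hadamard (Sᵀ * S) (Xᵀ * X) - ((r - q) • (1 : Matrix (Fin n) (Fin n) ℝ) + q • (Xᵀ * X))) ≤
      δ ^ 2 * (4 * B ^ 2 + 2 * (r - q) ^ 2) * n := by
  have hfX : frobSq X ≤ 2 * n := by
    unfold frobSq
    rw [Finset.sum_comm]
    have : ∀ a ∈ Finset.univ, ∑ i, X i a ^ 2 ≤ 2 := fun a _ => by
      have := (abs_le.1 (hX.1 a)).2; linarith
    refine (Finset.sum_le_card_nsmul _ _ _ this).trans (le_of_eq ?_)
    simp [mul_comm]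
  have hG : frobSq (Xᵀ * X) ≤ B ^ 2 * (2 * n) :=
    (frobSq_mul_le _ _ ((opNorm_transpose_le X).trans hXB)).trans (mul_le_mul_of_nonneg_left hfX (by positivity))
  have ent : ∀ a b, (Matrix.hadamard (Sᵀ * S) (Xᵀ * X) - ((r - q) • (1 : Matrix (Fin n) (Fin n) ℝ) + q • (Xᵀ * X))) a b ^ 2 ≤
      2 * δ ^ 2 * (Xᵀ * X) a b ^ 2 + if a = b then 2 * (r - q) ^ 2 * δ ^ 2 else 0 := by
    intro a b
    have es : (Sᵀ * S) a b = ∑ i, S i a * S i b := by simp [Matrix.mul_apply]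
    simp only [Matrix.sub_apply, Matrix.add_apply, Matrix.smul_apply, Matrix.hadamard_apply, smul_eq_mul, es]
    by_cases hab : a = b
    · subst hab
      have ex : (Xᵀ * X) a a = ∑ i, X i a ^ 2 := by simp [Matrix.mul_apply, sq]
      have h1 := hd a
      have h2 := hX.1 a
      rw [ex, if_pos rfl, Matrix.one_apply_eq]
      generalize (∑ i, X i a ^ 2) = x at *
      generalize (∑ i, S i a * S i a) = y at *
      have k1 : (y - r) ^ 2 ≤ δ ^ 2 := sq_le_sq' (abs_le.1 h1).1 (abs_le.1 h1).2
      have k2 : (x - 1) ^ 2 ≤ δ ^ 2 := sq_le_sq' (abs_le.1 h2).1 (abs_le.1 h2).2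
      have k3 := mul_le_mul_of_nonneg_right k1 (sq_nonneg x)
      have k4 := mul_le_mul_of_nonneg_left k2 (sq_nonneg (r - q))
      have e : y * x - ((r - q) * 1 + q * x) = (y - r) * x + (r - q) * (x - 1) := by ring
      rw [e]
      nlinarith [sq_nonneg ((y - r) * x - (r - q) * (x - 1))]
    · have h1 := ho a b hab
      rw [if_neg hab, Matrix.one_apply_ne hab]
      generalize (∑ i, S i a * S i b) = y at *
      generalize (Xᵀ * X) a b = x at *
      have k1 : (y - q) ^ 2 ≤ δ ^ 2 := sq_le_sq' (abs_le.1 h1).1 (abs_le.1 h1).2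
      have k3 := mul_le_mul_of_nonneg_right k1 (sq_nonneg x)
      have e : y * x - ((r - q) * 0 + q * x) = (y - q) * x := by ring
      rw [e]
      nlinarith [mul_nonneg (sq_nonneg δ) (sq_nonneg x)]
  have hsum := Finset.sum_le_sum fun a (_ : a ∈ (Finset.univ : Finset (Fin n))) => Finset.sum_le_sum fun b (_ : b ∈ (Finset.univ : Finset (Fin n))) => ent a b
  refine (show frobSq _ ≤ _ from hsum).trans ?_
  simp only [Finset.sum_add_distrib, ← Finset.mul_sum, Finset.sum_ite_eq, Finset.mem_univ, if_true, Finset.sum_const, Finset.card_univ, Fintype.card_fin, nsmul_eq_mul]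
  have : ∑ a, ∑ b, (Xᵀ * X) a b ^ 2 ≤ B ^ 2 * (2 * n) := hG
  have := mul_le_mul_of_nonneg_left this (show 0 ≤ 2 * δ ^ 2 by positivity)
  linarith

lemma herm_gram {m n : ℕ} (X : Matrix (Fin m) (Fin n) ℝ) : (Xᵀ * X).IsHermitian := by
  unfold Matrix.IsHermitian
  rw [Matrix.conjTranspose_eq_transpose_of_trivial, Matrix.transpose_mul, Matrix.transpose_transpose]

lemma herm_had {n : ℕ} {A B : Matrix (Fin n) (Fin n) ℝ} (hA : A.IsHermitian) (hB : B.IsHermitian) : (Matrix.hadamard A B).IsHermitian := by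
  refine Matrix.IsHermitian.ext fun i j => ?_
  have h1 := hA.apply i j
  have h2 := hB.apply i j
  simp only [star_trivial, Matrix.hadamard_apply] at *
  rw [h1, h2]

lemma herm_sum {ι : Type*} {n : ℕ} (s : Finset ι) (A : ι → Matrix (Fin n) (Fin n) ℝ) (h : ∀ l, (A l).IsHermitian) : (∑ l ∈ s, A l).IsHermitian := by
  unfold Matrix.IsHermitian
  rw [Matrix.conjTranspose_sum]
  exact Finset.sum_congr rfl fun l _ => h l

lemma herm_smul {n : ℕ} (c : ℝ) {A : Matrix (Fin n) (Fin n) ℝ} (h : A.IsHermitian) : (c • A).IsHermitian := by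
  unfold Matrix.IsHermitian
  rw [Matrix.conjTranspose_smul, h, star_trivial]

lemma dims_of (dn : ℕ → ℕ) (g : ℝ) (hg : 0 < g) (h : Tendsto (fun n : ℕ => (n : ℝ) / (dn n : ℝ)) atTop (𝓝 g)) :
    ∃ c C : ℝ, 0 < c ∧ 0 < C ∧ ∀ᶠ n : ℕ in atTop, c * n ≤ dn n ∧ (dn n : ℝ) ≤ C * n := by
  refine ⟨(2 * g)⁻¹, (g / 2)⁻¹, by positivity, by positivity, ?_⟩
  filter_upwards [h.eventually (gt_mem_nhds (show g < 2 * g by linarith)), h.eventually (lt_mem_nhds (show g / 2 < g by linarith))] with n h1 h2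
  have hd : (0 : ℝ) < dn n := by
    rcases (Nat.cast_nonneg (α := ℝ) (dn n)).eq_or_lt with h0 | h0
    · rw [← h0, div_zero] at h2; linarith
    · exact h0
  rw [div_lt_iff₀ hd] at h1
  rw [lt_div_iff₀ hd] at h2
  constructor
  · rw [inv_mul_le_iff₀ (by positivity)]; exact h1.le
  · rw [le_inv_mul_iff₀ (by positivity)]; exact h2.le

theorem ntk_approximation
    -- the number of layers is `L = Lm + 1 ≥ 1`
    (Lm : ℕ)
    (d : ℕ → ℕ → ℕ)
    (σ σ' σ'' : ℝ → ℝ) (lamσ : ℝ)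
    (hderiv1 : ∀ x, HasDerivAt σ (σ' x) x)
    (hderiv2 : ∀ x, HasDerivAt σ' (σ'' x) x)
    (hσ'bdd : ∀ x, |σ' x| ≤ lamσ) (hσ''bdd : ∀ x, |σ'' x| ≤ lamσ)
    (hmean : (∫ x, σ x ∂stdGaussian) = 0)
    (hvar : (∫ x, (σ x) ^ 2 ∂stdGaussian) = 1)
    (bσ aσ : ℝ)
    (hbσ : bσ = ∫ x, σ' x ∂stdGaussian) (haσ : aσ = ∫ x, (σ' x) ^ 2 ∂stdGaussian)
    (Ω : Type*) [MeasurableSpace Ω] (Pr : Measure Ω) [IsProbabilityMeasure Pr]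
    (W : (n : ℕ) → (ℓ : ℕ) → Ω → Fin (d n (ℓ + 1)) → Fin (d n ℓ) → ℝ)
    (wOut : (n : ℕ) → Ω → Fin (d n (Lm + 1)) → ℝ)
    (hW : ∀ n : ℕ,
      Measure.map (fun ω => (fun ℓ : Fin (Lm + 1) => W n ℓ ω, wOut n ω)) Pr =
        (Measure.pi fun ℓ : Fin (Lm + 1) =>
          gaussianMat (d n ((ℓ : ℕ) + 1)) (d n (ℓ : ℕ))).prod
          (gaussianVec (d n (Lm + 1))))
    (X0 : (n : ℕ) → Matrix (Fin (d n 0)) (Fin n) ℝ)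
    (ε : ℕ → ℝ) (B : ℝ)
    (hX0orth : ∀ n, IsOrthonormal (ε n) B (X0 n))
    (hε : Tendsto (fun n : ℕ => ε n * (n : ℝ) ^ ((1 : ℝ) / 4)) atTop (𝓝 0))
    (γ : ℕ → ℝ) (hγ : ∀ ℓ, 1 ≤ ℓ → ℓ ≤ Lm + 1 → 0 < γ ℓ)
    (hdim : ∀ ℓ, 1 ≤ ℓ → ℓ ≤ Lm + 1 →
      Tendsto (fun n : ℕ => (n : ℝ) / (d n ℓ : ℝ)) atTop (𝓝 (γ ℓ)))
    -- the backpropagation matrices `S_ℓ`, defined by their recursion from layer `L` down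
    (S : (n : ℕ) → Ω → (ℓ : ℕ) → Matrix (Fin (d n ℓ)) (Fin n) ℝ)
    (hStop : ∀ n ω (i : Fin (d n (Lm + 1))) (a : Fin n),
      S n ω (Lm + 1) i a =
        σ' (preact σ (d n) n (fun m => W n m ω) (X0 n) Lm i a) * wOut n ω i *
          (Real.sqrt (d n (Lm + 1)))⁻¹)
    (hSrec : ∀ n ω (ℓ : ℕ), ℓ < Lm → ∀ (i : Fin (d n (ℓ + 1))) (a : Fin n),
      S n ω (ℓ + 1) i a =
        σ' (preact σ (d n) n (fun m => W n m ω) (X0 n) ℓ i a) *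
          (Real.sqrt (d n (ℓ + 1)))⁻¹ *
          ∑ j, W n (ℓ + 1) ω j i * S n ω (ℓ + 2) j a) :
    -- the NTK, its deterministic-coefficient approximation, and the conclusions
    let XX := fun (n : ℕ) (ω : Ω) (ℓ : ℕ) => netLayer σ (d n) n (fun m => W n m ω) (X0 n) ℓ
    let KNTK := fun (n : ℕ) (ω : Ω) =>
      (XX n ω (Lm + 1))ᵀ * XX n ω (Lm + 1) +
        ∑ ℓ ∈ Finset.range (Lm + 1),
          Matrix.hadamard ((S n ω (ℓ + 1))ᵀ * S n ω (ℓ + 1)) ((XX n ω ℓ)ᵀ * XX n ω ℓ)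
    let target := fun (n : ℕ) (ω : Ω) =>
      (∑ ℓ ∈ Finset.range (Lm + 1), (aσ ^ (Lm + 1 - ℓ) - (bσ ^ 2) ^ (Lm + 1 - ℓ))) •
          (1 : Matrix (Fin n) (Fin n) ℝ) +
        (XX n ω (Lm + 1))ᵀ * XX n ω (Lm + 1) +
        ∑ ℓ ∈ Finset.range (Lm + 1), ((bσ ^ 2) ^ (Lm + 1 - ℓ)) • ((XX n ω ℓ)ᵀ * XX n ω ℓ)
    -- (1/n)·‖K^NTK − target‖_F² → 0 almost surely
    (∀ᵐ ω ∂Pr,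
      Tendsto (fun n : ℕ => (n : ℝ)⁻¹ * frobSq (KNTK n ω - target n ω)) atTop (𝓝 0)) ∧
    -- ‖K^NTK‖ ≤ C almost surely for all large n
    (∃ C : ℝ, 0 < C ∧ ∀ᵐ ω ∂Pr, ∀ᶠ n : ℕ in atTop, opNorm (KNTK n ω) ≤ C) ∧
    -- consequently the two empirical spectral distributions have the same a.s. weak limits
    (∀ ν : Measure ℝ,
      (∀ᵐ ω ∂Pr, ∀ f : BoundedContinuousFunction ℝ ℝ,
        Tendsto (fun n : ℕ => esd (KNTK n ω) f) atTop (𝓝 (∫ x, f x ∂ν))) ↔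
      (∀ᵐ ω ∂Pr, ∀ f : BoundedContinuousFunction ℝ ℝ,
        Tendsto (fun n : ℕ => esd (target n ω) f) atTop (𝓝 (∫ x, f x ∂ν)))) := by
  intro XX KNTK target
  have H : Hyp Lm d σ σ' σ'' lamσ Pr W wOut X0 :=
    { d1 := hderiv1
      d2 := hderiv2
      b1 := hσ'bdd
      b2 := hσ''bdd
      mean := hmean
      var := hvar
      law := hW
      dims := fun k hk => dims_of (fun n => d n (k + 1)) (γ (k + 1)) (hγ (k + 1) (by omega) (by omega)) (hdim (k + 1) (by omega) (by omega))
      near0 := fun δ hδ => by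
        filter_upwards [hε.eventually (gt_mem_nhds hδ), eventually_ge_atTop 1] with n h1 h2
        have h3 : (1 : ℝ) ≤ (n : ℝ) ^ ((1 : ℝ) / 4) := Real.one_le_rpow (by exact_mod_cast h2) (by norm_num)
        have h4 : ε n ≤ δ := by
          rcases le_total 0 (ε n) with h | h
          · have := mul_le_mul_of_nonneg_left h3 h
            linarith
          · linarith
        exact ⟨fun a => ((hX0orth n).1 a).trans h4, fun a b hab => ((hX0orth n).2.1 a b hab).trans h4⟩
      four0 := ⟨B, (opNorm_nonneg _).trans (hX0orth 0).2.2.1, Eventually.of_forall fun n => (hX0orth n).2.2⟩ }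
  have hB : ∀ ℓ, ∃ b : ℝ, 0 ≤ b ∧ (ℓ ≤ Lm + 1 → ∀ᵐ ω ∂Pr, ∀ᶠ n in atTop, opNorm (XX n ω ℓ) ≤ b) := by
    intro ℓ
    by_cases h : ℓ ≤ Lm + 1
    · obtain ⟨b, hb, h2⟩ := (layer_all H ℓ h).2
      refine ⟨b, hb, fun _ => ?_⟩
      filter_upwards [h2] with ω h2
      filter_upwards [h2] with n h2
      exact h2.1
    · exact ⟨0, le_rfl, fun h' => absurd h' h⟩
  choose b hb0 hb using hB
  have hbb : ∀ᵐ ω ∂Pr, ∀ ℓ, ℓ ≤ Lm + 1 → ∀ᶠ n in atTop, opNorm (XX n ω ℓ) ≤ b ℓ := by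
    rw [ae_all_iff]; intro ℓ
    by_cases h : ℓ ≤ Lm + 1
    · filter_upwards [hb ℓ h] with ω h1 _
      exact h1
    · exact Eventually.of_forall fun ω h' => absurd h' h
  have hnear : ∀ᵐ ω ∂Pr, ∀ m : ℕ, ∀ ℓ, ℓ ≤ Lm → ∀ᶠ n in atTop, NearO (1 / ((m : ℝ) + 1)) (XX n ω ℓ) := by
    rw [ae_all_iff]; intro m
    rw [ae_all_iff]; intro ℓ
    by_cases h : ℓ ≤ Lm
    · filter_upwards [(layer_all H ℓ (by omega)).1 (1 / ((m : ℝ) + 1)) (by positivity)] with ω h1 _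
      exact h1
    · exact Eventually.of_forall fun ω h' => absurd h' h
  have hsd : ∀ᵐ ω ∂Pr, ∀ m : ℕ, ∀ ℓ, ℓ ≤ Lm → ∀ᶠ n in atTop, ∀ a c : Fin n,
      |(∑ i, S n ω (ℓ + 1) i a * S n ω (ℓ + 1) i c) - kap σ' a c ^ (Lm + 1 - ℓ)| ≤ 1 / ((m : ℝ) + 1) := by
    rw [ae_all_iff]; intro m
    rw [ae_all_iff]; intro ℓ
    by_cases h : ℓ ≤ Lm
    · filter_upwards [sdot_ae H S hStop hSrec ℓ h (1 / ((m : ℝ) + 1)) (by positivity)] with ω h1 _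
      exact h1
    · exact Eventually.of_forall fun ω h' => absurd h' h
  have kd : ∀ {n : ℕ} (a : Fin n), kap σ' a a = aσ := fun a => by rw [haσ]; exact if_pos rfl
  have ko : ∀ {n : ℕ} (a c : Fin n), a ≠ c → kap σ' a c = bσ ^ 2 := fun a c h => by rw [hbσ]; exact if_neg h
  have hKT : ∀ n ω, KNTK n ω - target n ω = ∑ ℓ ∈ Finset.range (Lm + 1),
      (Matrix.hadamard ((S n ω (ℓ + 1))ᵀ * S n ω (ℓ + 1)) ((XX n ω ℓ)ᵀ * XX n ω ℓ) -
        ((aσ ^ (Lm + 1 - ℓ) - (bσ ^ 2) ^ (Lm + 1 - ℓ)) • (1 : Matrix (Fin n) (Fin n) ℝ) + ((bσ ^ 2) ^ (Lm + 1 - ℓ)) • ((XX n ω ℓ)ᵀ * XX n ω ℓ))) := by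
    intro n ω
    rw [Finset.sum_sub_distrib, Finset.sum_add_distrib, ← Finset.sum_smul]
    simp only [KNTK, target]
    abel
  have hKh : ∀ n ω, (KNTK n ω).IsHermitian := fun n ω =>
    (herm_gram _).add (herm_sum _ _ fun ℓ => herm_had (herm_gram _) (herm_gram _))
  have hTh : ∀ n ω, (target n ω).IsHermitian := fun n ω =>
    ((herm_smul _ Matrix.isHermitian_one).add (herm_gram _)).add (herm_sum _ _ fun ℓ => herm_smul _ (herm_gram _))
  have c1 : ∀ᵐ ω ∂Pr, Tendsto (fun n : ℕ => (n : ℝ)⁻¹ * frobSq (KNTK n ω - target n ω)) atTop (𝓝 0) := by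
    filter_upwards [hbb, hnear, hsd] with ω h1 h2 h3
    set A : ℝ := ((Finset.range (Lm + 1)).card : ℝ) * ∑ ℓ ∈ Finset.range (Lm + 1),
      (4 * b ℓ ^ 2 + 2 * (aσ ^ (Lm + 1 - ℓ) - (bσ ^ 2) ^ (Lm + 1 - ℓ)) ^ 2) with hA
    have hA0 : 0 ≤ A := by positivity
    have main : ∀ m : ℕ, ∀ᶠ n : ℕ in atTop, (n : ℝ)⁻¹ * frobSq (KNTK n ω - target n ω) ≤ 1 / ((m : ℝ) + 1) * A := by
      intro m
      have e1 : ∀ᶠ n in atTop, ∀ ℓ ∈ Finset.range (Lm + 1), opNorm (XX n ω ℓ) ≤ b ℓ :=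
        (Filter.eventually_all_finset _).2 fun ℓ hℓ => h1 ℓ (by have := Finset.mem_range.1 hℓ; omega)
      have e2 : ∀ᶠ n in atTop, ∀ ℓ ∈ Finset.range (Lm + 1), NearO (1 / ((m : ℝ) + 1)) (XX n ω ℓ) :=
        (Filter.eventually_all_finset _).2 fun ℓ hℓ => h2 m ℓ (by have := Finset.mem_range.1 hℓ; omega)
      have e3 : ∀ᶠ n in atTop, ∀ ℓ ∈ Finset.range (Lm + 1), ∀ a c : Fin n,
          |(∑ i, S n ω (ℓ + 1) i a * S n ω (ℓ + 1) i c) - kap σ' a c ^ (Lm + 1 - ℓ)| ≤ 1 / ((m : ℝ) + 1) :=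
        (Filter.eventually_all_finset _).2 fun ℓ hℓ => h3 m ℓ (by have := Finset.mem_range.1 hℓ; omega)
      filter_upwards [e1, e2, e3, eventually_gt_atTop 0] with n e1 e2 e3 hn
      have n0 : (0 : ℝ) < n := by exact_mod_cast hn
      set δ : ℝ := 1 / ((m : ℝ) + 1) with hδ
      have hδ0 : 0 ≤ δ := by positivity
      have hδ1 : δ ≤ 1 := by
        rw [hδ, div_le_one (by positivity)]
        have : (0 : ℝ) ≤ m := Nat.cast_nonneg m
        linarith
      rw [inv_mul_le_iff₀ n0, hKT]
      refine (frobSq_sum_le _ _).trans ?_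
      have : ∀ ℓ ∈ Finset.range (Lm + 1), frobSq (Matrix.hadamard ((S n ω (ℓ + 1))ᵀ * S n ω (ℓ + 1)) ((XX n ω ℓ)ᵀ * XX n ω ℓ) -
        ((aσ ^ (Lm + 1 - ℓ) - (bσ ^ 2) ^ (Lm + 1 - ℓ)) • (1 : Matrix (Fin n) (Fin n) ℝ) + ((bσ ^ 2) ^ (Lm + 1 - ℓ)) • ((XX n ω ℓ)ᵀ * XX n ω ℓ))) ≤
          δ * n * (4 * b ℓ ^ 2 + 2 * (aσ ^ (Lm + 1 - ℓ) - (bσ ^ 2) ^ (Lm + 1 - ℓ)) ^ 2) := by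
        intro ℓ hℓ
        refine (layer_err _ _ _ _ δ (b ℓ) hδ1 (hb0 ℓ) (fun a => by have := e3 ℓ hℓ a a; rwa [kd] at this)
          (fun a c hac => by have := e3 ℓ hℓ a c; rwa [ko a c hac] at this) (e2 ℓ hℓ) (e1 ℓ hℓ)).trans ?_
        have h5 : δ ^ 2 ≤ δ := by nlinarith
        have h6 := mul_le_mul_of_nonneg_right h5 (show 0 ≤ (4 * b ℓ ^ 2 + 2 * (aσ ^ (Lm + 1 - ℓ) - (bσ ^ 2) ^ (Lm + 1 - ℓ)) ^ 2) * (n : ℝ) by positivity)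
        linarith
      have h7 := mul_le_mul_of_nonneg_left (Finset.sum_le_sum this) (show (0 : ℝ) ≤ (Finset.range (Lm + 1)).card by positivity)
      refine h7.trans (le_of_eq ?_)
      rw [← Finset.mul_sum, hA]; ring
    rw [Metric.tendsto_atTop']
    intro η hη
    obtain ⟨m, hm⟩ := exists_nat_one_div_lt (show 0 < η / (A + 1) by positivity)
    obtain ⟨N, hN⟩ := eventually_atTop.1 (main m)
    refine ⟨N, fun n hn => ?_⟩
    have h8 := hN n hn.le
    have h9 : 0 ≤ (n : ℝ)⁻¹ * frobSq (KNTK n ω - target n ω) :=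
      mul_nonneg (by positivity) (Finset.sum_nonneg fun i _ => Finset.sum_nonneg fun j _ => sq_nonneg _)
    rw [Real.dist_eq, sub_zero, abs_of_nonneg h9]
    rw [lt_div_iff₀ (by positivity)] at hm
    have h10 : (0 : ℝ) < 1 / ((m : ℝ) + 1) := by positivity
    nlinarith
  have c2 : ∃ C : ℝ, 0 < C ∧ ∀ᵐ ω ∂Pr, ∀ᶠ n : ℕ in atTop, opNorm (KNTK n ω) ≤ C := by
    refine ⟨b (Lm + 1) ^ 2 + ∑ ℓ ∈ Finset.range (Lm + 1), (|aσ ^ (Lm + 1 - ℓ)| + 1) * b ℓ ^ 2 + 1, by positivity, ?_⟩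
    filter_upwards [hbb, hsd] with ω h1 h3
    have e1 : ∀ᶠ n in atTop, ∀ ℓ ∈ Finset.range (Lm + 1), opNorm (XX n ω ℓ) ≤ b ℓ :=
      (Filter.eventually_all_finset _).2 fun ℓ hℓ => h1 ℓ (by have := Finset.mem_range.1 hℓ; omega)
    have e3 : ∀ᶠ n in atTop, ∀ ℓ ∈ Finset.range (Lm + 1), ∀ a c : Fin n,
        |(∑ i, S n ω (ℓ + 1) i a * S n ω (ℓ + 1) i c) - kap σ' a c ^ (Lm + 1 - ℓ)| ≤ 1 / (((0 : ℕ) : ℝ) + 1) :=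
      (Filter.eventually_all_finset _).2 fun ℓ hℓ => h3 0 ℓ (by have := Finset.mem_range.1 hℓ; omega)
    filter_upwards [e1, e3, h1 (Lm + 1) le_rfl] with n e1 e3 e4
    have t1 : opNorm ((XX n ω (Lm + 1))ᵀ * XX n ω (Lm + 1)) ≤ b (Lm + 1) ^ 2 := by
      refine (opNorm_mul _ _).trans ?_
      rw [sq]
      exact mul_le_mul ((opNorm_transpose_le _).trans e4) e4 (opNorm_nonneg _) (hb0 _)
    have t2 : opNorm (∑ ℓ ∈ Finset.range (Lm + 1),
          Matrix.hadamard ((S n ω (ℓ + 1))ᵀ * S n ω (ℓ + 1)) ((XX n ω ℓ)ᵀ * XX n ω ℓ)) ≤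
        ∑ ℓ ∈ Finset.range (Lm + 1), (|aσ ^ (Lm + 1 - ℓ)| + 1) * b ℓ ^ 2 := by
      refine (opNorm_sum _ _).trans (Finset.sum_le_sum fun ℓ hℓ => ?_)
      refine opNorm_had _ _ _ _ (by positivity) (hb0 ℓ) (fun a => ?_) (e1 ℓ hℓ)
      have h5 := (abs_le.1 (e3 ℓ hℓ a a)).2
      rw [kd, Nat.cast_zero, zero_add, div_one] at h5
      have h6 := le_abs_self (aσ ^ (Lm + 1 - ℓ))
      linarith
    have t3 := opNorm_add ((XX n ω (Lm + 1))ᵀ * XX n ω (Lm + 1)) (∑ ℓ ∈ Finset.range (Lm + 1),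
          Matrix.hadamard ((S n ω (ℓ + 1))ᵀ * S n ω (ℓ + 1)) ((XX n ω ℓ)ᵀ * XX n ω ℓ))
    refine t3.trans ?_
    linarith
  refine ⟨c1, c2, fun ν => ?_⟩
  obtain ⟨C, hC0, hC⟩ := c2
  have c3 : ∀ᵐ ω ∂Pr, ∀ f : BoundedContinuousFunction ℝ ℝ, Tendsto (fun n : ℕ => esd (KNTK n ω) f - esd (target n ω) f) atTop (𝓝 0) := by
    filter_upwards [c1, hC] with ω h1 h2 f
    exact esd_tendsto (fun n => KNTK n ω) (fun n => target n ω) (fun n => hKh n ω) (fun n => hTh n ω) C h2 h1 f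
  constructor
  · intro h
    filter_upwards [h, c3] with ω h1 h2 f
    have := (h1 f).sub (h2 f)
    simpa using this
  · intro h
    filter_upwards [h, c3] with ω h1 h2 f
    have := (h1 f).add (h2 f)
    simpa using this
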